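/- arXiv:2303.13460 — 5 statements merged into one kernel-verified Lean document; each statement's English description precedes it below -/
import Mathlib

section
/- Let A, N_1, …, N_q ∈ ℝ^{n×n}, B ∈ ℝ^{n×m}, C ∈ ℝ^{p×n}, and let K = (k_{ij}) ∈ ℝ^{q×q} be symmetric positive semidefinite. Assume (i) stabilizability: there exist a matrix F ∈ ℝ^{m×n} and a symmetric positive definite X ∈ ℝ^{n×n} with (A+BF)ᵀX + X(A+BF) + Σ_{i,j=1}^q N_iᵀ X N_j k_{ij} ≺ 0; and (ii) detectability (Hautus form): for every real λ ≥ 0 and every symmetric positive semidefinite V ≠ 0 with A V + V Aᵀ + Σ_{i,j=1}^q N_i V N_jᵀ k_{ij} = λV, one has CV ≠ 0. Then there exists a symmetric positive semidefinite matrix Q₊ satisfying the Riccati equation AᵀQ₊ + Q₊A + Σ_{i,j=1}^q N_iᵀ Q₊ N_j k_{ij} + CᵀC − Q₊BBᵀQ₊ = 0, which is stabilizing in the sense that there exists a symmetric positive definite Y with (A−BBᵀQ₊)ᵀY + Y(A−BBᵀQ₊) + Σ_{i,j=1}^q N_iᵀ Y N_j k_{ij} ≺ 0. -/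
open Matrix BigOperators

open Matrix BigOperators

namespace Matrix

section RealPosSemidef

variable {n m : Type*} [Fintype n] [Fintype m]

lemma posSemidef_iff_real {P : Matrix n n ℝ} :
    P.PosSemidef ↔ Pᵀ = P ∧ ∀ v, 0 ≤ v ⬝ᵥ (P *ᵥ v) := by
  simp [posSemidef_iff_dotProduct_mulVec, IsHermitian]

lemma posDef_iff_real {P : Matrix n n ℝ} :
    P.PosDef ↔ Pᵀ = P ∧ ∀ v, v ≠ 0 → 0 < v ⬝ᵥ (P *ᵥ v) := by
  simp [posDef_iff_dotProduct_mulVec, IsHermitian]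

lemma posSemidef_transpose_mul_self_real (G : Matrix m n ℝ) : (Gᵀ * G).PosSemidef := by
  simpa using posSemidef_conjTranspose_mul_self G

open scoped MatrixOrder in
lemma PosSemidef.exists_eq_transpose_mul_self {P : Matrix n n ℝ} (hP : P.PosSemidef) :
    ∃ G : Matrix n n ℝ, P = Gᵀ * G := by
  classical
  obtain ⟨G, hG⟩ := CStarAlgebra.nonneg_iff_eq_star_mul_self.mp hP.nonneg
  exact ⟨G, by simpa [star_eq_conjTranspose] using hG⟩

lemma trace_transpose_mul_self_mul (G : Matrix m n ℝ) (V : Matrix n n ℝ) :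
    (Gᵀ * G * V).trace = (G * V * Gᵀ).trace := by
  rw [trace_mul_cycle, trace_mul_cycle, Matrix.mul_assoc]

lemma PosSemidef.mul_mul_transpose_real {V : Matrix n n ℝ} (hV : V.PosSemidef)
    (G : Matrix m n ℝ) : (G * V * Gᵀ).PosSemidef := by
  simpa using hV.mul_mul_conjTranspose_same G

lemma PosSemidef.trace_mul_nonneg {P V : Matrix n n ℝ} (hP : P.PosSemidef)
    (hV : V.PosSemidef) : 0 ≤ (P * V).trace := by
  obtain ⟨G, rfl⟩ := hP.exists_eq_transpose_mul_self
  rw [trace_transpose_mul_self_mul]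
  exact (hV.mul_mul_transpose_real G).trace_nonneg

lemma PosSemidef.mul_eq_zero_of_trace {V : Matrix n n ℝ} (hV : V.PosSemidef)
    {G : Matrix m n ℝ} (h : (Gᵀ * G * V).trace = 0) : G * V = 0 := by
  rw [trace_transpose_mul_self_mul, (hV.mul_mul_transpose_real G).trace_eq_zero_iff] at h
  obtain ⟨H, rfl⟩ := hV.exists_eq_transpose_mul_self
  have h2 : G * Hᵀ * (G * Hᵀ)ᴴ = 0 := by
    simpa [Matrix.mul_assoc] using h
  rw [self_mul_conjTranspose_eq_zero] at h2
  rw [← Matrix.mul_assoc, h2, Matrix.zero_mul]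

lemma dotProduct_mulVec_eq_trace (V : Matrix n n ℝ) (v : n → ℝ) :
    v ⬝ᵥ (V *ᵥ v) = (V * vecMulVec v v).trace := by
  rw [mul_vecMulVec, trace_vecMulVec, dotProduct_comm]

lemma posSemidef_vecMulVec_real (v : n → ℝ) : (vecMulVec v v).PosSemidef := by
  simpa using posSemidef_vecMulVec_self_star v

lemma posSemidef_of_trace_mul_nonneg {V : Matrix n n ℝ} (hV : Vᵀ = V)
    (h : ∀ Z : Matrix n n ℝ, Z.PosSemidef → 0 ≤ (V * Z).trace) : V.PosSemidef :=
  posSemidef_iff_real.2 ⟨hV, fun v => by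
    rw [dotProduct_mulVec_eq_trace]; exact h _ (posSemidef_vecMulVec_real v)⟩

lemma PosSemidef.dotProduct_mulVec_le_trace {P : Matrix n n ℝ} (hP : P.PosSemidef)
    (v : n → ℝ) : v ⬝ᵥ (P *ᵥ v) ≤ P.trace * (v ⬝ᵥ v) := by
  obtain ⟨G, rfl⟩ := hP.exists_eq_transpose_mul_self
  have h1 : v ⬝ᵥ ((Gᵀ * G) *ᵥ v) = ∑ k, (∑ i, G k i * v i) ^ 2 := by
    rw [← mulVec_mulVec, dotProduct_mulVec, vecMul_transpose]
    simp [dotProduct, mulVec, sq]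
  have h2 : (Gᵀ * G).trace = ∑ k, ∑ i, G k i ^ 2 := by
    rw [trace_mul_comm]
    simp [trace, mul_apply, sq]
  rw [h1, h2, Finset.sum_mul]
  refine Finset.sum_le_sum fun k _ => ?_
  refine (Finset.sum_mul_sq_le_sq_mul_sq _ _ _).trans (le_of_eq ?_)
  simp [dotProduct, sq]

lemma PosSemidef.abs_apply_le_trace {P : Matrix n n ℝ} (hP : P.PosSemidef) (i j : n) :
    |P i j| ≤ P.trace := by
  classical
  have hd : ∀ k, P k k ≤ P.trace := fun k =>
    Finset.single_le_sum (f := fun k => P k k) (fun k _ => hP.diag_nonneg) (Finset.mem_univ k)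
  obtain ⟨hs, hq⟩ := posSemidef_iff_real.1 hP
  have hij : P j i = P i j := congrFun (congrFun hs i) j
  have h1 := hq (Pi.single i 1 + Pi.single j 1)
  have h2 := hq (Pi.single i 1 - Pi.single j 1)
  simp [mulVec_add, mulVec_sub, add_dotProduct, sub_dotProduct, hij] at h1 h2
  have := hd i
  have := hd j
  rw [abs_le]
  constructor <;> linarith

lemma isClosed_setOf_posSemidef : IsClosed {P : Matrix n n ℝ | P.PosSemidef} := by
  simp only [posSemidef_iff_real, Set.ofPred_and, Set.ofPred_forall]
  refine IsClosed.inter (isClosed_eq (by fun_prop) (by fun_prop)) (isClosed_iInter fun v =>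
    isClosed_le continuous_const ?_)
  fun_prop

lemma isCompact_setOf_posSemidef_trace_le (c : ℝ) :
    IsCompact {P : Matrix n n ℝ | P.PosSemidef ∧ P.trace ≤ c} := by
  have hK : IsCompact (Set.univ.pi fun _ : n => Set.univ.pi fun _ : n => Set.Icc (-c) c) :=
    isCompact_univ_pi fun _ => isCompact_univ_pi fun _ => isCompact_Icc
  refine IsCompact.of_isClosed_subset (X := Matrix n n ℝ) hK
    (isClosed_setOf_posSemidef.inter
      (isClosed_le (f := fun P : Matrix n n ℝ => P.trace) (by fun_prop) continuous_const)) ?_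
  rintro P ⟨hP, hc⟩ i - j -
  exact abs_le.1 ((hP.abs_apply_le_trace i j).trans hc)

/-- A linear map on square matrices that preserves symmetry and is injective on symmetric matrices
is surjective onto symmetric matrices. -/
lemma exists_symm_preimage (T : Matrix n n ℝ →ₗ[ℝ] Matrix n n ℝ)
    (hT : ∀ X, Xᵀ = X → (T X)ᵀ = T X) (hinj : ∀ X, Xᵀ = X → T X = 0 → X = 0)
    {Y : Matrix n n ℝ} (hY : Yᵀ = Y) : ∃ X, Xᵀ = X ∧ T X = Y := by
  let S : Submodule ℝ (Matrix n n ℝ) :=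
    { carrier := {X | Xᵀ = X}
      add_mem' := fun {a b} ha hb => by simp_all
      zero_mem' := by simp
      smul_mem' := fun c a ha => by simp_all }
  let T' : S →ₗ[ℝ] S := T.restrict (p := S) (q := S) hT
  have h1 : Function.Injective T' := by
    rw [← LinearMap.ker_eq_bot, LinearMap.ker_eq_bot']
    rintro ⟨X, hX⟩ h
    exact Subtype.ext (hinj X hX (congrArg Subtype.val h))
  obtain ⟨⟨X, hX⟩, h⟩ := LinearMap.surjective_of_injective h1 ⟨Y, hY⟩
  exact ⟨X, hX, congrArg Subtype.val h⟩

/-- If `X₀` is positive definite and the symmetric matrix `X` is not positive semidefinite, then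
the pencil `X + t X₀` becomes positive semidefinite and singular for some `t > 0`. -/
lemma exists_add_smul_posSemidef_singular {X X₀ : Matrix n n ℝ} (hX₀ : X₀.PosDef) (hX : Xᵀ = X)
    (hneg : ¬ X.PosSemidef) :
    ∃ t : ℝ, 0 < t ∧ (X + t • X₀).PosSemidef ∧ ∃ v, v ≠ 0 ∧ (X + t • X₀) *ᵥ v = 0 := by
  obtain ⟨hs, hpos⟩ := posDef_iff_real.1 hX₀
  have hneg' : ∃ w, w ⬝ᵥ (X *ᵥ w) < 0 := by
    by_contra! h
    exact hneg (posSemidef_iff_real.2 ⟨hX, h⟩)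
  obtain ⟨w, hw⟩ := hneg'
  have hw0 : w ≠ 0 := by rintro rfl; simp at hw
  let f : (n → ℝ) → ℝ := fun v => (v ⬝ᵥ (X *ᵥ v)) / (v ⬝ᵥ (X₀ *ᵥ v))
  have hhom : ∀ (c : ℝ) (v : n → ℝ), c ≠ 0 → f (c • v) = f v := by
    intro c v hc
    simp only [f, mulVec_smul, dotProduct_smul, smul_dotProduct, smul_eq_mul]
    rw [mul_div_mul_left _ _ hc, mul_div_mul_left _ _ hc]
  have hsph : ∀ v : n → ℝ, v ≠ 0 → ‖v‖⁻¹ • v ∈ Metric.sphere (0 : n → ℝ) 1 := by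
    intro v hv
    simp [norm_smul, norm_ne_zero_iff.2 hv]
  have hcont : ContinuousOn f (Metric.sphere (0 : n → ℝ) 1) := by
    refine ContinuousOn.div (by fun_prop) (by fun_prop) fun v hv => (hpos v ?_).ne'
    rintro rfl
    simp at hv
  obtain ⟨v, hv, hmin⟩ := (isCompact_sphere (0 : n → ℝ) 1).exists_isMinOn ⟨_, hsph w hw0⟩ hcont
  have hv0 : v ≠ 0 := by rintro rfl; simp at hv
  have hmin' : ∀ u, u ≠ 0 → f v ≤ f u := fun u hu => by
    have := hmin (hsph u hu)
    rwa [Set.mem_ofPred_eq, hhom _ _ (inv_ne_zero (norm_ne_zero_iff.2 hu))] at this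
  have hfv : f v < 0 := (hmin' w hw0).trans_lt (div_neg_of_neg_of_pos hw (hpos w hw0))
  have hq : ∀ u, u ⬝ᵥ ((X + (-f v) • X₀) *ᵥ u) = u ⬝ᵥ (X *ᵥ u) - f v * (u ⬝ᵥ (X₀ *ᵥ u)) := by
    intro u
    simp [add_mulVec, smul_mulVec, dotProduct_add, sub_eq_add_neg, neg_mulVec]
  have hpsd : (X + (-f v) • X₀).PosSemidef := by
    refine posSemidef_iff_real.2 ⟨by simp [hX, hs], fun u => ?_⟩
    rw [hq]
    by_cases hu : u = 0
    · simp [hu]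
    · have := (le_div_iff₀ (hpos u hu)).1 (hmin' u hu)
      linarith
  refine ⟨-f v, by linarith, hpsd, v, hv0, (hpsd.dotProduct_mulVec_zero_iff v).1 ?_⟩
  rw [star_trivial, hq, div_mul_cancel₀ _ (hpos v hv0).ne', sub_self]

end RealPosSemidef

/-- The generalized Lyapunov operator `X ↦ Aᵀ X + X A + ∑ k, (M k)ᵀ X (M k)`. -/
def lyapunovMap {n ι : Type*} [Fintype n] [Fintype ι] (A : Matrix n n ℝ) (M : ι → Matrix n n ℝ) :
    Matrix n n ℝ →ₗ[ℝ] Matrix n n ℝ where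
  toFun X := Aᵀ * X + X * A + ∑ k, (M k)ᵀ * X * M k
  map_add' X Y := by
    simp only [Matrix.mul_add, Matrix.add_mul, Finset.sum_add_distrib]
    abel
  map_smul' c X := by
    simp [Finset.smul_sum]

/-- The Lyapunov criterion for mean square asymptotic stability. -/
def IsMeanSquareStable {n ι : Type*} [Fintype n] [Fintype ι] (A : Matrix n n ℝ)
    (M : ι → Matrix n n ℝ) : Prop :=
  ∃ X : Matrix n n ℝ, X.PosDef ∧ (-lyapunovMap A M X).PosDef

section Lyapunov

variable {n ι : Type*} [Fintype n] [Fintype ι] {A : Matrix n n ℝ} {M : ι → Matrix n n ℝ}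

lemma lyapunovMap_apply (A : Matrix n n ℝ) (M : ι → Matrix n n ℝ) (X : Matrix n n ℝ) :
    lyapunovMap A M X = Aᵀ * X + X * A + ∑ k, (M k)ᵀ * X * M k := rfl

lemma transpose_lyapunovMap (A : Matrix n n ℝ) (M : ι → Matrix n n ℝ) (X : Matrix n n ℝ) :
    (lyapunovMap A M X)ᵀ = lyapunovMap A M Xᵀ := by
  simp only [lyapunovMap_apply, transpose_add, transpose_mul, transpose_sum, transpose_transpose,
    Matrix.mul_assoc]
  rw [add_comm (Xᵀ * A)]

lemma transpose_lyapunovMap_of_symm (A : Matrix n n ℝ) (M : ι → Matrix n n ℝ) {X : Matrix n n ℝ}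
    (hX : Xᵀ = X) : (lyapunovMap A M X)ᵀ = lyapunovMap A M X := by
  rw [transpose_lyapunovMap, hX]

/-- The trace-adjoint of a generalized Lyapunov operator is again one. -/
lemma trace_lyapunovMap_mul (A : Matrix n n ℝ) (M : ι → Matrix n n ℝ) (X V : Matrix n n ℝ) :
    (lyapunovMap A M X * V).trace = (X * lyapunovMap Aᵀ (fun k => (M k)ᵀ) V).trace := by
  simp only [lyapunovMap_apply, Matrix.add_mul, Matrix.mul_add, Matrix.sum_mul, Matrix.mul_sum,
    trace_add, trace_sum, transpose_transpose]
  have h1 : (Aᵀ * X * V).trace = (X * (V * Aᵀ)).trace := by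
    rw [Matrix.mul_assoc, trace_mul_comm, Matrix.mul_assoc]
  have h2 : ∀ k, ((M k)ᵀ * X * M k * V).trace = (X * (M k * V * (M k)ᵀ)).trace := fun k => by
    rw [Matrix.mul_assoc, Matrix.mul_assoc, trace_mul_comm]
    simp only [Matrix.mul_assoc]
  rw [h1, Finset.sum_congr rfl fun k _ => h2 k, Matrix.mul_assoc X A V]
  ring

lemma dotProduct_lyapunovMap_mulVec_nonneg {Z : Matrix n n ℝ} (hZ : Z.PosSemidef) {v : n → ℝ}
    (hv : Z *ᵥ v = 0) : 0 ≤ v ⬝ᵥ (lyapunovMap A M Z *ᵥ v) := by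
  obtain ⟨hs, hq⟩ := posSemidef_iff_real.1 hZ
  have hv' : v ᵥ* Z = 0 := by rw [← hs, vecMul_transpose, hv]
  have h1 : v ⬝ᵥ ((Z * A) *ᵥ v) = 0 := by
    rw [← mulVec_mulVec, dotProduct_mulVec, hv', zero_dotProduct]
  have h2 : v ⬝ᵥ ((Aᵀ * Z) *ᵥ v) = 0 := by
    rw [← mulVec_mulVec, hv, mulVec_zero, dotProduct_zero]
  rw [lyapunovMap_apply, add_mulVec, add_mulVec, dotProduct_add, dotProduct_add, h1, h2,
    sum_mulVec, dotProduct_sum]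
  simp only [zero_add]
  refine Finset.sum_nonneg fun k _ => ?_
  rw [← mulVec_mulVec, ← mulVec_mulVec, dotProduct_mulVec, vecMul_transpose]
  exact hq _

namespace IsMeanSquareStable

/-- Inverse positivity of the Lyapunov operator of a stable pair. -/
lemma posSemidef_of_neg_lyapunovMap (h : IsMeanSquareStable A M) {X : Matrix n n ℝ}
    (hX : Xᵀ = X) (hL : (-lyapunovMap A M X).PosSemidef) : X.PosSemidef := by
  obtain ⟨X₀, hX₀, hL₀⟩ := h
  by_contra hneg
  obtain ⟨t, ht, hpsd, v, hv0, hv⟩ := exists_add_smul_posSemidef_singular hX₀ hX hneg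
  have h1 := dotProduct_lyapunovMap_mulVec_nonneg (A := A) (M := M) hpsd hv
  have h2 := (posSemidef_iff_real.1 hL).2 v
  have h3 := (posDef_iff_real.1 hL₀).2 v hv0
  simp only [map_add, map_smul, add_mulVec, smul_mulVec, neg_mulVec, dotProduct_add,
    dotProduct_smul, dotProduct_neg, smul_eq_mul] at h1 h2 h3
  nlinarith [mul_pos ht h3]

lemma eq_zero_of_lyapunovMap_eq_zero (h : IsMeanSquareStable A M) {X : Matrix n n ℝ}
    (hX : Xᵀ = X) (hL : lyapunovMap A M X = 0) : X = 0 := by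
  have h1 := h.posSemidef_of_neg_lyapunovMap hX (by simpa [hL] using PosSemidef.zero)
  have h2 := h.posSemidef_of_neg_lyapunovMap (X := -X) (by simp [hX])
    (by simpa [hL] using PosSemidef.zero)
  refine h1.trace_eq_zero_iff.1 (le_antisymm ?_ h1.trace_nonneg)
  simpa using h2.trace_nonneg

lemma exists_lyapunovMap_eq_neg (h : IsMeanSquareStable A M) {P : Matrix n n ℝ}
    (hP : P.PosSemidef) : ∃ X : Matrix n n ℝ, X.PosSemidef ∧ lyapunovMap A M X = -P := by
  obtain ⟨X, hX, hXP⟩ := exists_symm_preimage (lyapunovMap A M)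
    (fun X hX => transpose_lyapunovMap_of_symm A M hX)
    (fun X hX h0 => h.eq_zero_of_lyapunovMap_eq_zero hX h0)
    (Y := -P) (by simp [(posSemidef_iff_real.1 hP).1])
  exact ⟨X, h.posSemidef_of_neg_lyapunovMap hX (by simpa [hXP] using hP), hXP⟩

lemma exists_adjoint_eq_neg (h : IsMeanSquareStable A M) {P : Matrix n n ℝ}
    (hP : P.PosSemidef) :
    ∃ V : Matrix n n ℝ, V.PosSemidef ∧ lyapunovMap Aᵀ (fun k => (M k)ᵀ) V = -P := by
  obtain ⟨V, hV, hVP⟩ := exists_symm_preimage (lyapunovMap Aᵀ fun k => (M k)ᵀ)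
    (fun X hX => transpose_lyapunovMap_of_symm _ _ hX) (fun V hV h0 => by
      obtain ⟨X, -, hXV⟩ := exists_symm_preimage (lyapunovMap A M)
        (fun X hX => transpose_lyapunovMap_of_symm A M hX)
        (fun X hX h0 => h.eq_zero_of_lyapunovMap_eq_zero hX h0) hV
      have h1 : (V * V).trace = 0 := by
        nth_rewrite 1 [← hXV]
        rw [trace_lyapunovMap_mul, h0, Matrix.mul_zero, trace_zero]
      refine trace_conjTranspose_mul_self_eq_zero_iff.1 ?_
      simpa [hV] using h1)
    (Y := -P) (by simp [(posSemidef_iff_real.1 hP).1])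
  refine ⟨V, posSemidef_of_trace_mul_nonneg hV fun Z hZ => ?_, hVP⟩
  obtain ⟨X, hX, hXZ⟩ := h.exists_lyapunovMap_eq_neg hZ
  have h1 := trace_lyapunovMap_mul A M X V
  rw [hXZ, hVP, Matrix.neg_mul, Matrix.mul_neg, trace_neg, trace_neg, neg_inj] at h1
  rw [trace_mul_comm, h1]
  exact hX.trace_mul_nonneg hP

end IsMeanSquareStable

lemma lyapunovMap_sub_smul_one [DecidableEq n] (A : Matrix n n ℝ) (M : ι → Matrix n n ℝ) (l : ℝ)
    (X : Matrix n n ℝ) :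
    lyapunovMap (A - (l / 2) • 1) M X = lyapunovMap A M X - l • X := by
  have : l • X = (l / 2) • X + (l / 2) • X := by rw [← add_smul, add_halves]
  simp only [lyapunovMap_apply, this, transpose_sub, transpose_smul, transpose_one,
    Matrix.sub_mul, Matrix.mul_sub, Matrix.smul_mul, Matrix.mul_smul, Matrix.one_mul,
    Matrix.mul_one]
  abel

lemma continuous_lyapunovMap (A : Matrix n n ℝ) (M : ι → Matrix n n ℝ) :
    Continuous (lyapunovMap A M) := by
  change Continuous fun X => Aᵀ * X + X * A + ∑ k, (M k)ᵀ * X * M k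
  fun_prop

/-- Stability of a shifted pair propagates downwards by the inverse trace of the resolvent. -/
lemma isMeanSquareStable_sub_of_trace_lt [DecidableEq n] {l η : ℝ} {X : Matrix n n ℝ}
    (hX : X.PosSemidef) (hL : lyapunovMap (A - (l / 2) • 1) M X = -1) (hη : η * X.trace < 1)
    (hη0 : 0 ≤ η) : IsMeanSquareStable (A - ((l - η) / 2) • 1) M := by
  obtain ⟨hs, hq⟩ := posSemidef_iff_real.1 hX
  have hpos : ∀ v : n → ℝ, v ≠ 0 → 0 < v ⬝ᵥ v := fun v hv => by
    simpa using dotProduct_star_self_pos_iff.2 hv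
  refine ⟨X, posDef_iff_real.2 ⟨hs, fun v hv => (hq v).lt_of_ne fun h0 => ?_⟩, ?_⟩
  · have h1 := dotProduct_lyapunovMap_mulVec_nonneg (A := A - (l / 2) • 1) (M := M) hX
      ((hX.dotProduct_mulVec_zero_iff v).1 (by simpa using h0.symm))
    rw [hL, neg_mulVec, one_mulVec, dotProduct_neg] at h1
    linarith [hpos v hv]
  · have h2 : -lyapunovMap (A - ((l - η) / 2) • 1) M X = 1 - η • X := by
      rw [lyapunovMap_sub_smul_one] at hL ⊢
      rw [sub_smul, ← sub_add, hL]
      abel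
    rw [h2]
    refine posDef_iff_real.2 ⟨by simp [hs], fun v hv => ?_⟩
    have h3 := mul_le_mul_of_nonneg_left (hX.dotProduct_mulVec_le_trace v) hη0
    rw [sub_mulVec, one_mulVec, smul_mulVec, dotProduct_sub, dotProduct_smul, smul_eq_mul]
    nlinarith [mul_pos (sub_pos.2 hη) (hpos v hv)]

lemma exists_isMeanSquareStable_sub [DecidableEq n] (A : Matrix n n ℝ) (M : ι → Matrix n n ℝ) :
    ∃ l : ℝ, IsMeanSquareStable (A - (l / 2) • 1) M := by
  set P := lyapunovMap A M 1 with hP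
  have hs : Pᵀ = P := transpose_lyapunovMap_of_symm A M transpose_one
  refine ⟨(Pᵀ * P).trace + 2, 1, PosDef.one, ?_⟩
  rw [lyapunovMap_sub_smul_one, ← hP]
  refine posDef_iff_real.2 ⟨by simp [hs], fun v hv => ?_⟩
  have hpos : 0 < v ⬝ᵥ v := by simpa using dotProduct_star_self_pos_iff.2 hv
  have h1 := (posSemidef_transpose_mul_self_real P).dotProduct_mulVec_le_trace v
  have h2 := (posSemidef_transpose_mul_self_real P).trace_nonneg
  have h3 := (posSemidef_iff_real.1 (posSemidef_transpose_mul_self_real (P - 1))).2 v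
  have h4 : (P - 1)ᵀ * (P - 1) = Pᵀ * P - P - P + 1 := by
    rw [transpose_sub, transpose_one, Matrix.mul_sub, Matrix.sub_mul, Matrix.sub_mul, hs]
    simp only [Matrix.mul_one, Matrix.one_mul]
    abel
  rw [h4] at h3
  simp only [add_mulVec, sub_mulVec, one_mulVec, neg_mulVec, smul_mulVec, dotProduct_add,
    dotProduct_sub, dotProduct_neg, dotProduct_smul, smul_eq_mul] at h3 ⊢
  nlinarith [mul_nonneg h2 hpos.le]

/-- Approximate eigenvectors of the adjoint Lyapunov operator, obtained from the blow-up of the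
resolvent at the stability threshold `sInf {l | (A - (l / 2) I, M) is stable}`. -/
lemma exists_approx_eigenvector [DecidableEq n] {b ε : ℝ} (hε : 0 < ε)
    (hb : IsGLB {l : ℝ | IsMeanSquareStable (A - (l / 2) • 1) M} b) :
    ∃ W : Matrix n n ℝ, W.PosSemidef ∧ W.trace = 1 ∧ ∃ c d : ℝ, |c| ≤ ε ∧ |d| ≤ ε ∧
      lyapunovMap Aᵀ (fun k => (M k)ᵀ) W - b • W = c • W - d • 1 := by
  obtain ⟨l, hl, hbl, hlε⟩ := hb.exists_between (lt_add_of_pos_right b hε)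
  obtain ⟨X, hX, hXL⟩ := hl.exists_lyapunovMap_eq_neg PosSemidef.one
  obtain ⟨V, hV, hVL⟩ := hl.exists_adjoint_eq_neg PosSemidef.one
  have htr : X.trace = V.trace := by
    have := trace_lyapunovMap_mul (A - (l / 2) • 1) M X V
    rw [hXL, hVL] at this
    simpa using this.symm
  have hX0 := hX.trace_nonneg
  have hkey : 1 ≤ (l - b) * X.trace := by
    by_contra! hlt
    set e := (1 - (l - b) * X.trace) / (2 * (X.trace + 1)) with he
    have he0 : 0 < e := div_pos (by linarith) (by linarith)
    have he1 : e * (2 * (X.trace + 1)) = 1 - (l - b) * X.trace :=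
      div_mul_cancel₀ _ (by linarith)
    have hst := isMeanSquareStable_sub_of_trace_lt (η := l - b + e) hX hXL
      (by nlinarith) (by linarith)
    have := hb.1 hst
    linarith
  have hpos : 0 < X.trace := hX0.lt_of_ne fun h => by rw [← h] at hkey; linarith
  have hinv : X.trace⁻¹ ≤ l - b := by
    rw [inv_le_iff_one_le_mul₀ hpos]; linarith
  have hinv0 : 0 < X.trace⁻¹ := inv_pos.2 hpos
  refine ⟨X.trace⁻¹ • V, hV.smul hinv0.le, ?_, l - b, X.trace⁻¹, ?_, ?_, ?_⟩
  · rw [trace_smul, ← htr, smul_eq_mul, inv_mul_cancel₀ hpos.ne']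
  · rw [abs_of_nonneg (by linarith)]; linarith
  · rw [abs_of_pos hinv0]; linarith
  · have hT : (A - (l / 2) • 1)ᵀ = Aᵀ - (l / 2) • 1 := by simp
    rw [hT, lyapunovMap_sub_smul_one, sub_eq_iff_eq_add] at hVL
    rw [map_smul, hVL, sub_smul, smul_add, smul_neg, smul_comm X.trace⁻¹ l]
    abel

/-- A Perron-Frobenius statement: if the Lyapunov criterion fails, then the adjoint operator has a
positive semidefinite eigenvector for some nonnegative eigenvalue. -/
lemma exists_eigenvector_of_not_isMeanSquareStable (h : ¬ IsMeanSquareStable A M) :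
    ∃ l : ℝ, 0 ≤ l ∧ ∃ V : Matrix n n ℝ, V.PosSemidef ∧ V ≠ 0 ∧
      lyapunovMap Aᵀ (fun k => (M k)ᵀ) V = l • V := by
  classical
  set S := {l : ℝ | IsMeanSquareStable (A - (l / 2) • 1) M} with hS
  have hS0 : ∀ l ∈ S, 0 ≤ l := by
    rintro l ⟨X, hX, hL⟩
    by_contra! hl
    refine h ⟨X, hX, ?_⟩
    have := hL.add_posSemidef (hX.posSemidef.smul (neg_nonneg.2 hl.le))
    rw [lyapunovMap_sub_smul_one] at this
    convert this using 1
    rw [neg_smul]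
    abel
  have hglb : IsGLB S (sInf S) := isGLB_csInf (exists_isMeanSquareStable_sub A M) ⟨0, hS0⟩
  refine ⟨sInf S, hglb.2 hS0, ?_⟩
  set b := sInf S
  let L := lyapunovMap Aᵀ fun k => (M k)ᵀ
  let g : Matrix n n ℝ → ℝ := fun W => ∑ i, ∑ j, |(L W - b • W) i j|
  have hL : Continuous L := continuous_lyapunovMap _ _
  have hg : Continuous g := by
    refine continuous_finsetSum _ fun i _ => continuous_finsetSum _ fun j _ => ?_
    exact ((hL.sub (continuous_id.const_smul b)).matrix_elem i j).abs
  have hK : IsCompact ({W : Matrix n n ℝ | W.PosSemidef ∧ W.trace ≤ 1} ∩ {W | W.trace = 1}) :=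
    (isCompact_setOf_posSemidef_trace_le 1).inter_right
      (isClosed_eq (f := fun W : Matrix n n ℝ => W.trace) (by fun_prop) continuous_const)
  obtain ⟨W₁, hW₁, hW₁t, -⟩ := exists_approx_eigenvector one_pos hglb
  obtain ⟨V, ⟨⟨hV, -⟩, hVt⟩, hmin⟩ :=
    hK.exists_isMinOn ⟨W₁, ⟨hW₁, hW₁t.le⟩, hW₁t⟩ hg.continuousOn
  have hVt : V.trace = 1 := hVt
  refine ⟨V, hV, by rintro rfl; simp at hVt, ?_⟩
  have hle : ∀ ε : ℝ, 0 < ε → g V ≤ (∑ _i : n, ∑ _j : n, 2) * ε := by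
    intro ε hε
    obtain ⟨W, hW, hWt, c, d, hc, hd, hWL⟩ := exists_approx_eigenvector hε hglb
    refine (hmin (a := W) ⟨⟨hW, hWt.le⟩, hWt⟩).trans ?_
    rw [Finset.sum_mul]
    refine Finset.sum_le_sum fun i _ => ?_
    rw [Finset.sum_mul]
    refine Finset.sum_le_sum fun j _ => ?_
    change |(lyapunovMap Aᵀ (fun k => (M k)ᵀ) W - b • W) i j| ≤ 2 * ε
    rw [hWL]
    have h1 : |W i j| ≤ 1 := (hW.abs_apply_le_trace i j).trans hWt.le
    have h2 : |(1 : Matrix n n ℝ) i j| ≤ 1 := by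
      rw [one_apply]; split_ifs <;> simp
    calc |(c • W - d • (1 : Matrix n n ℝ)) i j|
        ≤ |c * W i j| + |d * (1 : Matrix n n ℝ) i j| := abs_sub _ _
      _ ≤ ε * 1 + ε * 1 := by
          rw [abs_mul, abs_mul]
          gcongr
      _ = 2 * ε := by ring
  have hg0 : g V ≤ 0 := by
    have hlim : Filter.Tendsto (fun ε : ℝ => (∑ _i : n, ∑ _j : n, (2 : ℝ)) * ε)
        (nhdsWithin 0 (Set.Ioi 0)) (nhds 0) := by
      refine tendsto_nhdsWithin_of_tendsto_nhds (Continuous.tendsto' (by fun_prop) _ _ ?_)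
      simp
    exact ge_of_tendsto hlim (Filter.eventually_of_mem self_mem_nhdsWithin hle)
  have hg1 : g V = 0 := le_antisymm hg0 (by positivity)
  rw [← sub_eq_zero]
  ext i j
  rw [Finset.sum_eq_zero_iff_of_nonneg fun i _ => by positivity] at hg1
  have h1 := hg1 i (Finset.mem_univ i)
  rw [Finset.sum_eq_zero_iff_of_nonneg fun i _ => by positivity] at h1
  exact abs_eq_zero.1 (h1 j (Finset.mem_univ j))

end Lyapunov

lemma sum_gram_smul_mul_mul {n ι : Type*} [Fintype n] [Fintype ι] (G : Matrix ι ι ℝ)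
    (N N' : ι → Matrix n n ℝ) (X : Matrix n n ℝ) :
    ∑ i, ∑ j, (Gᵀ * G) i j • (N' i * X * N j) =
      ∑ k, (∑ i, G k i • N' i) * X * (∑ j, G k j • N j) := by
  simp only [Matrix.sum_mul, Matrix.mul_sum, Matrix.smul_mul, Matrix.mul_smul, mul_apply,
    transpose_apply, Finset.sum_smul, Finset.smul_sum, smul_smul]
  rw [Finset.sum_congr rfl fun i _ => Finset.sum_comm, Finset.sum_comm]
  refine Finset.sum_congr rfl fun k _ => ?_
  rw [Finset.sum_comm]
  simp only [mul_comm]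

section Riccati

variable {n m p ι : Type*} [Fintype n] [Fintype m] [Fintype p] [Fintype ι]

/-- The Riccati operator `Q ↦ Aᵀ Q + Q A + ∑ k, (M k)ᵀ Q (M k) + Cᵀ C - Q B Bᵀ Q`. -/
def riccatiMap (A : Matrix n n ℝ) (M : ι → Matrix n n ℝ) (B : Matrix n m ℝ) (C : Matrix p n ℝ)
    (Q : Matrix n n ℝ) : Matrix n n ℝ :=
  lyapunovMap A M Q + Cᵀ * C - Q * B * Bᵀ * Q

/-- The Hautus form of detectability. -/
def IsHautusDetectable (A : Matrix n n ℝ) (M : ι → Matrix n n ℝ) (C : Matrix p n ℝ) : Prop :=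
  ∀ l : ℝ, 0 ≤ l → ∀ V : Matrix n n ℝ, V.PosSemidef → V ≠ 0 →
    lyapunovMap Aᵀ (fun k => (M k)ᵀ) V = l • V → C * V ≠ 0

variable {A : Matrix n n ℝ} {M : ι → Matrix n n ℝ} {B : Matrix n m ℝ} {C : Matrix p n ℝ}

lemma lyapunovMap_add_feedback (A : Matrix n n ℝ) (M : ι → Matrix n n ℝ) (B : Matrix n m ℝ)
    (C : Matrix p n ℝ) (F : Matrix m n ℝ) {Q : Matrix n n ℝ} (hQ : Qᵀ = Q) :
    lyapunovMap (A + B * F) M Q + (Cᵀ * C + Fᵀ * F) =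
      riccatiMap A M B C Q + (F + Bᵀ * Q)ᵀ * (F + Bᵀ * Q) := by
  simp only [riccatiMap, lyapunovMap_apply, transpose_add, transpose_mul, transpose_transpose, hQ,
    Matrix.add_mul, Matrix.mul_add, Matrix.mul_assoc]
  abel

/-- Under detectability, a positive semidefinite supersolution of the closed-loop Lyapunov equation
certifies stability of the closed loop. -/
lemma IsHautusDetectable.isMeanSquareStable (hdet : IsHautusDetectable A M C) {F : Matrix m n ℝ}
    {Q : Matrix n n ℝ} (hQ : Q.PosSemidef)
    (hL : (-(lyapunovMap (A + B * F) M Q + (Cᵀ * C + Fᵀ * F))).PosSemidef) :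
    IsMeanSquareStable (A + B * F) M := by
  by_contra hns
  obtain ⟨l, hl, V, hV, hV0, hVL⟩ := exists_eigenvector_of_not_isMeanSquareStable hns
  have h1 := trace_lyapunovMap_mul (A + B * F) M Q V
  rw [hVL, Matrix.mul_smul, trace_smul, smul_eq_mul] at h1
  have h2 := mul_nonneg hl (hQ.trace_mul_nonneg hV)
  have h3 := hL.trace_mul_nonneg hV
  have h4 := (posSemidef_transpose_mul_self_real C).trace_mul_nonneg hV
  have h5 := (posSemidef_transpose_mul_self_real F).trace_mul_nonneg hV
  rw [Matrix.neg_mul, Matrix.add_mul, Matrix.add_mul, trace_neg, trace_add, trace_add] at h3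
  have hC : C * V = 0 := hV.mul_eq_zero_of_trace (by linarith)
  have hF : F * V = 0 := hV.mul_eq_zero_of_trace (by linarith)
  have hF' : V * Fᵀ = 0 := by
    have := congrArg transpose hF
    rwa [transpose_mul, (posSemidef_iff_real.1 hV).1, transpose_zero] at this
  refine hdet l hl V hV hV0 ?_ hC
  rw [← hVL]
  simp only [lyapunovMap_apply, transpose_transpose, transpose_add, transpose_mul, Matrix.add_mul,
    Matrix.mul_add, Matrix.mul_assoc, hF, Matrix.mul_zero, add_zero]
  rw [← Matrix.mul_assoc V Fᵀ, hF', Matrix.zero_mul, add_zero]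

/-- Every stabilizing feedback yields a supersolution of the Riccati equation, by solving the
closed-loop Lyapunov equation (a Newton-Kleinman step). -/
lemma IsMeanSquareStable.exists_riccati_supersolution {F : Matrix m n ℝ}
    (hF : IsMeanSquareStable (A + B * F) M) (C : Matrix p n ℝ) :
    ∃ Q : Matrix n n ℝ, Q.PosSemidef ∧ (-riccatiMap A M B C Q).PosSemidef ∧
      lyapunovMap (A + B * F) M Q = -(Cᵀ * C + Fᵀ * F) := by
  obtain ⟨Q, hQ, hQL⟩ := hF.exists_lyapunovMap_eq_neg
    ((posSemidef_transpose_mul_self_real C).add (posSemidef_transpose_mul_self_real F))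
  refine ⟨Q, hQ, ?_, hQL⟩
  have h1 := lyapunovMap_add_feedback A M B C F (posSemidef_iff_real.1 hQ).1
  rw [hQL, neg_add_cancel, eq_comm, add_eq_zero_iff_neg_eq] at h1
  rw [h1]
  exact posSemidef_transpose_mul_self_real _

lemma IsHautusDetectable.isMeanSquareStable_of_supersolution (hdet : IsHautusDetectable A M C)
    {Q : Matrix n n ℝ} (hQ : Q.PosSemidef) (hR : (-riccatiMap A M B C Q).PosSemidef) :
    IsMeanSquareStable (A + B * (-(Bᵀ * Q))) M := by
  refine hdet.isMeanSquareStable hQ ?_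
  rw [lyapunovMap_add_feedback A M B C _ (posSemidef_iff_real.1 hQ).1]
  simpa using hR

/-- The trace-minimal supersolution of the Riccati equation is a stabilizing solution. -/
theorem exists_stabilizing_riccati_solution (hdet : IsHautusDetectable A M C) {F : Matrix m n ℝ}
    (hF : IsMeanSquareStable (A + B * F) M) :
    ∃ Q : Matrix n n ℝ, Q.PosSemidef ∧ riccatiMap A M B C Q = 0 ∧
      IsMeanSquareStable (A + B * (-(Bᵀ * Q))) M := by
  obtain ⟨Q₀, hQ₀, hR₀, -⟩ := hF.exists_riccati_supersolution C
  have hcont : Continuous fun Q : Matrix n n ℝ => -riccatiMap A M B C Q := by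
    have := continuous_lyapunovMap A M
    unfold riccatiMap
    fun_prop
  have hK := (isCompact_setOf_posSemidef_trace_le Q₀.trace).inter_right
    (isClosed_setOf_posSemidef.preimage hcont)
  obtain ⟨Q, ⟨⟨hQ, hQt⟩, hR⟩, hmin⟩ := hK.exists_isMinOn ⟨Q₀, ⟨hQ₀, le_rfl⟩, hR₀⟩
    (f := fun Q : Matrix n n ℝ => Q.trace) (Continuous.continuousOn (by fun_prop))
  have hR : (-riccatiMap A M B C Q).PosSemidef := hR
  have hst := hdet.isMeanSquareStable_of_supersolution hQ hR
  refine ⟨Q, hQ, ?_, hst⟩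
  obtain ⟨Q', hQ', hR', hQL'⟩ := hst.exists_riccati_supersolution C
  have hL : lyapunovMap (A + B * (-(Bᵀ * Q))) M (Q - Q') = riccatiMap A M B C Q := by
    have h1 := lyapunovMap_add_feedback A M B C (-(Bᵀ * Q)) (posSemidef_iff_real.1 hQ).1
    rw [neg_add_cancel, Matrix.mul_zero, add_zero] at h1
    rw [map_sub, hQL', sub_neg_eq_add, h1]
  have hD : (Q - Q').PosSemidef := hst.posSemidef_of_neg_lyapunovMap
    (by rw [transpose_sub, (posSemidef_iff_real.1 hQ).1, (posSemidef_iff_real.1 hQ').1])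
    (by rwa [hL])
  have htr := hD.trace_nonneg
  rw [trace_sub, sub_nonneg] at htr
  have hle : Q.trace ≤ Q'.trace := hmin (a := Q') ⟨⟨hQ', htr.trans hQt⟩, hR'⟩
  have h0 : Q - Q' = 0 := hD.trace_eq_zero_iff.1 (by rw [trace_sub]; linarith)
  rw [← hL, h0, map_zero]

end Riccati

end Matrix

/-- Existence of a stabilizing positive semidefinite solution of the stochastic
LQ Riccati equation under stabilizability and detectability. -/
theorem stmt_0 {n m p q : ℕ}
    (A : Matrix (Fin n) (Fin n) ℝ) (N : Fin q → Matrix (Fin n) (Fin n) ℝ)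
    (B : Matrix (Fin n) (Fin m) ℝ) (C : Matrix (Fin p) (Fin n) ℝ)
    (K : Matrix (Fin q) (Fin q) ℝ) (hK : K.PosSemidef)
    (hstab : ∃ F : Matrix (Fin m) (Fin n) ℝ, ∃ X : Matrix (Fin n) (Fin n) ℝ,
      X.PosDef ∧
      (-((A + B * F)ᵀ * X + X * (A + B * F) +
          ∑ i : Fin q, ∑ j : Fin q, K i j • ((N i)ᵀ * X * N j))).PosDef)
    (hdet : ∀ l : ℝ, 0 ≤ l → ∀ V : Matrix (Fin n) (Fin n) ℝ,
      V.PosSemidef → V ≠ 0 →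
      A * V + V * Aᵀ + ∑ i : Fin q, ∑ j : Fin q, K i j • (N i * V * (N j)ᵀ) = l • V →
      C * V ≠ 0) :
    ∃ Q : Matrix (Fin n) (Fin n) ℝ, Q.PosSemidef ∧
      Aᵀ * Q + Q * A + (∑ i : Fin q, ∑ j : Fin q, K i j • ((N i)ᵀ * Q * N j)) +
        Cᵀ * C - Q * B * Bᵀ * Q = 0 ∧
      ∃ Y : Matrix (Fin n) (Fin n) ℝ, Y.PosDef ∧
        (-((A - B * Bᵀ * Q)ᵀ * Y + Y * (A - B * Bᵀ * Q) +
            ∑ i : Fin q, ∑ j : Fin q, K i j • ((N i)ᵀ * Y * N j))).PosDef := by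
  obtain ⟨G, rfl⟩ := hK.exists_eq_transpose_mul_self
  let M : Fin q → Matrix (Fin n) (Fin n) ℝ := fun k => ∑ i, G k i • N i
  have hlyap : ∀ A' X, A'ᵀ * X + X * A' +
      ∑ i, ∑ j, (Gᵀ * G) i j • ((N i)ᵀ * X * N j) = lyapunovMap A' M X := fun A' X => by
    simp only [sum_gram_smul_mul_mul G N (fun i => (N i)ᵀ), lyapunovMap_apply, M,
      transpose_sum, transpose_smul]
  have hadj : ∀ V, A * V + V * Aᵀ + ∑ i, ∑ j, (Gᵀ * G) i j • (N i * V * (N j)ᵀ) =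
      lyapunovMap Aᵀ (fun k => (M k)ᵀ) V := fun V => by
    simp only [sum_gram_smul_mul_mul G (fun i => (N i)ᵀ) N, lyapunovMap_apply,
      transpose_transpose, M, transpose_sum, transpose_smul]
  simp only [hlyap, hadj] at hstab hdet ⊢
  obtain ⟨F, hF⟩ := hstab
  obtain ⟨Q, hQ, hR, hst⟩ := exists_stabilizing_riccati_solution (B := B) (C := C) hdet hF
  refine ⟨Q, hQ, hR, ?_⟩
  rwa [Matrix.mul_neg, ← sub_eq_add_neg, ← Matrix.mul_assoc] at hst
end

section
/- Let A, N_1, …, N_q ∈ ℝ^{n×n}, B ∈ ℝ^{n×m}, C ∈ ℝ^{p×n}, and let K = (k_{ij}) ∈ ℝ^{q×q} be symmetric positive semidefinite. Suppose Q ⪰ 0 is a symmetric positive semidefinite solution of the Riccati equation AᵀQ + QA + Σ_{i,j=1}^q N_iᵀ Q N_j k_{ij} + CᵀC − QBBᵀQ = 0. If Q is singular (not positive definite), then there exist a real number λ and a symmetric positive semidefinite matrix V ≠ 0 such that A V + V Aᵀ + Σ_{i,j=1}^q N_i V N_jᵀ k_{ij} = λV and CV = 0. Equivalently, if the observability Hautus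 test holds (every nonzero positive semidefinite eigenvector V of V ↦ AV + VAᵀ + Σ_{i,j} N_i V N_jᵀ k_{ij} with real eigenvalue satisfies CV ≠ 0), then Q ≻ 0. -/
open Matrix BigOperators

namespace Matrix

open scoped MatrixOrder in
theorem PosSemidef.exists_transpose_mul_self {ι : Type*} [Fintype ι] [DecidableEq ι]
    {V : Matrix ι ι ℝ} (hV : V.PosSemidef) : ∃ L : Matrix ι ι ℝ, V = Lᵀ * L := by
  obtain ⟨L, hL⟩ := CStarAlgebra.nonneg_iff_eq_star_mul_self.mp hV.nonneg
  exact ⟨L, by rw [hL, star_eq_conjTranspose, conjTranspose_eq_transpose_of_trivial]⟩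

theorem posSemidef_real_iff {ι : Type*} [Fintype ι] {V : Matrix ι ι ℝ} :
    V.PosSemidef ↔ Vᵀ = V ∧ ∀ x : ι → ℝ, 0 ≤ x ⬝ᵥ V *ᵥ x := by
  simp [posSemidef_iff_dotProduct_mulVec, IsHermitian]

theorem PosSemidef.mul_mul_transpose {ι κ : Type*} [Fintype ι] [Fintype κ] {V : Matrix ι ι ℝ}
    (hV : V.PosSemidef) (M : Matrix κ ι ℝ) : (M * V * Mᵀ).PosSemidef := by
  simpa using hV.mul_mul_conjTranspose_same M

theorem PosSemidef.trace_smul_one_sub {ι : Type*} [Fintype ι] [DecidableEq ι]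
    {V : Matrix ι ι ℝ} (hV : V.PosSemidef) : (V.trace • 1 - V).PosSemidef := by
  obtain ⟨L, rfl⟩ := hV.exists_transpose_mul_self
  refine posSemidef_real_iff.mpr ⟨by simp [transpose_mul], fun x => ?_⟩
  rw [sub_mulVec, dotProduct_sub, smul_mulVec, one_mulVec, dotProduct_smul, smul_eq_mul,
    ← mulVec_mulVec, dotProduct_mulVec x Lᵀ, vecMul_transpose, sub_nonneg]
  have htrace : (Lᵀ * L).trace = ∑ i, ∑ j, L i j ^ 2 := by
    rw [Finset.sum_comm]
    simp [trace, mul_apply, sq]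
  rw [htrace, Finset.sum_mul]
  refine Finset.sum_le_sum fun i _ => ?_
  have h := Finset.sum_mul_sq_le_sq_mul_sq Finset.univ (L i) x
  simpa [dotProduct, mulVec, sq] using h

theorem PosSemidef.abs_apply_le_trace_s1 {ι : Type*} [Fintype ι]
    {V : Matrix ι ι ℝ} (hV : V.PosSemidef) (i j : ι) : |V i j| ≤ V.trace := by
  classical
  have hdiag (k : ι) : V k k ≤ V.trace :=
    Finset.single_le_sum (f := fun k => V k k) (fun k _ => hV.diag_nonneg) (Finset.mem_univ k)
  have hsymm : V j i = V i j := by simpa using hV.1.apply i j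
  have hpair (s : ℝ) := (posSemidef_real_iff.mp hV).2 (Pi.single i 1 + Pi.single j s)
  have h₁ := hpair 1
  have h₂ := hpair (-1)
  simp [mulVec_add, add_dotProduct, dotProduct_add, hsymm] at h₁ h₂
  rw [abs_le]
  constructor <;> linarith [hdiag i, hdiag j]

theorem isClosed_posSemidef {ι : Type*} [Fintype ι] :
    IsClosed {V : Matrix ι ι ℝ | V.PosSemidef} := by
  simp only [posSemidef_real_iff, Set.ofPred_and, Set.ofPred_forall]
  refine (isClosed_eq (by fun_prop) continuous_id).inter (isClosed_iInter fun x => ?_)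
  exact isClosed_le continuous_const
    (continuous_const.dotProduct (continuous_id.matrix_mulVec continuous_const))

theorem isCompact_posSemidef_trace_eq_one {ι : Type*} [Fintype ι] :
    IsCompact {V : Matrix ι ι ℝ | V.PosSemidef ∧ V.trace = 1} := by
  refine (IsCompact.matrix (isCompact_Icc (a := (-1 : ℝ)) (b := 1))).of_isClosed_subset
    (isClosed_posSemidef.inter (isClosed_eq continuous_id.matrix_trace continuous_const)) ?_
  rintro V ⟨hV, htr⟩ i j
  exact abs_le.mp (htr ▸ hV.abs_apply_le_trace_s1 i j)

/-- A strictly positive linear map on symmetric matrices has a positive semidefinite eigenvector,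
obtained by maximizing `r` subject to `r • V ⪯ T V`. -/
theorem exists_posSemidef_eigenvector_of_strictlyPositive {ι : Type*} [Fintype ι] [DecidableEq ι]
    [Nonempty ι] (T : Matrix ι ι ℝ →ₗ[ℝ] Matrix ι ι ℝ) {c : ℝ} (hc : 0 < c)
    (hT : ∀ V : Matrix ι ι ℝ, V.PosSemidef → (T V - (c * V.trace) • 1).PosSemidef) :
    ∃ r : ℝ, ∃ V : Matrix ι ι ℝ, V.PosSemidef ∧ V.trace = 1 ∧ T V = r • V := by
  set S := {V : Matrix ι ι ℝ | V.PosSemidef ∧ V.trace = 1}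
  have hS : IsCompact S := isCompact_posSemidef_trace_eq_one
  have hTcont : Continuous T := T.continuous_of_finiteDimensional
  have hTpos (V : Matrix ι ι ℝ) (hV : V.PosSemidef) : (T V).PosSemidef := by
    have h := (hT V hV).add (PosSemidef.one.smul (mul_nonneg hc.le hV.trace_nonneg))
    rwa [sub_add_cancel] at h
  obtain ⟨R, hR⟩ := hS.bddAbove_image (f := fun V => (T V).trace) hTcont.matrix_trace.continuousOn
  have hbound (V : Matrix ι ι ℝ) (hV : V ∈ S) (r : ℝ) (h : (T V - r • V).PosSemidef) : r ≤ R := by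
    have h₁ := h.trace_nonneg
    rw [trace_sub, trace_smul, hV.2, smul_eq_mul, mul_one] at h₁
    linarith [hR ⟨V, hV, rfl⟩]
  have hcompact : IsCompact ((S ×ˢ Set.Icc 0 R) ∩
      {z : Matrix ι ι ℝ × ℝ | (T z.1 - z.2 • z.1).PosSemidef}) :=
    (hS.prod isCompact_Icc).inter_right (isClosed_posSemidef.preimage (by fun_prop))
  have hcard : (0 : ℝ) < Fintype.card ι := by exact_mod_cast Fintype.card_pos
  set V₀ : Matrix ι ι ℝ := (Fintype.card ι : ℝ)⁻¹ • 1
  have hV₀ : V₀ ∈ S :=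
    ⟨PosSemidef.one.smul (by positivity), by simp [V₀, trace_smul, hcard.ne']⟩
  have h₀ : (T V₀ - (0 : ℝ) • V₀).PosSemidef := by simpa using hTpos V₀ hV₀.1
  obtain ⟨⟨V, r⟩, ⟨⟨hV, hr⟩, hVr⟩, hmax⟩ := hcompact.exists_isMaxOn
    ⟨(V₀, 0), ⟨⟨hV₀, le_rfl, hbound V₀ hV₀ 0 h₀⟩, h₀⟩⟩ continuous_snd.continuousOn
  simp only [Set.mem_ofPred_eq] at hVr hr
  refine ⟨r, V, hV.1, hV.2, ?_⟩
  by_contra hne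
  have hD : 0 < (T V - r • V).trace := lt_of_le_of_ne hVr.trace_nonneg fun h =>
    hne (sub_eq_zero.mp (hVr.trace_eq_zero_iff.mp h.symm))
  have hW := hTpos V hV.1
  have htW : 0 < (T V).trace := by
    have h := (hT V hV.1).trace_nonneg
    rw [hV.2, trace_sub, trace_smul, trace_one, smul_eq_mul] at h
    have : 0 < c * 1 * (Fintype.card ι : ℝ) := by positivity
    linarith
  set t := (T V).trace
  set δ := c * (T V - r • V).trace / t
  have hδ : 0 < δ := by positivity
  have hU : t⁻¹ • T V ∈ S :=
    ⟨hW.smul (by positivity), by rw [trace_smul, smul_eq_mul]; exact inv_mul_cancel₀ htW.ne'⟩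
  have hUr : (T (t⁻¹ • T V) - (r + δ) • t⁻¹ • T V).PosSemidef := by
    have h := ((hT _ hVr).add (hW.trace_smul_one_sub.smul hδ.le)).smul (inv_nonneg.mpr htW.le)
    convert h using 1
    have hδt : c * (T V - r • V).trace = δ * t := by simp only [δ]; field_simp
    rw [hδt, map_sub, map_smul, map_smul]
    module
  have := hmax (show (t⁻¹ • T V, r + δ) ∈ _ from
    ⟨⟨hU, by linarith [hr.1], hbound _ hU _ hUr⟩, hUr⟩)
  simp only [Set.mem_ofPred_eq] at this
  linarith

/-- The eigenvector equation survives a vanishing linear perturbation. -/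
theorem exists_posSemidef_eigenvector_of_perturbation {ι : Type*} [Fintype ι]
    (L G : Matrix ι ι ℝ →ₗ[ℝ] Matrix ι ι ℝ)
    (h : ∀ ε : ℝ, 0 < ε → ∃ r : ℝ, ∃ V : Matrix ι ι ℝ,
      V.PosSemidef ∧ V.trace = 1 ∧ L V + ε • G V = r • V) :
    ∃ r : ℝ, ∃ V : Matrix ι ι ℝ, V.PosSemidef ∧ V.trace = 1 ∧ L V = r • V := by
  have hL : Continuous L := L.continuous_of_finiteDimensional
  have hG : Continuous G := G.continuous_of_finiteDimensional
  have : FirstCountableTopology (Matrix ι ι ℝ) :=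
    inferInstanceAs (FirstCountableTopology (ι → ι → ℝ))
  choose r V hV htr heq using fun k : ℕ => h (1 / ((k : ℝ) + 1)) (by positivity)
  obtain ⟨W, hW, φ, hφ, hlim⟩ :=
    isCompact_posSemidef_trace_eq_one.tendsto_subseq fun k => ⟨hV k, htr k⟩
  refine ⟨(L W).trace, W, hW.1, hW.2, ?_⟩
  have hε := tendsto_one_div_add_atTop_nhds_zero_nat (𝕜 := ℝ) |>.comp hφ.tendsto_atTop
  have hF : Continuous fun z : ℝ × Matrix ι ι ℝ => L z.2 + z.1 • G z.2 := by fun_prop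
  have h₁ := (hF.tendsto (0, W)).comp (hε.prodMk_nhds hlim)
  have h₂ := ((hF.matrix_trace.smul continuous_snd).tendsto (0, W)).comp (hε.prodMk_nhds hlim)
  have := tendsto_nhds_unique (h₁.congr fun k => ?_) h₂
  · simpa using this
  · simp only [Function.comp_apply, Pi.smul_apply']
    rw [heq, trace_smul, htr, smul_eq_mul, mul_one]

/-- The generalized Lyapunov operator has a positive semidefinite eigenvector. -/
theorem exists_posSemidef_eigenvector_lyapunov {ι κ : Type*} [Fintype ι] [DecidableEq ι]
    [Nonempty ι] [Fintype κ] (A : Matrix ι ι ℝ) (M : κ → Matrix ι ι ℝ) :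
    ∃ r : ℝ, ∃ V : Matrix ι ι ℝ, V.PosSemidef ∧ V.trace = 1 ∧
      A * V + V * Aᵀ + ∑ k, M k * V * (M k)ᵀ = r • V := by
  let L : Matrix ι ι ℝ →ₗ[ℝ] Matrix ι ι ℝ :=
    { toFun := fun V => A * V + V * Aᵀ + ∑ k, M k * V * (M k)ᵀ
      map_add' := fun V W => by
        simp only [mul_add, add_mul, Finset.sum_add_distrib]; abel
      map_smul' := fun a V => by simp [Finset.smul_sum] }
  let G : Matrix ι ι ℝ →ₗ[ℝ] Matrix ι ι ℝ :=
    { toFun := fun V => A * V * Aᵀ + V.trace • 1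
      map_add' := fun V W => by simp only [mul_add, add_mul, trace_add, add_smul]; abel
      map_smul' := fun a V => by simp [mul_smul] }
  refine exists_posSemidef_eigenvector_of_perturbation L G fun ε hε => ?_
  obtain ⟨r, V, hV, htr, heq⟩ := exists_posSemidef_eigenvector_of_strictlyPositive
    (LinearMap.id + ε • L + ε ^ 2 • G) (pow_pos hε 2) fun V hV => by
      have h := (hV.mul_mul_transpose (1 + ε • A)).add
        ((posSemidef_sum Finset.univ fun k _ => hV.mul_mul_transpose (M k)).smul hε.le)
      convert h using 1
      simp only [L, G, LinearMap.add_apply, LinearMap.id_apply, LinearMap.smul_apply,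
        LinearMap.coe_mk, AddHom.coe_mk, transpose_add, transpose_one, transpose_smul, add_mul,
        mul_add, one_mul, mul_one, smul_mul_assoc, mul_smul_comm]
      module
  refine ⟨(r - 1) / ε, V, hV, htr, ?_⟩
  have h : ε • (L V + ε • G V) = (r - 1) • V := by
    rw [sub_smul, one_smul, ← heq]
    simp only [LinearMap.add_apply, LinearMap.id_apply, LinearMap.smul_apply]
    module
  rw [div_eq_inv_mul, mul_smul, ← h, inv_smul_smul₀ hε.ne']

/-- A matrix whose columns form a basis of the subspace `W`, together with a left inverse. -/
theorem exists_basis_matrix {ι : Type*} [Fintype ι] [DecidableEq ι] (W : Submodule ℝ (ι → ℝ)) :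
    ∃ (E : Matrix ι (Fin (Module.finrank ℝ W)) ℝ) (F : Matrix (Fin (Module.finrank ℝ W)) ι ℝ),
      F * E = 1 ∧ (∀ y, E *ᵥ y ∈ W) ∧ ∀ w ∈ W, E *ᵥ F *ᵥ w = w := by
  obtain ⟨f, hf⟩ := W.subtype.exists_leftInverse_of_injective W.ker_subtype
  have hf' (w : W) : f w = w := LinearMap.congr_fun hf w
  let b := Module.finBasis ℝ W
  refine ⟨LinearMap.toMatrix' (W.subtype ∘ₗ b.equivFun.symm.toLinearMap),
    LinearMap.toMatrix' (b.equivFun.toLinearMap ∘ₗ f), ?_, fun y => ?_, fun w hw => ?_⟩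
  · rw [← LinearMap.toMatrix'_comp, ← LinearMap.toMatrix'_id]
    congr 1
    refine LinearMap.ext fun y => ?_
    simp only [LinearMap.comp_apply, Submodule.subtype_apply, LinearEquiv.coe_coe, hf',
      LinearEquiv.apply_symm_apply, LinearMap.id_apply]
  · rw [LinearMap.toMatrix'_mulVec]
    exact (b.equivFun.symm y).2
  · rw [LinearMap.toMatrix'_mulVec, LinearMap.toMatrix'_mulVec]
    simp only [LinearMap.comp_apply, Submodule.subtype_apply, LinearEquiv.coe_coe,
      LinearEquiv.symm_apply_apply]
    exact congrArg Subtype.val (hf' ⟨w, hw⟩)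

/-- On a nontrivial invariant subspace contained in the kernel of `C`, the generalized Lyapunov
operator has a positive semidefinite eigenvector annihilated by `C`. -/
theorem exists_posSemidef_eigenvector_of_invariant {ι κ μ : Type*} [Fintype ι] [DecidableEq ι]
    [Fintype κ] (A : Matrix ι ι ℝ) (M : κ → Matrix ι ι ℝ) (C : Matrix μ ι ℝ)
    (W : Submodule ℝ (ι → ℝ)) (hW : W ≠ ⊥) (hA : ∀ w ∈ W, A *ᵥ w ∈ W)
    (hM : ∀ k, ∀ w ∈ W, M k *ᵥ w ∈ W) (hC : ∀ w ∈ W, C *ᵥ w = 0) :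
    ∃ r : ℝ, ∃ V : Matrix ι ι ℝ, V.PosSemidef ∧ V ≠ 0 ∧
      A * V + V * Aᵀ + ∑ k, M k * V * (M k)ᵀ = r • V ∧ C * V = 0 := by
  obtain ⟨E, F, hFE, hE, hEF⟩ := exists_basis_matrix W
  have : Nonempty (Fin (Module.finrank ℝ W)) := by
    rw [← Fin.pos_iff_nonempty, Nat.pos_iff_ne_zero]
    exact fun h => hW (Submodule.finrank_eq_zero.mp h)
  have hinv (X : Matrix ι ι ℝ) (hX : ∀ w ∈ W, X *ᵥ w ∈ W) : X * E = E * (F * X * E) := by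
    refine ext_of_mulVec_single fun j => ?_
    simp only [← mulVec_mulVec]
    exact (hEF _ (hX _ (hE _))).symm
  have hCE : C * E = 0 := by
    refine ext_of_mulVec_single fun j => ?_
    rw [← mulVec_mulVec, hC _ (hE _), zero_mulVec]
  obtain ⟨r, X, hX, htr, heq⟩ :=
    exists_posSemidef_eigenvector_lyapunov (F * A * E) fun k => F * M k * E
  have hA' := hinv A hA
  have hM' (k : κ) := hinv (M k) (hM k)
  set A' := F * A * E
  set M' := fun k => F * M k * E
  change A' * X + X * A'ᵀ + ∑ k, M' k * X * (M' k)ᵀ = r • X at heq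
  refine ⟨r, E * X * Eᵀ, hX.mul_mul_transpose E, fun h => ?_, ?_, ?_⟩
  · have hX0 : X = F * (E * X * Eᵀ) * Fᵀ := by
      calc X = (F * E) * X * (F * E)ᵀ := by simp [hFE]
        _ = _ := by simp only [transpose_mul, Matrix.mul_assoc]
    rw [h] at hX0
    simp [hX0] at htr
  · have hleft : A * (E * X * Eᵀ) = E * (A' * X) * Eᵀ := by
      simp only [← Matrix.mul_assoc, hA']
    have hright : E * X * Eᵀ * Aᵀ = E * (X * A'ᵀ) * Eᵀ := by
      rw [Matrix.mul_assoc, ← transpose_mul, hA', transpose_mul]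
      simp only [Matrix.mul_assoc]
    have hnoise (k : κ) : M k * (E * X * Eᵀ) * (M k)ᵀ = E * (M' k * X * (M' k)ᵀ) * Eᵀ := by
      calc M k * (E * X * Eᵀ) * (M k)ᵀ = (M k * E) * X * (M k * E)ᵀ := by
            simp only [transpose_mul, Matrix.mul_assoc]
        _ = (E * M' k) * X * (E * M' k)ᵀ := by rw [hM' k]
        _ = _ := by simp only [transpose_mul, Matrix.mul_assoc]
    rw [hleft, hright]
    simp only [hnoise]
    rw [← Matrix.sum_mul, ← Matrix.mul_sum, ← Matrix.add_mul, ← Matrix.add_mul,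
      ← Matrix.mul_add, ← Matrix.mul_add, heq]
    simp
  · rw [← Matrix.mul_assoc, ← Matrix.mul_assoc, hCE]
    simp

/-- Factoring the covariance turns a double noise sum into a sum of squares. -/
theorem sum_sum_smul_mul_mul_transpose {ι κ : Type*} [Fintype ι] [Fintype κ]
    (L : Matrix κ κ ℝ) (N : κ → Matrix ι ι ℝ) (V : Matrix ι ι ℝ) :
    ∑ i, ∑ j, (Lᵀ * L) i j • (N i * V * (N j)ᵀ) =
      ∑ k, (∑ i, L k i • N i) * V * (∑ i, L k i • N i)ᵀ := by
  simp only [mul_apply, transpose_apply, transpose_sum, transpose_smul, Matrix.sum_mul,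
    Matrix.mul_sum, Finset.sum_smul, smul_mul_assoc, mul_smul_comm]
  rw [Finset.sum_comm_cycle]
  refine Finset.sum_congr rfl fun k _ => ?_
  rw [Finset.sum_comm]
  simp only [Finset.smul_sum, smul_smul]
  exact Finset.sum_congr rfl fun j _ => Finset.sum_congr rfl fun i _ => by rw [mul_comm]

end Matrix

/-- If a positive semidefinite solution of the observability Riccati equation is
singular, the Hautus observability test fails; equivalently, observability forces
positive definiteness of the solution. -/
theorem stmt_1 {n m p q : ℕ}
    (A : Matrix (Fin n) (Fin n) ℝ) (N : Fin q → Matrix (Fin n) (Fin n) ℝ)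
    (B : Matrix (Fin n) (Fin m) ℝ) (C : Matrix (Fin p) (Fin n) ℝ)
    (K : Matrix (Fin q) (Fin q) ℝ) (hK : K.PosSemidef)
    (Q : Matrix (Fin n) (Fin n) ℝ) (hQ : Q.PosSemidef)
    (hric : Aᵀ * Q + Q * A + (∑ i : Fin q, ∑ j : Fin q, K i j • ((N i)ᵀ * Q * N j)) +
      Cᵀ * C - Q * B * Bᵀ * Q = 0) :
    (¬ Q.PosDef →
      ∃ l : ℝ, ∃ V : Matrix (Fin n) (Fin n) ℝ, V.PosSemidef ∧ V ≠ 0 ∧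
        A * V + V * Aᵀ + ∑ i : Fin q, ∑ j : Fin q, K i j • (N i * V * (N j)ᵀ) = l • V ∧
        C * V = 0) ∧
    ((∀ l : ℝ, ∀ V : Matrix (Fin n) (Fin n) ℝ, V.PosSemidef → V ≠ 0 →
        A * V + V * Aᵀ + ∑ i : Fin q, ∑ j : Fin q, K i j • (N i * V * (N j)ᵀ) = l • V →
        C * V ≠ 0) →
      Q.PosDef) := by
  have hmain : ¬ Q.PosDef → ∃ l : ℝ, ∃ V : Matrix (Fin n) (Fin n) ℝ, V.PosSemidef ∧ V ≠ 0 ∧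
      A * V + V * Aᵀ + ∑ i : Fin q, ∑ j : Fin q, K i j • (N i * V * (N j)ᵀ) = l • V ∧
      C * V = 0 := by
    intro hsing
    obtain ⟨L, rfl⟩ := hK.exists_transpose_mul_self
    set M : Fin q → Matrix (Fin n) (Fin n) ℝ := fun k => ∑ i, L k i • N i
    have hnoise : ∑ i, ∑ j, (Lᵀ * L) i j • ((N i)ᵀ * Q * N j) = ∑ k, (M k)ᵀ * Q * M k := by
      have h := sum_sum_smul_mul_mul_transpose L (fun i => (N i)ᵀ) Q
      simpa only [transpose_transpose, M, transpose_sum, transpose_smul] using h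
    rw [hnoise] at hric
    have hker (w : Fin n → ℝ) (hw : Q *ᵥ w = 0) :
        (∀ k, Q *ᵥ M k *ᵥ w = 0) ∧ C *ᵥ w = 0 ∧ Q *ᵥ A *ᵥ w = 0 := by
      have hvec := congrArg (· *ᵥ w) hric
      simp only [sub_mulVec, add_mulVec, sum_mulVec, ← mulVec_mulVec, hw, mulVec_zero, zero_add,
        sub_zero, zero_mulVec] at hvec
      have hQt : w ᵥ* Q = 0 := by
        rw [← mulVec_transpose, (posSemidef_real_iff.mp hQ).1, hw]
      have hquad := congrArg (w ⬝ᵥ ·) hvec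
      simp only [dotProduct_add, dotProduct_sum, dotProduct_mulVec w, vecMul_transpose, hQt,
        zero_dotProduct, zero_add, dotProduct_zero] at hquad
      have hk (k : Fin q) : 0 ≤ (M k *ᵥ w) ⬝ᵥ Q *ᵥ M k *ᵥ w :=
        (posSemidef_real_iff.mp hQ).2 _
      have hsum := Finset.sum_nonneg fun k (_ : k ∈ Finset.univ) => hk k
      have hCnonneg : 0 ≤ (C *ᵥ w) ⬝ᵥ C *ᵥ w := by
        simpa using dotProduct_star_self_nonneg (C *ᵥ w)
      have hMw (k : Fin q) : Q *ᵥ M k *ᵥ w = 0 := by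
        refine (hQ.dotProduct_mulVec_zero_iff _).mp ?_
        simpa using (Finset.sum_eq_zero_iff_of_nonneg fun k _ => hk k).mp
          (by linarith) k (Finset.mem_univ k)
      have hCw : C *ᵥ w = 0 := dotProduct_self_eq_zero.mp (by linarith)
      exact ⟨hMw, hCw, by simpa [hMw, hCw] using hvec⟩
    obtain ⟨v, hv, hQv⟩ := exists_mulVec_eq_zero_iff.mpr
      (not_not.mp (mt hQ.posDef_iff_det_ne_zero.mpr hsing))
    obtain ⟨r, V, hV, hne, heq, hCV⟩ := exists_posSemidef_eigenvector_of_invariant A M C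
      (LinearMap.ker Q.mulVecLin) ((Submodule.ne_bot_iff _).mpr ⟨v, hQv, hv⟩)
      (fun w hw => (hker w hw).2.2) (fun k w hw => (hker w hw).1 k) fun w hw => (hker w hw).2.1
    exact ⟨r, V, hV, hne, by rw [sum_sum_smul_mul_mul_transpose, heq], hCV⟩
  refine ⟨hmain, fun hobs => ?_⟩
  by_contra hsing
  obtain ⟨l, V, hV, hne, heq, hCV⟩ := hmain hsing
  exact hobs l V hV hne heq hCV
end

section
/- Let E be a finite-dimensional real inner product space and let H₊ ⊆ E be a closed convex cone that is pointed (H₊ ∩ (−H₊) = {0}) and solid (H₊ has nonempty interior). Let T : E → E be a linear map which is resolvent positive, i.e., there exists α₀ ∈ ℝ such that for all α > α₀ the map α·id − T is invertible and (α·id − T)⁻¹(H₊) ⊆ H₊. Let α* be the spectral abscissa of T, i.e., the maximum of the real parts of the eigenvalues of the complexification of T. Then α* is an eigenvalue of T and there exists X ∈ H₊ with X ≠ 0 and T(X) = α* X. -/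
open TensorProduct

section ComplexParts

variable {E : Type*} [AddCommGroup E] [Module ℝ E]

/-- The real part of a vector of the complexification of `E`. -/
noncomputable def tensorRe : ℂ ⊗[ℝ] E →ₗ[ℝ] E :=
  (TensorProduct.lid ℝ E).toLinearMap ∘ₗ LinearMap.rTensor E Complex.reLm

/-- The imaginary part of a vector of the complexification of `E`. -/
noncomputable def tensorIm : ℂ ⊗[ℝ] E →ₗ[ℝ] E :=
  (TensorProduct.lid ℝ E).toLinearMap ∘ₗ LinearMap.rTensor E Complex.imLm

@[simp]
lemma tensorRe_tmul (c : ℂ) (x : E) : tensorRe (c ⊗ₜ[ℝ] x) = c.re • x := by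
  simp [tensorRe]

@[simp]
lemma tensorIm_tmul (c : ℂ) (x : E) : tensorIm (c ⊗ₜ[ℝ] x) = c.im • x := by
  simp [tensorIm]

lemma tensorRe_baseChange (T : E →ₗ[ℝ] E) (z : ℂ ⊗[ℝ] E) :
    tensorRe (T.baseChange ℂ z) = T (tensorRe z) := by
  induction z with
  | zero => simp
  | tmul c x => simp
  | add z w hz hw => simp [hz, hw]

lemma tensorIm_baseChange (T : E →ₗ[ℝ] E) (z : ℂ ⊗[ℝ] E) :
    tensorIm (T.baseChange ℂ z) = T (tensorIm z) := by
  induction z with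
  | zero => simp
  | tmul c x => simp
  | add z w hz hw => simp [hz, hw]

lemma tensorRe_smul (μ : ℂ) (z : ℂ ⊗[ℝ] E) :
    tensorRe (μ • z) = μ.re • tensorRe z - μ.im • tensorIm z := by
  induction z with
  | zero => simp
  | tmul c x => simp [TensorProduct.smul_tmul', sub_smul, mul_smul]
  | add z w hz hw => simp only [smul_add, map_add, hz, hw]; abel

lemma tensorIm_smul (μ : ℂ) (z : ℂ ⊗[ℝ] E) :
    tensorIm (μ • z) = μ.im • tensorRe z + μ.re • tensorIm z := by
  induction z with
  | zero => simp
  | tmul c x => simp [TensorProduct.smul_tmul', add_smul, mul_smul, add_comm]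
  | add z w hz hw => simp only [smul_add, map_add, hz, hw]; abel

lemma tmul_tensorRe_add_tmul_tensorIm (z : ℂ ⊗[ℝ] E) :
    (1 : ℂ) ⊗ₜ[ℝ] tensorRe z + Complex.I ⊗ₜ[ℝ] tensorIm z = z := by
  induction z with
  | zero => simp
  | tmul c x =>
    rw [tensorRe_tmul, tensorIm_tmul, ← TensorProduct.smul_tmul, ← TensorProduct.smul_tmul,
      ← TensorProduct.add_tmul]
    congr 1
    apply Complex.ext <;> simp
  | add z w hz hw =>
    conv_rhs => rw [← hz, ← hw]
    simp only [map_add, TensorProduct.tmul_add]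
    abel

/-- An eigenvector of the complexification of `T`, split into real and imaginary parts. -/
lemma exists_real_parts_of_hasEigenvalue_baseChange {T : E →ₗ[ℝ] E} {μ : ℂ}
    (h : Module.End.HasEigenvalue (T.baseChange ℂ : Module.End ℂ (ℂ ⊗[ℝ] E)) μ) :
    ∃ u v : E, (u ≠ 0 ∨ v ≠ 0) ∧ T u = μ.re • u - μ.im • v ∧ T v = μ.im • u + μ.re • v := by
  obtain ⟨z, hz⟩ := h.exists_hasEigenvector
  refine ⟨tensorRe z, tensorIm z, ?_, ?_, ?_⟩
  · by_contra! hc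
    apply hz.2
    rw [← tmul_tensorRe_add_tmul_tensorIm z, hc.1, hc.2]
    simp
  · rw [← tensorRe_baseChange, ← tensorRe_smul, ← hz.apply_eq_smul]
  · rw [← tensorIm_baseChange, ← tensorIm_smul, ← hz.apply_eq_smul]

lemma hasEigenvalue_baseChange_of_apply_eq_smul {T : E →ₗ[ℝ] E} {s : ℝ} {x : E} (hx : x ≠ 0)
    (h : T x = s • x) :
    Module.End.HasEigenvalue (T.baseChange ℂ : Module.End ℂ (ℂ ⊗[ℝ] E)) (s : ℂ) := by
  refine Module.End.hasEigenvalue_of_hasEigenvector (x := (1 : ℂ) ⊗ₜ[ℝ] x)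
    ⟨Module.End.mem_eigenspace_iff.2 ?_, fun h0 => hx ?_⟩
  · rw [LinearMap.baseChange_tmul, h, ← TensorProduct.smul_tmul, TensorProduct.smul_tmul']
    congr 1
  · simpa using congrArg tensorRe h0

end ComplexParts

section Cone

open Filter Topology

variable {E : Type*} [NormedAddCommGroup E] {H : Set E}

lemma add_mem_interior_of_mem (hadd : ∀ x ∈ H, ∀ y ∈ H, x + y ∈ H) {x y : E}
    (hx : x ∈ H) (hy : y ∈ interior H) : x + y ∈ interior H := by
  have : (Homeomorph.addLeft x) '' interior H ⊆ interior H := by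
    apply interior_maximal
    · rintro _ ⟨w, hw, rfl⟩
      exact hadd x hx w (interior_subset hw)
    · exact (Homeomorph.addLeft x).isOpenMap _ isOpen_interior
  exact this ⟨y, hy, rfl⟩

variable [NormedSpace ℝ E]

lemma exists_add_smul_mem_of_mem_interior {x : E} (hx : x ∈ interior H) (y : E) :
    ∃ ε : ℝ, 0 < ε ∧ x + ε • y ∈ H := by
  have ht : Tendsto (fun ε : ℝ => x + ε • y) (𝓝[>] 0) (𝓝 x) := by
    have : Continuous fun ε : ℝ => x + ε • y := by fun_prop
    simpa using (this.tendsto 0).mono_left nhdsWithin_le_nhds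
  obtain ⟨ε, h1, h2⟩ :=
    ((ht.eventually (mem_interior_iff_mem_nhds.1 hx)).and self_mem_nhdsWithin).exists
  exact ⟨ε, h2, h1⟩

lemma smul_mem_interior_of_pos (hcone : ∀ c : ℝ, 0 ≤ c → ∀ x ∈ H, c • x ∈ H) {c : ℝ}
    (hc : 0 < c) {x : E} (hx : x ∈ interior H) : c • x ∈ interior H := by
  have : (Homeomorph.smulOfNeZero c hc.ne') '' interior H ⊆ interior H := by
    apply interior_maximal
    · rintro _ ⟨w, hw, rfl⟩
      exact hcone c hc.le w (interior_subset hw)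
    · exact (Homeomorph.smulOfNeZero c hc.ne').isOpenMap _ isOpen_interior
  exact this ⟨x, hx, rfl⟩

/-- If `z + t • x` stays in a closed set when `t` is contracted by a factor `ρ < 1`, then the
set contains `z`. -/
lemma mem_of_forall_mul_mem (hclosed : IsClosed H) {ρ t : ℝ} (h0 : 0 ≤ ρ) (h1 : ρ < 1)
    {x z : E} (h : ∀ n : ℕ, z + (ρ ^ n * t) • x ∈ H) : z ∈ H := by
  have ht : Tendsto (fun n : ℕ => z + (ρ ^ n * t) • x) atTop (𝓝 z) := by
    have := (((tendsto_pow_atTop_nhds_zero_of_lt_one h0 h1).mul_const t).smul_const x).const_add z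
    simpa using this
  exact hclosed.mem_of_tendsto ht (Eventually.of_forall h)

variable {T : E →ₗ[ℝ] E} {α₀ β γ : ℝ}

lemma mem_interior_of_smul_sub_mem_interior [FiniteDimensional ℝ E]
    (hadd : ∀ x ∈ H, ∀ y ∈ H, x + y ∈ H)
    (hcone : ∀ c : ℝ, 0 ≤ c → ∀ x ∈ H, c • x ∈ H)
    (hres : ∀ α > α₀, ∀ x, α • x - T x ∈ H → x ∈ H)
    {w : E} (hw : w ∈ H) (hTw : β • w - T w ∈ interior H) : w ∈ interior H := by
  obtain ⟨α, hα⟩ := exists_gt (max α₀ β)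
  rw [max_lt_iff] at hα
  have hcont : Continuous fun x => α • x - T x := by
    have := T.continuous_of_finiteDimensional
    fun_prop
  refine interior_maximal (s := H) (t := (fun x => α • x - T x) ⁻¹' interior H)
    (fun x hx => hres α hα.1 x (interior_subset hx)) (isOpen_interior.preimage hcont) ?_
  have h := add_mem_interior_of_mem hadd (hcone (α - β) (by linarith) w hw) hTw
  have e : (α - β) • w + (β • w - T w) = α • w - T w := by module
  rwa [e] at h

/-- A strict supersolution in the interior of the cone makes the resolvent positive. -/
lemma mem_of_smul_sub_mem (hclosed : IsClosed H)
    (hadd : ∀ x ∈ H, ∀ y ∈ H, x + y ∈ H)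
    (hcone : ∀ c : ℝ, 0 ≤ c → ∀ x ∈ H, c • x ∈ H)
    (hres : ∀ α > α₀, ∀ x, α • x - T x ∈ H → x ∈ H)
    {x z : E} (hx : x ∈ interior H) (hTx : β • x - T x ∈ H) (hβγ : β < γ)
    (hz : γ • z - T z ∈ H) : z ∈ H := by
  obtain ⟨α, hα⟩ := exists_gt (max α₀ γ)
  rw [max_lt_iff] at hα
  obtain ⟨ε, hε, hεz⟩ := exists_add_smul_mem_of_mem_interior hx z
  have hd : 0 < α - β := by linarith
  have hρ0 : 0 ≤ (α - γ) / (α - β) := div_nonneg (by linarith) hd.le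
  refine mem_of_forall_mul_mem (ρ := (α - γ) / (α - β)) (t := ε⁻¹) hclosed hρ0
    (by rw [div_lt_one hd]; linarith) (x := x) fun n => ?_
  induction n with
  | zero =>
    have h := hcone ε⁻¹ (by positivity) _ hεz
    rw [smul_add, inv_smul_smul₀ hε.ne'] at h
    simpa [add_comm] using h
  | succ n ih =>
    set ρ := (α - γ) / (α - β) with hρ
    have hρd : ρ * (α - β) = α - γ := by rw [hρ]; field_simp
    apply hres α hα.1
    have e : α • (z + (ρ ^ (n + 1) * ε⁻¹) • x) - T (z + (ρ ^ (n + 1) * ε⁻¹) • x)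
        = (ρ * (α - β)) • (z + (ρ ^ n * ε⁻¹) • x)
          + ((γ • z - T z) + (ρ ^ (n + 1) * ε⁻¹) • (β • x - T x))
          + (α - γ - ρ * (α - β)) • z := by
      simp only [map_add, map_smul]
      module
    rw [e, hρd, sub_self, zero_smul, add_zero]
    exact hadd _ (hcone _ (by linarith) _ ih) _
      (hadd _ hz _ (hcone _ (by positivity) _ hTx))

/-- A supersolution in the interior of the cone bounds the real parts of the eigenvalues. -/
lemma re_le_of_supersolution (hclosed : IsClosed H)
    (hadd : ∀ x ∈ H, ∀ y ∈ H, x + y ∈ H)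
    (hcone : ∀ c : ℝ, 0 ≤ c → ∀ x ∈ H, c • x ∈ H)
    (hpointed : ∀ x ∈ H, -x ∈ H → x = 0)
    (hres : ∀ α > α₀, ∀ x, α • x - T x ∈ H → x ∈ H)
    {x u v : E} (hx : x ∈ interior H) (hTx : β • x - T x ∈ H)
    {a b : ℝ} (huv : u ≠ 0 ∨ v ≠ 0) (hu : T u = a • u - b • v) (hv : T v = b • u + a • v) :
    a ≤ β := by
  by_contra! hlt
  obtain ⟨α, hα⟩ := exists_gt (max α₀ (max β ((a ^ 2 + b ^ 2 - β ^ 2) / (2 * (a - β)))))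
  simp only [max_lt_iff] at hα
  obtain ⟨hα₀, hαβ, hα⟩ := hα
  have hd : 0 < α - β := by linarith
  rw [div_lt_iff₀ (by linarith)] at hα
  set m := √((α - a) ^ 2 + b ^ 2) with hm
  have hm0 : 0 ≤ m := Real.sqrt_nonneg _
  have hm2 : m ^ 2 = (α - a) ^ 2 + b ^ 2 := Real.sq_sqrt (by positivity)
  have hmd : m < α - β := by
    apply lt_of_pow_lt_pow_left₀ 2 hd.le
    rw [hm2]
    nlinarith
  obtain ⟨t, ht, hstart⟩ : ∃ t : ℝ, 0 ≤ t ∧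
      ∀ c d : ℝ, c ^ 2 + d ^ 2 ≤ 1 → c • u + d • v + t • x ∈ H := by
    have key : ∀ y : E, ∃ t : ℝ, 0 ≤ t ∧ ∀ c : ℝ, 0 ≤ c → c ≤ 1 → c • y + t • x ∈ H := by
      intro y
      obtain ⟨ε, hε, hεy⟩ := exists_add_smul_mem_of_mem_interior hx y
      refine ⟨ε⁻¹, by positivity, fun c h0 h1 => ?_⟩
      have h := hadd _ (hcone (c * ε⁻¹) (by positivity) _ hεy) _
        (hcone ((1 - c) * ε⁻¹) (mul_nonneg (by linarith) (by positivity)) x (interior_subset hx))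
      have e : (c * ε⁻¹) • (x + ε • y) + ((1 - c) * ε⁻¹) • x
          = (c * (ε⁻¹ * ε)) • y + ε⁻¹ • x := by module
      rwa [e, inv_mul_cancel₀ hε.ne', mul_one] at h
    have key' : ∀ y : E, ∃ t : ℝ, 0 ≤ t ∧ ∀ c : ℝ, |c| ≤ 1 → c • y + t • x ∈ H := by
      intro y
      obtain ⟨t, ht, h⟩ := key y
      obtain ⟨t', ht', h'⟩ := key (-y)
      refine ⟨t + t', by positivity, fun c hc => ?_⟩
      have hxH := interior_subset hx
      rcases le_total 0 c with h0 | h0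
      · have := hadd _ (h c h0 ((le_abs_self c).trans hc)) _ (hcone t' ht' x hxH)
        convert this using 1
        module
      · have := hadd _ (h' (-c) (by linarith) ((neg_le_abs c).trans hc)) _ (hcone t ht x hxH)
        convert this using 1
        module
    obtain ⟨t, ht, h⟩ := key' u
    obtain ⟨t', ht', h'⟩ := key' v
    refine ⟨t + t', by positivity, fun c d hcd => ?_⟩
    have := hadd _ (h c (abs_le_one_iff_mul_self_le_one.2 (by nlinarith [sq_nonneg d]))) _
      (h' d (abs_le_one_iff_mul_self_le_one.2 (by nlinarith [sq_nonneg c])))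
    convert this using 1
    module
  have hall : ∀ n : ℕ, ∀ c d : ℝ, c ^ 2 + d ^ 2 ≤ 1 →
      c • u + d • v + ((m / (α - β)) ^ n * t) • x ∈ H := by
    intro n
    induction n with
    | zero => simpa using hstart
    | succ n ih =>
      intro c d hcd
      set ρ := m / (α - β) with hρ
      have hρ0 : 0 ≤ ρ := div_nonneg hm0 hd.le
      have hρd : ρ * (α - β) = m := by rw [hρ]; field_simp
      apply hres α hα₀
      obtain ⟨c', d', hcd', hc', hd'⟩ : ∃ c' d' : ℝ, c' ^ 2 + d' ^ 2 ≤ 1 ∧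
          m * c' = (α - a) * c - b * d ∧ m * d' = b * c + (α - a) * d := by
        rcases hm0.eq_or_lt with h0 | hpos
        · have hb : b = 0 := by nlinarith [sq_nonneg (α - a), sq_nonneg b]
          have ha : α - a = 0 := by nlinarith [sq_nonneg (α - a), sq_nonneg b]
          exact ⟨0, 0, by norm_num, by simp [ha, hb], by simp [ha, hb]⟩
        · refine ⟨((α - a) * c - b * d) / m, (b * c + (α - a) * d) / m, ?_,
            by field_simp, by field_simp⟩
          rw [div_pow, div_pow, ← add_div, div_le_one (by positivity), hm2]
          nlinarith [mul_le_mul_of_nonneg_left hcd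
            (by positivity : 0 ≤ (α - a) ^ 2 + b ^ 2)]
      have e : α • (c • u + d • v + (ρ ^ (n + 1) * t) • x)
          - T (c • u + d • v + (ρ ^ (n + 1) * t) • x)
          = m • (c' • u + d' • v + (ρ ^ n * t) • x)
            + (ρ ^ (n + 1) * t) • (β • x - T x) := by
        simp only [map_add, map_smul, hu, hv, smul_add, smul_smul, hc', hd']
        rw [← hρd]
        module
      rw [e]
      exact hadd _ (hcone m hm0 _ (ih c' d' hcd')) _ (hcone _ (by positivity) _ hTx)
  have hmem : ∀ c d : ℝ, c ^ 2 + d ^ 2 ≤ 1 → c • u + d • v ∈ H := fun c d hcd =>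
    mem_of_forall_mul_mem hclosed (div_nonneg hm0 hd.le) (by rwa [div_lt_one hd])
      fun n => hall n c d hcd
  rcases huv with h | h
  · exact h (hpointed u (by simpa using hmem 1 0 (by norm_num))
      (by simpa using hmem (-1) 0 (by norm_num)))
  · exact h (hpointed v (by simpa using hmem 0 1 (by norm_num))
      (by simpa using hmem 0 (-1) (by norm_num)))

/-- Limits of normalized solutions of `β • x - T x = e`, as `β` decreases to `s`. -/
lemma exists_smul_sub_eq_smul_of_forall_gt [FiniteDimensional ℝ E] (hclosed : IsClosed H)
    (hcone : ∀ c : ℝ, 0 ≤ c → ∀ x ∈ H, c • x ∈ H) {s : ℝ} {e : E}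
    (h : ∀ β > s, ∃ x ∈ H, β • x - T x = e) :
    ∃ p : ℝ, 0 ≤ p ∧ ∃ y ∈ H, ‖y‖ = 1 - p ∧ s • y - T y = p • e := by
  have hpos : ∀ n : ℕ, s + 1 / ((n : ℝ) + 1) > s := fun n => by
    have : 0 < 1 / ((n : ℝ) + 1) := by positivity
    linarith
  choose x hxH hx using fun n : ℕ => h _ (hpos n)
  let p : ℕ → ℝ := fun n => (1 + ‖x n‖)⁻¹
  have hp0 : ∀ n, 0 ≤ p n := fun n => by positivity
  have hpn : ∀ n, ‖p n • x n‖ = 1 - p n := fun n => by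
    have : 1 + ‖x n‖ ≠ 0 := by positivity
    rw [norm_smul, Real.norm_of_nonneg (hp0 n)]
    simp only [p]
    field_simp
    ring
  have hp1 : ∀ n, p n ≤ 1 := fun n => by linarith [norm_nonneg (p n • x n), hpn n]
  obtain ⟨⟨q, y⟩, -, φ, hφ, hlim⟩ :=
    (isCompact_Icc.prod (isCompact_closedBall (0 : E) 1)).tendsto_subseq
      (x := fun n => (p n, p n • x n)) (s := Set.Icc (0 : ℝ) 1 ×ˢ Metric.closedBall (0 : E) 1)
      (fun n => ⟨⟨hp0 n, hp1 n⟩, by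
        rw [mem_closedBall_zero_iff]; linarith [hpn n, hp0 n]⟩)
  have hq : Tendsto (fun n => p (φ n)) atTop (𝓝 q) := hlim.fst_nhds
  have hy : Tendsto (fun n => p (φ n) • x (φ n)) atTop (𝓝 y) := hlim.snd_nhds
  refine ⟨q, ge_of_tendsto' hq fun n => hp0 _, y,
    hclosed.mem_of_tendsto hy (Eventually.of_forall fun n => hcone _ (hp0 _) _ (hxH _)), ?_, ?_⟩
  · refine tendsto_nhds_unique hy.norm ?_
    simpa only [hpn] using hq.const_sub 1
  · have hβ : Tendsto (fun n => s + 1 / ((φ n : ℝ) + 1)) atTop (𝓝 s) := by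
      simpa using ((tendsto_one_div_add_atTop_nhds_zero_nat (𝕜 := ℝ)).comp
        hφ.tendsto_atTop).const_add s
    have hT := (T.continuous_of_finiteDimensional.tendsto y).comp hy
    refine tendsto_nhds_unique ((hβ.smul hy).sub hT) ?_
    refine (hq.smul_const e).congr fun n => ?_
    rw [← hx (φ n)]
    simp only [Function.comp_apply, map_smul]
    module

end Cone

/-- Perron–Frobenius type theorem for resolvent positive linear maps on a
finite-dimensional real inner product space ordered by a closed, solid, pointed
convex cone: the spectral abscissa is an eigenvalue with an eigenvector in the cone. -/
theorem stmt_4 {E : Type*} [NormedAddCommGroup E] [InnerProductSpace ℝ E]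
    [FiniteDimensional ℝ E]
    (H : Set E) (hclosed : IsClosed H) (hconv : Convex ℝ H)
    (hcone : ∀ c : ℝ, 0 ≤ c → ∀ x ∈ H, c • x ∈ H)
    (hpointed : H ∩ (-H) = {0})
    (hsolid : (interior H).Nonempty)
    (T : E →ₗ[ℝ] E)
    (hres : ∃ α₀ : ℝ, ∀ α : ℝ, α > α₀ →
      Function.Bijective (α • (LinearMap.id : E →ₗ[ℝ] E) - T) ∧
      ∀ x : E, (α • (LinearMap.id : E →ₗ[ℝ] E) - T) x ∈ H → x ∈ H)
    (αs : ℝ)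
    (hαs : IsGreatest {x : ℝ | ∃ μ : ℂ,
      Module.End.HasEigenvalue (LinearMap.baseChange ℂ T :
        Module.End ℂ (ℂ ⊗[ℝ] E)) μ ∧ μ.re = x} αs) :
    Module.End.HasEigenvalue (T : Module.End ℝ E) αs ∧
    ∃ X ∈ H, X ≠ 0 ∧ T X = αs • X := by
  obtain ⟨α₀, hα₀⟩ := hres
  have hres : ∀ α > α₀, ∀ x, α • x - T x ∈ H → x ∈ H := fun α hα => (hα₀ α hα).2
  have hadd : ∀ x ∈ H, ∀ y ∈ H, x + y ∈ H := by
    intro x hx y hy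
    have h := hcone 2 (by norm_num) _
      (hconv hx hy (by norm_num : (0 : ℝ) ≤ 1 / 2) (by norm_num : (0 : ℝ) ≤ 1 / 2) (by norm_num))
    have e : (2 : ℝ) • ((1 / 2 : ℝ) • x + (1 / 2 : ℝ) • y) = x + y := by module
    rwa [e] at h
  have hpt : ∀ x ∈ H, -x ∈ H → x = 0 := fun x hx hnx => by
    have : x ∈ H ∩ (-H) := ⟨hx, hnx⟩
    rwa [hpointed] at this
  obtain ⟨e, he⟩ := hsolid
  have heH : e ∈ H := interior_subset he
  let B : Set ℝ := {β | ∃ x ∈ interior H, β • x - T x ∈ H}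
  have hBne : B.Nonempty := by
    obtain ⟨β, hβ⟩ := exists_gt α₀
    obtain ⟨x, hx⟩ := (hα₀ β hβ).1.2 e
    have hx' : β • x - T x = e := hx
    exact ⟨β, x, mem_interior_of_smul_sub_mem_interior hadd hcone hres
      (hres β hβ x (hx'.symm ▸ heH)) (hx'.symm ▸ he), hx'.symm ▸ heH⟩
  have hBlb : αs ∈ lowerBounds B := by
    rintro β ⟨x, hx, hTx⟩
    obtain ⟨μ, hμ, rfl⟩ := hαs.1
    obtain ⟨u, v, huv, hu, hv⟩ := exists_real_parts_of_hasEigenvalue_baseChange hμ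
    exact re_le_of_supersolution hclosed hadd hcone hpt hres hx hTx huv hu hv
  have hBbdd : BddBelow B := ⟨αs, hBlb⟩
  have hsol : ∀ γ > sInf B, ∃ z ∈ H, γ • z - T z = e := by
    intro γ hγ
    obtain ⟨β, ⟨x, hx, hTx⟩, hβγ⟩ := exists_lt_of_csInf_lt hBne hγ
    have hmem : ∀ z, γ • z - T z ∈ H → z ∈ H := fun z hz =>
      mem_of_smul_sub_mem hclosed hadd hcone hres hx hTx hβγ hz
    have h0 : (0 : E) ∈ H := by simpa using hcone 0 le_rfl e heH
    have hinj : Function.Injective (γ • (LinearMap.id : E →ₗ[ℝ] E) - T) := by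
      rw [injective_iff_map_eq_zero]
      intro z hz
      have hz' : γ • z - T z = 0 := hz
      refine hpt z (hmem z (hz'.symm ▸ h0)) (hmem (-z) ?_)
      have : γ • (-z) - T (-z) = -(γ • z - T z) := by rw [map_neg]; module
      rwa [this, hz', neg_zero]
    obtain ⟨z, hz⟩ := LinearMap.injective_iff_surjective.1 hinj e
    have hz' : γ • z - T z = e := hz
    exact ⟨z, hmem z (hz'.symm ▸ heH), hz'⟩
  obtain ⟨p, hp, y, hyH, hynorm, hy⟩ := exists_smul_sub_eq_smul_of_forall_gt hclosed hcone hsol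
  have hp0 : p = 0 := by
    by_contra hne
    have hpe : p • e ∈ interior H :=
      smul_mem_interior_of_pos hcone (lt_of_le_of_ne hp (Ne.symm hne)) he
    have hyint : y ∈ interior H :=
      mem_interior_of_smul_sub_mem_interior hadd hcone hres hyH (hy.symm ▸ hpe)
    obtain ⟨ε, hε, hmem⟩ := exists_add_smul_mem_of_mem_interior hpe (-y)
    have hB : sInf B - ε ∈ B := by
      refine ⟨y, hyint, ?_⟩
      have : (sInf B - ε) • y - T y = (sInf B • y - T y) + ε • (-y) := by module
      rwa [this, hy]
    linarith [csInf_le hBbdd hB]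
  have hy0 : y ≠ 0 := by
    rintro rfl
    simp [hp0] at hynorm
  have hTy : T y = sInf B • y := by
    rw [hp0, zero_smul, sub_eq_zero] at hy
    exact hy.symm
  have hs : sInf B = αs := le_antisymm
    (hαs.2 ⟨_, hasEigenvalue_baseChange_of_apply_eq_smul hy0 hTy, by simp⟩)
    (le_csInf hBne hBlb)
  rw [hs] at hTy
  exact ⟨Module.End.hasEigenvalue_of_hasEigenvector
    ⟨Module.End.mem_eigenspace_iff.2 hTy, hy0⟩, y, hyH, hy0, hTy⟩
end

section
/- Let Â, N̂_1, …, N̂_q ∈ ℝ^{n×n}, B̂ ∈ ℝ^{n×m}, Ĉ ∈ ℝ^{p×n}, and let K = (k_{ij}) ∈ ℝ^{q×q} be symmetric positive semidefinite. For r < n, let Â_r and N̂_{i,r} be the leading r×r blocks of Â and N̂_i, B̂_r the first r rows of B̂, and Ĉ_r the first r columns of Ĉ. Assume (Â, N̂_i) is mean square asymptotically stable, encoded by the existence of X ≻ 0 with ÂᵀX + XÂ + Σ_{i,j=1}^q N̂_iᵀ X N̂_j k_{ij} ≺ 0. Let Σ̂ = diag(Σ̂_r, Σ̂_{2}) be a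 positive definite diagonal matrix, with Σ̂_r its leading r×r block and Σ̂_{2} the trailing (n−r)×(n−r) block, such that the sets of diagonal entries of Σ̂_r and Σ̂_{2} are disjoint, and such that ÂᵀΣ̂ + Σ̂Â + Σ_{i,j=1}^q N̂_iᵀ Σ̂ N̂_j k_{ij} ⪯ −ĈᵀĈ and ÂᵀΣ̂⁻¹ + Σ̂⁻¹Â + Σ_{i,j=1}^q N̂_iᵀ Σ̂⁻¹ N̂_j k_{ij} ⪯ −Σ̂⁻¹B̂B̂ᵀΣ̂⁻¹. Then (Â_r, N̂_{i,r}) is mean square asymptotically stable, i.e., there exists X_r ≻ 0 (r×r, symmetric) with Â_rᵀX_r + X_rÂ_r + Σ_{i,j=1}^q N̂_{i,r}ᵀ X_r N̂_{j,r} k_{ij} ≺ 0. -/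
open Matrix BigOperators

section StochasticLyapunov

variable {n ι : Type*} [Fintype n] [Fintype ι]

/-- The generalized Lyapunov operator `X ↦ AᵀX + XA + ∑ NₗᵀXNₗ`. -/
def lyap (A : Matrix n n ℝ) (N : ι → Matrix n n ℝ) (X : Matrix n n ℝ) : Matrix n n ℝ :=
  Aᵀ * X + X * A + ∑ l, (N l)ᵀ * X * N l

/-- The trace adjoint `V ↦ AV + VAᵀ + ∑ NₗVNₗᵀ` of `lyap`. -/
def lyapAdj (A : Matrix n n ℝ) (N : ι → Matrix n n ℝ) (V : Matrix n n ℝ) : Matrix n n ℝ :=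
  A * V + V * Aᵀ + ∑ l, N l * V * (N l)ᵀ

theorem trace_mul_lyap (A : Matrix n n ℝ) (N : ι → Matrix n n ℝ) (V X : Matrix n n ℝ) :
    (V * lyap A N X).trace = (lyapAdj A N V * X).trace := by
  simp only [lyap, lyapAdj, mul_add, add_mul, trace_add, Finset.mul_sum, Finset.sum_mul, trace_sum]
  have h1 : (V * (Aᵀ * X)).trace = (V * Aᵀ * X).trace := by rw [mul_assoc]
  have h2 : (V * (X * A)).trace = (A * V * X).trace := by
    rw [← mul_assoc, trace_mul_comm, mul_assoc]
  have h3 (l : ι) : (V * ((N l)ᵀ * X * N l)).trace = (N l * V * (N l)ᵀ * X).trace := by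
    rw [← mul_assoc, trace_mul_comm]
    simp only [mul_assoc]
  rw [h1, h2, Finset.sum_congr rfl fun l _ => h3 l, add_comm (trace (V * Aᵀ * X))]

theorem transpose_lyap (A : Matrix n n ℝ) (N : ι → Matrix n n ℝ) {X : Matrix n n ℝ}
    (hX : Xᵀ = X) : (lyap A N X)ᵀ = lyap A N X := by
  simp only [lyap, transpose_add, transpose_mul, transpose_transpose, hX, transpose_sum, mul_assoc]
  rw [add_comm (X * A)]

theorem transpose_lyapAdj (A : Matrix n n ℝ) (N : ι → Matrix n n ℝ) {V : Matrix n n ℝ}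
    (hV : Vᵀ = V) : (lyapAdj A N V)ᵀ = lyapAdj A N V := by
  simp only [lyapAdj, transpose_add, transpose_mul, transpose_transpose, hV, transpose_sum,
    mul_assoc]
  rw [add_comm (V * Aᵀ)]

theorem lyap_add (A : Matrix n n ℝ) (N : ι → Matrix n n ℝ) (X Y : Matrix n n ℝ) :
    lyap A N (X + Y) = lyap A N X + lyap A N Y := by
  simp only [lyap, mul_add, add_mul, Finset.sum_add_distrib]
  abel

theorem lyap_smul (A : Matrix n n ℝ) (N : ι → Matrix n n ℝ) (c : ℝ) (X : Matrix n n ℝ) :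
    lyap A N (c • X) = c • lyap A N X := by
  simp only [lyap, mul_smul_comm, smul_mul_assoc, smul_add, Finset.smul_sum]

theorem lyapAdj_add (A : Matrix n n ℝ) (N : ι → Matrix n n ℝ) (V W : Matrix n n ℝ) :
    lyapAdj A N (V + W) = lyapAdj A N V + lyapAdj A N W := by
  simp only [lyapAdj, mul_add, add_mul, Finset.sum_add_distrib]
  abel

theorem lyapAdj_smul (A : Matrix n n ℝ) (N : ι → Matrix n n ℝ) (c : ℝ) (V : Matrix n n ℝ) :
    lyapAdj A N (c • V) = c • lyapAdj A N V := by
  simp only [lyapAdj, mul_smul_comm, smul_mul_assoc, smul_add, Finset.smul_sum]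

/-- The carré-du-champ identity for `lyap`, at matrices commuting with the reference `S`. -/
theorem lyap_dissipation (A : Matrix n n ℝ) (N : ι → Matrix n n ℝ) {S T : Matrix n n ℝ}
    (hT : Tᵀ = T) (hST : S * T = T * S) :
    lyap A N (T * S * T) - lyap A N (S * T) * T - T * lyap A N (S * T) + T * lyap A N S * T =
      ∑ l, (T * N l - N l * T)ᵀ * S * (T * N l - N l * T) := by
  have hN (l : ι) : (T * N l - N l * T)ᵀ * S * (T * N l - N l * T) =
      (N l)ᵀ * (T * S * T) * N l - (N l)ᵀ * (S * T) * N l * T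
        - T * ((N l)ᵀ * (S * T) * N l) + T * ((N l)ᵀ * S * N l) * T := by
    have : (N l)ᵀ * (S * T) * N l * T = (N l)ᵀ * (T * S) * N l * T := by rw [hST]
    rw [this]
    simp only [transpose_sub, transpose_mul, hT]
    noncomm_ring
  simp only [hN, Finset.sum_add_distrib, Finset.sum_sub_distrib, ← Finset.mul_sum,
    ← Finset.sum_mul, lyap]
  have h1 : T * S * T = S * T * T := by rw [hST]
  have h2 : T * (S * T * A) = S * T * T * A := by rw [← h1]; simp only [mul_assoc]
  have h3 : T * S * A * T = S * T * A * T := by rw [hST]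
  rw [h1]
  generalize ∑ l, (N l)ᵀ * (S * T * T) * N l = Q1
  generalize ∑ l, (N l)ᵀ * (S * T) * N l = Q2
  generalize ∑ l, (N l)ᵀ * S * N l = Q3
  simp only [mul_add, add_mul, ← mul_assoc] at h2 h3 ⊢
  rw [h2, h3]
  abel

open scoped MatrixOrder Matrix.Norms.L2Operator in
theorem exists_eq_conjTranspose_mul_self {M : Matrix n n ℝ} (hM : M.PosSemidef) :
    ∃ W : Matrix n n ℝ, M = Wᴴ * W := by
  classical
  exact CStarAlgebra.nonneg_iff_eq_star_mul_self.mp hM.nonneg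

theorem trace_mul_conj_nonneg {m : Type*} [Fintype m] {V : Matrix m m ℝ} {Y : Matrix n n ℝ}
    (hV : V.PosSemidef) (hY : Y.PosSemidef) (M : Matrix n m ℝ) :
    0 ≤ (V * (Mᵀ * Y * M)).trace := by
  classical
  obtain ⟨W, rfl⟩ := exists_eq_conjTranspose_mul_self hV
  have h := (hY.conjTranspose_mul_mul_same (M * Wᴴ)).trace_nonneg
  rw [mul_assoc, trace_mul_comm]
  simpa only [conjTranspose_eq_transpose_of_trivial, transpose_mul, transpose_transpose,
    Matrix.mul_assoc] using h

theorem mul_mul_eq_zero_of_trace_mul_conj {m : Type*} [Fintype m] {V : Matrix m m ℝ}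
    {Y : Matrix n n ℝ} (hV : V.PosSemidef) (hY : Y.PosSemidef) (M : Matrix n m ℝ)
    (h : (V * (Mᵀ * Y * M)).trace = 0) : Y * M * V = 0 := by
  classical
  obtain ⟨W, rfl⟩ := exists_eq_conjTranspose_mul_self hV
  obtain ⟨Q, rfl⟩ := exists_eq_conjTranspose_mul_self hY
  have h0 : Q * M * Wᴴ = 0 := by
    rw [← trace_conjTranspose_mul_self_eq_zero_iff, ← h, mul_assoc Wᴴ, trace_mul_comm Wᴴ]
    simp only [conjTranspose_eq_transpose_of_trivial, transpose_mul, transpose_transpose,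
      Matrix.mul_assoc]
  calc Qᴴ * Q * M * (Wᴴ * W) = Qᴴ * (Q * M * Wᴴ) * W := by simp only [Matrix.mul_assoc]
    _ = 0 := by rw [h0]; simp

theorem mul_eq_zero_of_trace_mul {V Y : Matrix n n ℝ} (hV : V.PosSemidef) (hY : Y.PosSemidef)
    (h : (V * Y).trace = 0) : Y * V = 0 := by
  classical
  simpa using mul_mul_eq_zero_of_trace_mul_conj hV hY 1 (by simpa using h)

theorem trace_mul_pos {V Y : Matrix n n ℝ} (hV : V.PosSemidef) (hV0 : V ≠ 0) (hY : Y.PosDef) :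
    0 < (V * Y).trace := by
  classical
  refine lt_of_le_of_ne (by simpa using trace_mul_conj_nonneg hV hY.posSemidef 1) fun h => hV0 ?_
  have h0 := mul_eq_zero_of_trace_mul hV hY.posSemidef h.symm
  have hu := hY.isUnit
  exact (hu.mul_right_eq_zero).1 h0


/-- `V` is a positive semidefinite matrix supported on the range of the projection `π` and fixed
by the compression to `π` of the adjoint Lyapunov operator. -/
structure IsCompressedFixed (A : Matrix n n ℝ) (N : ι → Matrix n n ℝ) (π V : Matrix n n ℝ) :
    Prop where
  posSemidef : V.PosSemidef
  proj_mul : π * V = V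
  fixed : π * lyapAdj A N V * π = 0

section CompressedFixed

variable {A : Matrix n n ℝ} {N : ι → Matrix n n ℝ} {π V S T : Matrix n n ℝ}

theorem IsCompressedFixed.transpose_eq (h : IsCompressedFixed A N π V) : Vᵀ = V := by
  simpa using h.posSemidef.isHermitian.eq

theorem IsCompressedFixed.mul_proj (h : IsCompressedFixed A N π V) (hπ : πᵀ = π) :
    V * π = V := by
  have := congrArg transpose h.proj_mul
  rwa [transpose_mul, h.transpose_eq, hπ] at this

variable [DecidableEq n]

theorem IsCompressedFixed.trace_mul_lyap (h : IsCompressedFixed A N π V) (hπ : πᵀ = π)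
    (hππ : π * π = π) {X : Matrix n n ℝ} (hX : π * X = X * π) :
    (V * lyap A N X).trace =
      ∑ l, (V * (((1 - π) * N l)ᵀ * X * ((1 - π) * N l))).trace := by
  rw [_root_.trace_mul_lyap]
  have hcX : (1 - π) * X = X * (1 - π) := by rw [sub_mul, mul_sub, hX, one_mul, mul_one]
  have hVc : V * (1 - π) = 0 := by rw [mul_sub, h.mul_proj hπ, mul_one, sub_self]
  have hcV : (1 - π) * V = 0 := by rw [sub_mul, h.proj_mul, one_mul, sub_self]
  have hsplit : lyapAdj A N V * X =
      lyapAdj A N V * (π * X * π) + lyapAdj A N V * ((1 - π) * X) := by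
    rw [← mul_add, mul_assoc π, ← hX, ← mul_assoc π, hππ, sub_mul, one_mul, add_sub_cancel]
  have h1 : (lyapAdj A N V * (π * X * π)).trace = 0 := by
    rw [← mul_assoc, trace_mul_comm, ← mul_assoc, ← mul_assoc, h.fixed]
    simp
  have h2 : (A * V * ((1 - π) * X)).trace = 0 := by
    rw [← mul_assoc, mul_assoc A, hVc]
    simp
  have h3 : (V * Aᵀ * ((1 - π) * X)).trace = 0 := by
    rw [trace_mul_comm, hcX, ← mul_assoc, mul_assoc X, hcV]
    simp
  have h4 (l : ι) : (N l * V * (N l)ᵀ * ((1 - π) * X)).trace =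
      (V * (((1 - π) * N l)ᵀ * X * ((1 - π) * N l))).trace := by
    have hc : (1 - π) * X = (1 - π) * X * (1 - π) := by
      rw [mul_assoc, ← hcX, ← mul_assoc]
      congr 1
      simp [mul_sub, sub_mul, hππ]
    rw [hc, mul_assoc, mul_assoc, trace_mul_comm]
    simp only [transpose_mul, transpose_sub, transpose_one, hπ, mul_assoc]
  rw [hsplit, trace_add, h1, zero_add, lyapAdj, add_mul, add_mul, trace_add, trace_add, h2, h3,
    Finset.sum_mul, trace_sum, Finset.sum_congr rfl fun l _ => h4 l]
  simp

theorem IsCompressedFixed.trace_mul_lyap_nonneg (h : IsCompressedFixed A N π V) (hπ : πᵀ = π)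
    (hππ : π * π = π) {X : Matrix n n ℝ} (hX : π * X = X * π) (hXpos : X.PosSemidef) :
    0 ≤ (V * lyap A N X).trace := by
  rw [h.trace_mul_lyap hπ hππ hX]
  exact Finset.sum_nonneg fun l _ => trace_mul_conj_nonneg h.posSemidef hXpos _

theorem IsCompressedFixed.lyap_mul_eq_zero (h : IsCompressedFixed A N π V) (hπ : πᵀ = π)
    (hππ : π * π = π) {X : Matrix n n ℝ} (hX : π * X = X * π) (hXpos : X.PosSemidef)
    (hL : (-lyap A N X).PosSemidef) :
    (V * lyap A N X).trace = 0 ∧ lyap A N X * V = 0 := by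
  have h1 := h.trace_mul_lyap_nonneg hπ hππ hX hXpos
  have h2 := trace_mul_conj_nonneg h.posSemidef hL 1
  have h3 : (V * lyap A N X).trace = 0 := by
    simp at h2
    linarith
  refine ⟨h3, ?_⟩
  have := mul_eq_zero_of_trace_mul h.posSemidef hL (by simpa using h3)
  simpa using this

theorem IsCompressedFixed.compl_mul_eq_zero (h : IsCompressedFixed A N π V) (hπ : πᵀ = π)
    (hππ : π * π = π) (hπS : π * S = S * π) (hS : S.PosDef)
    (hL : (-lyap A N S).PosSemidef) (l : ι) : (1 - π) * N l * V = 0 := by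
  have h1 := (h.lyap_mul_eq_zero hπ hππ hπS hS.posSemidef hL).1
  rw [h.trace_mul_lyap hπ hππ hπS, Finset.sum_eq_zero_iff_of_nonneg
    fun l _ => trace_mul_conj_nonneg h.posSemidef hS.posSemidef _] at h1
  have h2 := mul_mul_eq_zero_of_trace_mul_conj h.posSemidef hS.posSemidef _
    (h1 l (Finset.mem_univ l))
  rw [mul_assoc] at h2
  exact (hS.isUnit.mul_right_eq_zero).1 h2

theorem IsCompressedFixed.commute (h : IsCompressedFixed A N π V) (hπ : πᵀ = π)
    (hππ : π * π = π) (hπS : π * S = S * π) (hπT : π * T = T * π) (hST : S * T = T * S)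
    (hT : Tᵀ = T) (hS : S.PosDef) (hSTpos : (S * T).PosSemidef)
    (hL : (-lyap A N S).PosSemidef) (hLT : (-lyap A N (S * T)).PosSemidef) :
    (∀ l, N l * T * V = T * N l * V) ∧ A * T * V = T * A * V := by
  have hLV := (h.lyap_mul_eq_zero hπ hππ hπS hS.posSemidef hL).2
  have hπST : π * (S * T) = S * T * π := by rw [← mul_assoc, hπS, mul_assoc, hπT, mul_assoc]
  have hLTV := (h.lyap_mul_eq_zero hπ hππ hπST hSTpos hLT).2
  have hVLT : V * lyap A N (S * T) = 0 := by
    have := congrArg transpose hLTV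
    rwa [transpose_mul, h.transpose_eq, transpose_lyap, transpose_zero] at this
    rw [transpose_mul, hT, hST]
    congr 1
    simpa using hS.isHermitian.eq
  have hTST : (V * lyap A N (T * S * T)).trace = 0 := by
    rw [h.trace_mul_lyap hπ hππ]
    · refine Finset.sum_eq_zero fun l _ => ?_
      rw [trace_mul_comm, mul_assoc, h.compl_mul_eq_zero hπ hππ hπS hS hL l]
      simp
    · rw [mul_assoc T, ← mul_assoc π, hπT, mul_assoc T π, hπST, ← mul_assoc T (S * T)]
  have hTV : (V * (T * lyap A N (S * T))).trace = 0 := by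
    rw [← mul_assoc, trace_mul_comm, ← mul_assoc, hLTV]
    simp
  have hVT : (V * (lyap A N (S * T) * T)).trace = 0 := by
    rw [← mul_assoc, hVLT]
    simp
  have hdis : (V * (T * lyap A N S * T)).trace =
      ∑ l, (V * ((T * N l - N l * T)ᵀ * S * (T * N l - N l * T))).trace := by
    rw [← trace_sum, ← Finset.mul_sum, ← lyap_dissipation A N hT hST]
    simp only [mul_add, mul_sub, trace_add, trace_sub, hTST, hTV, hVT]
    ring
  have hle := trace_mul_conj_nonneg h.posSemidef hL T
  have hnonneg (l : ι) := trace_mul_conj_nonneg h.posSemidef hS.posSemidef (T * N l - N l * T)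
  have hTLT : (V * (Tᵀ * -lyap A N S * T)).trace = -(V * (T * lyap A N S * T)).trace := by
    rw [hT]
    simp
  have hsum : ∑ l, (V * ((T * N l - N l * T)ᵀ * S * (T * N l - N l * T))).trace = 0 := by
    refine le_antisymm ?_ (Finset.sum_nonneg fun l _ => hnonneg l)
    linarith
  have hLTV0 : (V * (Tᵀ * -lyap A N S * T)).trace = 0 := by
    linarith
  have hN (l : ι) : N l * T * V = T * N l * V := by
    have h0 := (Finset.sum_eq_zero_iff_of_nonneg fun l _ => hnonneg l).1 hsum l (Finset.mem_univ l)
    have h1 := mul_mul_eq_zero_of_trace_mul_conj h.posSemidef hS.posSemidef _ h0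
    rw [mul_assoc] at h1
    have h2 := (hS.isUnit.mul_right_eq_zero).1 h1
    rw [sub_mul, sub_eq_zero] at h2
    exact h2.symm
  refine ⟨hN, ?_⟩
  have h1 : lyap A N S * T * V = 0 := by
    simpa using mul_mul_eq_zero_of_trace_mul_conj h.posSemidef hL T hLTV0
  have h2 : lyap A N S * T * V - lyap A N (S * T) * V = S * (A * T * V - T * A * V) := by
    have h3 (l : ι) : (N l)ᵀ * S * N l * T * V = (N l)ᵀ * (S * T) * N l * V := by
      have := congrArg (fun M => (N l)ᵀ * S * M) (hN l)
      simpa only [mul_assoc] using this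
    simp only [lyap, add_mul, Finset.sum_mul, h3]
    noncomm_ring
  rw [h1, hLTV, sub_zero] at h2
  exact sub_eq_zero.1 ((hS.isUnit.mul_right_eq_zero).1 h2.symm)

theorem IsCompressedFixed.conj (h : IsCompressedFixed A N π V) (hπT : π * T = T * π)
    (hT : Tᵀ = T) (hN : ∀ l, N l * T * V = T * N l * V) (hA : A * T * V = T * A * V) :
    IsCompressedFixed A N π (T * V * T) where
  posSemidef := by
    simpa [hT] using h.posSemidef.conjTranspose_mul_mul_same T
  proj_mul := by rw [← mul_assoc, ← mul_assoc, hπT, mul_assoc T, h.proj_mul]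
  fixed := by
    have hA' : V * T * Aᵀ = V * Aᵀ * T := by
      simpa [transpose_mul, hT, h.transpose_eq, mul_assoc] using congrArg transpose hA
    have hN' (l : ι) : V * T * (N l)ᵀ = V * (N l)ᵀ * T := by
      simpa [transpose_mul, hT, h.transpose_eq, mul_assoc] using congrArg transpose (hN l)
    have hNN (l : ι) : N l * (T * V * T) * (N l)ᵀ = T * (N l * V * (N l)ᵀ) * T := by
      calc N l * (T * V * T) * (N l)ᵀ = N l * T * V * T * (N l)ᵀ := by simp only [mul_assoc]
        _ = T * N l * (V * T * (N l)ᵀ) := by rw [hN]; simp only [mul_assoc]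
        _ = _ := by rw [hN']; simp only [mul_assoc]
    have key : lyapAdj A N (T * V * T) = T * lyapAdj A N V * T := by
      simp only [lyapAdj, hNN, mul_add, add_mul, Finset.mul_sum, Finset.sum_mul]
      congr 2
      · rw [← mul_assoc, ← mul_assoc, hA, mul_assoc T A V]
      · rw [mul_assoc T V T, mul_assoc T, hA', ← mul_assoc]
    have : π * (T * lyapAdj A N V * T) * π = T * (π * lyapAdj A N V * π) * T := by
      rw [mul_assoc, mul_assoc, ← hπT]
      simp only [← mul_assoc, hπT]
      rw [mul_assoc _ T π, ← hπT, ← mul_assoc]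
    rw [key, this, h.fixed]
    simp

theorem IsCompressedFixed.mul_pow_mul (h : IsCompressedFixed A N π V) (hπ : πᵀ = π)
    (hππ : π * π = π) (hπS : π * S = S * π) (hπT : π * T = T * π) (hST : S * T = T * S)
    (hT : Tᵀ = T) (hTu : IsUnit T) (hS : S.PosDef) (hSTpos : (S * T).PosSemidef)
    (hL : (-lyap A N S).PosSemidef) (hLT : (-lyap A N (S * T)).PosSemidef) (k : ℕ) :
    A * T ^ k * V = T ^ k * A * V := by
  have hfix (k : ℕ) : IsCompressedFixed A N π (T ^ k * V * T ^ k) := by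
    induction k with
    | zero => simpa using h
    | succ k ih =>
      obtain ⟨hN, hA⟩ := ih.commute hπ hππ hπS hπT hST hT hS hSTpos hL hLT
      have := ih.conj hπT hT hN hA
      rwa [← mul_assoc, ← mul_assoc, ← pow_succ', mul_assoc _ (T ^ k) T, ← pow_succ] at this
  induction k with
  | zero => simp
  | succ k ih =>
    have hA := ((hfix k).commute hπ hππ hπS hπT hST hT hS hSTpos hL hLT).2
    rw [← mul_assoc, ← mul_assoc] at hA
    have hA' : A * T * (T ^ k * V) = T * A * (T ^ k * V) := by
      apply (hTu.pow k).mul_left_injective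
      simpa only [mul_assoc] using hA
    rw [pow_succ', mul_assoc T (T ^ k), mul_assoc T, ← ih]
    simpa only [mul_assoc] using hA'

/-- A matrix commuting with all powers of `diagonal t` on `V` maps the columns of `V` to vectors
supported on the values of `t` seen by the support of `V`. -/
theorem mul_apply_eq_zero_of_mul_diagonal_pow {t : n → ℝ} {P : n → Prop} [DecidablePred P]
    (hAV : ∀ k : ℕ, A * diagonal t ^ k * V = diagonal t ^ k * A * V)
    (hV : ∀ i j, ¬ P i → V i j = 0) {i : n} (hi : ∀ l, P l → t l ≠ t i) (j : n) :
    (A * V) i j = 0 := by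
  have hpoly (p : Polynomial ℝ) :
      ∑ l, A i l * p.eval (t l) * V l j = p.eval (t i) * (A * V) i j := by
    induction p using Polynomial.induction_on' with
    | add p q hp hq =>
      simp only [Polynomial.eval_add, mul_add, add_mul, Finset.sum_add_distrib, hp, hq]
    | monomial k c =>
      have h := congrFun (congrFun (hAV k) i) j
      rw [mul_assoc, mul_assoc, diagonal_pow, diagonal_mul, mul_apply] at h
      simp only [diagonal_mul, Pi.pow_apply] at h
      simp only [Polynomial.eval_monomial]
      rw [mul_assoc, ← h, Finset.mul_sum]
      exact Finset.sum_congr rfl fun l _ => by ring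
  have h := hpoly (∏ l with P l, (Polynomial.X - Polynomial.C (t l)))
  rw [Finset.sum_eq_zero] at h
  · refine (mul_eq_zero.1 h.symm).resolve_left ?_
    simp only [Polynomial.eval_prod, Finset.prod_ne_zero_iff, Finset.mem_filter]
    intro l hl
    simpa [sub_eq_zero] using (hi l hl.2).symm
  · intro l _
    by_cases hl : P l
    · rw [Polynomial.eval_prod, Finset.prod_eq_zero (i := l)] <;> simp [hl]
    · simp [hV l j hl]

theorem IsCompressedFixed.eq_zero (h : IsCompressedFixed A N π V) (hπ : πᵀ = π)
    (hA : (1 - π) * A * V = 0) (hN : ∀ l, (1 - π) * N l * V = 0) {X : Matrix n n ℝ}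
    (hX : (-lyap A N X).PosDef) : V = 0 := by
  by_contra hV0
  have hA1 : A * V = π * (A * V) := by
    rw [mul_assoc, sub_mul, one_mul, sub_eq_zero] at hA
    exact hA
  have hA2 : V * Aᵀ = V * Aᵀ * π := by
    simpa [transpose_mul, h.transpose_eq, hπ] using congrArg transpose hA1
  have hN1 (l : ι) : N l * V = π * (N l * V) := by
    have := hN l
    rw [mul_assoc, sub_mul, one_mul, sub_eq_zero] at this
    exact this
  have hN2 (l : ι) : V * (N l)ᵀ = V * (N l)ᵀ * π := by
    simpa [transpose_mul, h.transpose_eq, hπ] using congrArg transpose (hN1 l)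
  have hA3 : π * (A * V) * π = A * V := by
    rw [← hA1, mul_assoc, h.mul_proj hπ]
  have hA4 : π * (V * Aᵀ) * π = V * Aᵀ := by
    rw [mul_assoc, ← hA2, ← mul_assoc, h.proj_mul]
  have hN3 (l : ι) : π * (N l * V * (N l)ᵀ) * π = N l * V * (N l)ᵀ := by
    rw [← mul_assoc, ← hN1, mul_assoc, mul_assoc, ← mul_assoc V, ← hN2, mul_assoc]
  have hfix : lyapAdj A N V = 0 := by
    rw [← h.fixed]
    simp only [lyapAdj, mul_add, add_mul, Finset.mul_sum, Finset.sum_mul, hN3, hA3, hA4]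
  have := trace_mul_pos h.posSemidef hV0 hX
  rw [mul_neg, trace_neg, _root_.trace_mul_lyap, hfix] at this
  simp at this

end CompressedFixed

section Alternative

variable (n) in
/-- The positive semidefinite matrices of unit trace. -/
def densityMatrices : Set (Matrix n n ℝ) := {V | V.PosSemidef ∧ V.trace = 1}

theorem convex_densityMatrices : Convex ℝ (densityMatrices n) := by
  intro V hV W hW a b ha hb hab
  refine ⟨(hV.1.smul ha).add (hW.1.smul hb), ?_⟩
  simp [trace_add, trace_smul, hV.2, hW.2, hab]

theorem posDef_of_forall_trace_mul_pos {X : Matrix n n ℝ} (hX : Xᵀ = X)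
    (h : ∀ V ∈ densityMatrices n, 0 < (V * X).trace) : X.PosDef := by
  refine .of_dotProduct_mulVec_pos (by simpa [IsHermitian] using hX) fun x hx => ?_
  have hpos : 0 < x ⬝ᵥ x := by
    simpa using dotProduct_star_self_pos_iff.2 hx
  have hmem : (x ⬝ᵥ x)⁻¹ • vecMulVec x x ∈ densityMatrices n := by
    refine ⟨(by simpa using posSemidef_vecMulVec_self_star x : (vecMulVec x x).PosSemidef).smul
      (inv_nonneg.2 hpos.le), ?_⟩
    rw [trace_smul, trace_vecMulVec, smul_eq_mul, inv_mul_cancel₀ hpos.ne']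
  have h1 := h _ hmem
  rw [smul_mul_assoc, trace_smul, smul_eq_mul, trace_mul_comm, mul_vecMulVec,
    trace_vecMulVec, dotProduct_comm] at h1
  simpa [dotProduct_comm] using (pos_iff_pos_of_mul_pos h1).1 (inv_pos.2 hpos)

theorem abs_apply_le_one_of_mem_densityMatrices {V : Matrix n n ℝ}
    (hV : V ∈ densityMatrices n) (i j : n) :
    |V i j| ≤ 1 := by
  classical
  have hdiag (i : n) : V i i ≤ 1 := by
    rw [← hV.2]
    exact Finset.single_le_sum (f := fun i => V i i) (fun i _ => hV.1.diag_nonneg)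
      (Finset.mem_univ i)
  have hsymm : V j i = V i j := by simpa using hV.1.isHermitian.apply i j
  have h1 := hV.1.dotProduct_mulVec_nonneg (Pi.single i 1 + Pi.single j 1)
  have h2 := hV.1.dotProduct_mulVec_nonneg (Pi.single i 1 - Pi.single j 1)
  simp [mulVec_add, mulVec_sub, add_dotProduct, sub_dotProduct, hsymm] at h1 h2
  have := hdiag i
  have := hdiag j
  exact abs_le.2 ⟨by linarith, by linarith⟩

open scoped Matrix.Norms.Elementwise in
theorem isCompact_densityMatrices : IsCompact (densityMatrices n) := by
  refine Metric.isCompact_of_isClosed_isBounded ?_ ?_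
  · have : densityMatrices n =
        ({V | Vᴴ = V} ∩ ⋂ x : n → ℝ, {V | 0 ≤ star x ⬝ᵥ V *ᵥ x}) ∩ {V | V.trace = 1} := by
      ext V
      simp only [densityMatrices, posSemidef_iff_dotProduct_mulVec, Set.mem_ofPred_eq,
        Set.mem_inter_iff, Set.mem_iInter, IsHermitian]
    rw [this]
    refine ((isClosed_eq (by fun_prop) (by fun_prop)).inter
      (isClosed_iInter fun x => isClosed_le (by fun_prop) (by fun_prop))).inter
      (isClosed_eq (by fun_prop) (by fun_prop))
  · refine (Metric.isBounded_iff_subset_closedBall 0).2 ⟨1, fun V hV => ?_⟩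
    rw [mem_closedBall_zero_iff, norm_le_iff zero_le_one]
    exact fun i j => abs_apply_le_one_of_mem_densityMatrices hV i j

open scoped Matrix.Norms.Elementwise in
theorem exists_posDef_add_smul {X S : Matrix n n ℝ} (hX : Xᵀ = X) (hS : S.PosDef) :
    ∃ c : ℝ, 0 ≤ c ∧ (X + c • S).PosDef := by
  have hpos (V) (hV : V ∈ densityMatrices n) : 0 < (V * S).trace := by
    refine trace_mul_pos hV.1 ?_ hS
    rintro rfl
    simpa using hV.2
  have hcont : ContinuousOn (fun V : Matrix n n ℝ => (V * X).trace / (V * S).trace)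
      (densityMatrices n) :=
    ContinuousOn.div (by fun_prop) (by fun_prop) fun V hV => (hpos V hV).ne'
  obtain ⟨b, hb⟩ := isCompact_densityMatrices.bddBelow_image hcont
  refine ⟨|b| + 1, by positivity, posDef_of_forall_trace_mul_pos ?_ fun V hV => ?_⟩
  · rw [transpose_add, transpose_smul, hX]
    congr 2
    simpa using hS.isHermitian.eq
  · have h1 : b ≤ (V * X).trace / (V * S).trace := hb ⟨V, hV, rfl⟩
    rw [le_div_iff₀ (hpos V hV)] at h1
    rw [mul_add, mul_smul_comm, trace_add, trace_smul, smul_eq_mul]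
    nlinarith [hpos V hV, neg_abs_le b]

open scoped Matrix.Norms.Elementwise in
/-- Theorem of the alternative for a Lyapunov operator with a positive definite supersolution. -/
theorem exists_posDef_lyap_or_exists_lyapAdj_eq_zero (A : Matrix n n ℝ) (N : ι → Matrix n n ℝ)
    {S : Matrix n n ℝ} (hS : S.PosDef) (hL : (-lyap A N S).PosSemidef) :
    (∃ X : Matrix n n ℝ, X.PosDef ∧ (-lyap A N X).PosDef) ∨
      ∃ V : Matrix n n ℝ, V.PosSemidef ∧ V ≠ 0 ∧ lyapAdj A N V = 0 := by
  classical
  let g : Matrix n n ℝ →ₗ[ℝ] Matrix n n ℝ :=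
    { toFun := lyapAdj A N
      map_add' := lyapAdj_add A N
      map_smul' := lyapAdj_smul A N }
  by_cases h0 : (0 : Matrix n n ℝ) ∈ g '' densityMatrices n
  · obtain ⟨V, hV, hV0⟩ := h0
    refine .inr ⟨V, hV.1, ?_, hV0⟩
    rintro rfl
    simpa using hV.2
  · left
    have : LocallyConvexSpace ℝ (Matrix n n ℝ) :=
      inferInstanceAs (LocallyConvexSpace ℝ (n → n → ℝ))
    obtain ⟨f, u, hf, hu⟩ := geometric_hahn_banach_closed_point
      (convex_densityMatrices.linear_image g)
      (isCompact_densityMatrices.image g.continuous_of_finiteDimensional).isClosed h0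
    rw [map_zero] at hu
    let F : Matrix n n ℝ := of fun i j => f (single i j 1)
    have hfF (M : Matrix n n ℝ) : f M = (Mᵀ * F).trace := by
      conv_lhs => rw [matrix_eq_sum_single M]
      simp only [map_sum, trace, diag, mul_apply, transpose_apply, F, of_apply]
      rw [Finset.sum_comm]
      refine Finset.sum_congr rfl fun i _ => Finset.sum_congr rfl fun j _ => ?_
      rw [← smul_eq_mul, ← map_smul, smul_single, smul_eq_mul, mul_one]
    have hXneg (V) (hV : V ∈ densityMatrices n) : 0 < (V * -lyap A N (F + Fᵀ)).trace := by
      have h1 := (hf _ ⟨V, hV, rfl⟩).trans hu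
      have h2 : (lyapAdj A N V)ᵀ = lyapAdj A N V :=
        transpose_lyapAdj A N (by simpa using hV.1.isHermitian.eq)
      have h3 : (lyapAdj A N V * F).trace < 0 := by
        rw [hfF] at h1
        rw [← h2]
        exact h1
      have h4 : (lyapAdj A N V * Fᵀ).trace = (lyapAdj A N V * F).trace := by
        rw [← trace_transpose, transpose_mul, transpose_transpose, h2, trace_mul_comm]
      rw [mul_neg, trace_neg, trace_mul_lyap, mul_add, trace_add, h4]
      linarith
    have hFsymm : (F + Fᵀ)ᵀ = F + Fᵀ := by simp [add_comm]
    have hneg : (-lyap A N (F + Fᵀ)).PosDef :=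
      posDef_of_forall_trace_mul_pos (by rw [transpose_neg, transpose_lyap A N hFsymm]) hXneg
    obtain ⟨c, hc, hpos⟩ := exists_posDef_add_smul hFsymm hS
    refine ⟨_, hpos, ?_⟩
    rw [lyap_add, lyap_smul, neg_add, ← smul_neg]
    exact hneg.add_posSemidef (hL.smul hc)

end Alternative

section Compression

variable {κ : Type*} [Fintype κ] [DecidableEq κ] {A : Matrix n n ℝ}
  {N : ι → Matrix n n ℝ} {E : Matrix n κ ℝ}

theorem neg_lyap_compression_posSemidef [DecidableEq n] (hE : Eᵀ * E = 1) {S : Matrix n n ℝ}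
    {R : Matrix κ κ ℝ} (hSE : S * E = E * R) (hS : S.PosSemidef) (hL : (-lyap A N S).PosSemidef) :
    (-lyap (Eᵀ * A * E) (fun l => Eᵀ * N l * E) R).PosSemidef := by
  have hSt : Sᵀ = S := by simpa using hS.isHermitian.eq
  have hR : Eᵀ * S * E = R := by
    rw [Matrix.mul_assoc, hSE, ← Matrix.mul_assoc, hE, Matrix.one_mul]
  have hES : Eᵀ * S = R * Eᵀ := by
    have hRt : Rᵀ = R := by
      rw [← hR]
      simp only [transpose_mul, transpose_transpose, hSt, Matrix.mul_assoc]
    have := congrArg transpose hSE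
    rwa [transpose_mul, transpose_mul, hSt, hRt] at this
  have hSπ : S * (E * Eᵀ) = E * R * Eᵀ := by rw [← Matrix.mul_assoc, hSE]
  have hπSπ : E * Eᵀ * S * (E * Eᵀ) = E * R * Eᵀ := by
    rw [Matrix.mul_assoc E, hES, ← Matrix.mul_assoc, Matrix.mul_assoc (E * (R * Eᵀ)),
      ← Matrix.mul_assoc E R]
    simp only [Matrix.mul_assoc]
    rw [← Matrix.mul_assoc Eᵀ E, hE, Matrix.one_mul]
  have hπS : E * Eᵀ * S = E * R * Eᵀ := by rw [Matrix.mul_assoc, hES, Matrix.mul_assoc]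
  have hcompl : (1 - E * Eᵀ)ᵀ * S * (1 - E * Eᵀ) = S - E * R * Eᵀ := by
    simp only [transpose_sub, transpose_one, transpose_mul, transpose_transpose, sub_mul, mul_sub,
      one_mul, mul_one]
    rw [hSπ, hπSπ, hπS]
    abel
  have hN (l : ι) : ((1 - E * Eᵀ) * N l * E)ᵀ * S * ((1 - E * Eᵀ) * N l * E) =
      Eᵀ * ((N l)ᵀ * S * N l) * E - (Eᵀ * N l * E)ᵀ * R * (Eᵀ * N l * E) := by
    calc _ = Eᵀ * (N l)ᵀ * ((1 - E * Eᵀ)ᵀ * S * (1 - E * Eᵀ)) * N l * E := by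
          simp only [transpose_mul, Matrix.mul_assoc]
      _ = _ := by
          rw [hcompl]
          simp only [Matrix.mul_sub, Matrix.sub_mul, transpose_mul, transpose_transpose,
            Matrix.mul_assoc]
  have key : -lyap (Eᵀ * A * E) (fun l => Eᵀ * N l * E) R =
      Eᵀ * (-lyap A N S) * E +
        ∑ l, ((1 - E * Eᵀ) * N l * E)ᵀ * S * ((1 - E * Eᵀ) * N l * E) := by
    have h1 : (Eᵀ * A * E)ᵀ * R = Eᵀ * (Aᵀ * S) * E := by
      simp only [transpose_mul, transpose_transpose, Matrix.mul_assoc, hSE]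
    have h2 : R * (Eᵀ * A * E) = Eᵀ * (S * A) * E := by
      simp only [← Matrix.mul_assoc, hES]
    simp only [hN, lyap, h1, h2, Finset.sum_sub_distrib, Matrix.mul_neg, Matrix.neg_mul,
      Matrix.mul_add, Matrix.add_mul, Matrix.mul_sum, Matrix.sum_mul]
    abel
  rw [key]
  refine PosSemidef.add (by simpa using hL.conjTranspose_mul_mul_same E) ?_
  exact posSemidef_sum _ fun l _ => by
    simpa only [conjTranspose_eq_transpose_of_trivial] using
      hS.conjTranspose_mul_mul_same ((1 - E * Eᵀ) * N l * E)

theorem isCompressedFixed_of_lyapAdj_eq_zero (hE : Eᵀ * E = 1) {W : Matrix κ κ ℝ}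
    (hW : W.PosSemidef) (h : lyapAdj (Eᵀ * A * E) (fun l => Eᵀ * N l * E) W = 0) :
    IsCompressedFixed A N (E * Eᵀ) (E * W * Eᵀ) where
  posSemidef := by simpa using hW.mul_mul_conjTranspose_same E
  proj_mul := by
    simp only [Matrix.mul_assoc]
    rw [← Matrix.mul_assoc Eᵀ E, hE, Matrix.one_mul]
  fixed := by
    have hEE (Z : Matrix κ n ℝ) : Eᵀ * (E * Z) = Z := by
      rw [← Matrix.mul_assoc, hE, Matrix.one_mul]
    have : E * Eᵀ * lyapAdj A N (E * W * Eᵀ) * (E * Eᵀ) =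
        E * lyapAdj (Eᵀ * A * E) (fun l => Eᵀ * N l * E) W * Eᵀ := by
      simp only [lyapAdj, Matrix.mul_add, Matrix.add_mul, Matrix.mul_sum, Matrix.sum_mul,
        transpose_mul, transpose_transpose, Matrix.mul_assoc, hEE]
    rw [this, h]
    simp

/-- Truncation along an injection `f` preserves the Lyapunov stability criterion, when `diagonal σ`
and its inverse are both supersolutions and `f` does not separate equal values of `σ`. -/
theorem exists_posDef_lyap_submatrix [DecidableEq n] {f : κ → n} (hf : f.Injective) {σ : n → ℝ}
    (hσ : ∀ i, 0 < σ i) (hdisj : ∀ k, ∀ j ∉ Set.range f, σ (f k) ≠ σ j) {X : Matrix n n ℝ}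
    (hX : (-lyap A N X).PosDef) (h1 : (-lyap A N (diagonal σ)).PosSemidef)
    (h2 : (-lyap A N (diagonal σ)⁻¹).PosSemidef) :
    ∃ Y : Matrix κ κ ℝ, Y.PosDef ∧
      (-lyap (A.submatrix f f) (fun l => (N l).submatrix f f) Y).PosDef := by
  classical
  set E : Matrix n κ ℝ := (1 : Matrix n n ℝ).submatrix id f with hEdef
  have hsub (M : Matrix n n ℝ) : M.submatrix f f = Eᵀ * M * E := by
    ext k j
    simp [hEdef, mul_apply, one_apply]
  have hE : Eᵀ * E = 1 := by
    rw [← Matrix.mul_one Eᵀ, ← hsub, submatrix_one f hf]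
  have hπ : E * Eᵀ = diagonal fun i => if i ∈ Set.range f then 1 else 0 := by
    ext i j
    rw [mul_apply, diagonal_apply]
    simp only [hEdef, transpose_apply, submatrix_apply, id, one_apply]
    split_ifs with hij hi
    · obtain ⟨k, rfl⟩ := hi
      subst hij
      simp [hf.eq_iff]
    · refine Finset.sum_eq_zero fun k _ => ?_
      rw [if_neg fun hk => hi ⟨k, hk.symm⟩, zero_mul]
    · refine Finset.sum_eq_zero fun k _ => ?_
      by_cases hk : i = f k
      · rw [if_neg (c := j = f k) fun hk' => hij (hk.trans hk'.symm), mul_zero]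
      · rw [if_neg hk, zero_mul]
  have hSE : diagonal σ * E = E * diagonal (σ ∘ f) := by
    ext i k
    simp only [diagonal_mul, mul_diagonal, hEdef, submatrix_apply, id, one_apply]
    split_ifs with h <;> simp [h]
  have hS : (diagonal σ).PosDef := PosDef.diagonal hσ
  simp only [hsub]
  refine (exists_posDef_lyap_or_exists_lyapAdj_eq_zero _ _
    (PosDef.diagonal fun k => hσ (f k) : (diagonal (σ ∘ f)).PosDef)
    (neg_lyap_compression_posSemidef hE hSE hS.posSemidef h1)).resolve_right ?_
  rintro ⟨W, hW, hW0, hWfix⟩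
  have h := isCompressedFixed_of_lyapAdj_eq_zero hE hW hWfix
  have hπt : (E * Eᵀ)ᵀ = E * Eᵀ := by rw [hπ, diagonal_transpose]
  have hππ : E * Eᵀ * (E * Eᵀ) = E * Eᵀ := by
    rw [Matrix.mul_assoc, ← Matrix.mul_assoc Eᵀ E, hE, Matrix.one_mul]
  have hcomm (d : n → ℝ) : E * Eᵀ * diagonal d = diagonal d * (E * Eᵀ) := by
    rw [hπ, diagonal_mul_diagonal, diagonal_mul_diagonal]
    simp only [mul_comm]
  have hST : diagonal σ * diagonal (fun i => (σ i)⁻¹ ^ 2) = (diagonal σ)⁻¹ := by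
    refine (inv_eq_right_inv ?_).symm
    rw [diagonal_mul_diagonal, diagonal_mul_diagonal, ← diagonal_one]
    congr 1
    ext i
    have := (hσ i).ne'
    field_simp
  have hpow := h.mul_pow_mul (T := diagonal fun i => (σ i)⁻¹ ^ 2) hπt hππ (hcomm σ) (hcomm _)
    (by rw [diagonal_mul_diagonal, diagonal_mul_diagonal]; simp only [mul_comm])
    (diagonal_transpose _)
    (PosDef.diagonal fun i => pow_pos (inv_pos.2 (hσ i)) 2).isUnit hS
    (by rw [hST]; exact hS.inv.posSemidef) h1 (by rw [hST]; exact h2)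
  have hV0 (i j : n) (hi : i ∉ Set.range f) : (E * W * Eᵀ) i j = 0 := by
    rw [← h.proj_mul, hπ, diagonal_mul, if_neg hi, zero_mul]
  have hA : (1 - E * Eᵀ) * A * (E * W * Eᵀ) = 0 := by
    rw [mul_assoc, hπ, ← diagonal_one, diagonal_sub]
    ext i j
    rw [diagonal_mul, Matrix.zero_apply]
    by_cases hi : i ∈ Set.range f
    · simp [hi]
    · rw [mul_apply_eq_zero_of_mul_diagonal_pow (P := (· ∈ Set.range f)) hpow hV0, mul_zero]
      rintro _ ⟨k, rfl⟩ heq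
      refine hdisj k i hi ?_
      exact inv_injective
        ((pow_left_inj₀ (inv_pos.2 (hσ _)).le (inv_pos.2 (hσ _)).le two_ne_zero).1 heq)
  have hVzero := h.eq_zero hπt hA
    (fun l => h.compl_mul_eq_zero hπt hππ (hcomm σ) hS h1 l) hX
  refine hW0 ?_
  calc W = Eᵀ * E * W * (Eᵀ * E) := by rw [hE, Matrix.one_mul, Matrix.mul_one]
    _ = Eᵀ * (E * W * Eᵀ) * E := by simp only [Matrix.mul_assoc]
    _ = 0 := by rw [hVzero]; simp

end Compression

theorem lyap_sum_smul {q : Type*} [Fintype q] (A : Matrix n n ℝ) (N : q → Matrix n n ℝ)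
    (M : Matrix ι q ℝ) (X : Matrix n n ℝ) :
    lyap A (fun l => ∑ i, M l i • N i) X =
      Aᵀ * X + X * A + ∑ i, ∑ j, (Mᵀ * M) i j • ((N i)ᵀ * X * N j) := by
  rw [lyap]
  congr 1
  simp only [transpose_sum, transpose_smul, Finset.sum_mul, Finset.mul_sum, smul_mul_assoc,
    mul_smul_comm, smul_smul, mul_apply, transpose_apply, Finset.sum_smul,
    Finset.smul_sum]
  rw [Finset.sum_comm, Finset.sum_congr rfl fun _ _ => Finset.sum_comm, Finset.sum_comm]
  simp only [mul_comm]

end StochasticLyapunov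

/-- Truncation of a mean square asymptotically stable system with a type-II
Gramian having disjoint leading/trailing diagonal entries yields a mean square
asymptotically stable reduced pair. -/
theorem stmt_8 {n m p q r : ℕ} (hr : r < n)
    (A : Matrix (Fin n) (Fin n) ℝ) (N : Fin q → Matrix (Fin n) (Fin n) ℝ)
    (B : Matrix (Fin n) (Fin m) ℝ) (C : Matrix (Fin p) (Fin n) ℝ)
    (K : Matrix (Fin q) (Fin q) ℝ) (hK : K.PosSemidef)
    (hstable : ∃ X : Matrix (Fin n) (Fin n) ℝ, X.PosDef ∧
      (-(Aᵀ * X + X * A + ∑ i : Fin q, ∑ j : Fin q, K i j • ((N i)ᵀ * X * N j))).PosDef)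
    (σ : Fin n → ℝ) (hσpos : ∀ i, 0 < σ i)
    (hdisj : ∀ i j : Fin n, (i : ℕ) < r → r ≤ (j : ℕ) → σ i ≠ σ j)
    (hgram1 : (-(Cᵀ * C) -
      (Aᵀ * Matrix.diagonal σ + Matrix.diagonal σ * A +
        ∑ i : Fin q, ∑ j : Fin q, K i j • ((N i)ᵀ * Matrix.diagonal σ * N j))).PosSemidef)
    (hgram2 : (-((Matrix.diagonal σ)⁻¹ * B * Bᵀ * (Matrix.diagonal σ)⁻¹) -
      (Aᵀ * (Matrix.diagonal σ)⁻¹ + (Matrix.diagonal σ)⁻¹ * A +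
        ∑ i : Fin q, ∑ j : Fin q,
          K i j • ((N i)ᵀ * (Matrix.diagonal σ)⁻¹ * N j))).PosSemidef) :
    ∃ Xr : Matrix (Fin r) (Fin r) ℝ, Xr.PosDef ∧
      (-((A.submatrix (Fin.castLE hr.le) (Fin.castLE hr.le))ᵀ * Xr +
          Xr * A.submatrix (Fin.castLE hr.le) (Fin.castLE hr.le) +
          ∑ i : Fin q, ∑ j : Fin q,
            K i j • (((N i).submatrix (Fin.castLE hr.le) (Fin.castLE hr.le))ᵀ * Xr *
              (N j).submatrix (Fin.castLE hr.le) (Fin.castLE hr.le)))).PosDef := by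
  obtain ⟨M, rfl⟩ := exists_eq_conjTranspose_mul_self hK
  rw [conjTranspose_eq_transpose_of_trivial] at *
  obtain ⟨X, -, hX⟩ := hstable
  rw [← lyap_sum_smul] at hX hgram1 hgram2
  have hC : (Cᵀ * C).PosSemidef := by simpa using posSemidef_conjTranspose_mul_self C
  have hB : ((diagonal σ)⁻¹ * B * Bᵀ * (diagonal σ)⁻¹).PosSemidef := by
    have := posSemidef_self_mul_conjTranspose ((diagonal σ)⁻¹ * B)
    simpa [transpose_nonsing_inv, Matrix.mul_assoc] using this
  have h1 := hgram1.add hC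
  have h2 := hgram2.add hB
  rw [neg_sub_comm, sub_add_cancel] at h1 h2
  obtain ⟨Y, hY, hYL⟩ := exists_posDef_lyap_submatrix (Fin.castLE_injective hr.le) hσpos
    (fun k j hj => hdisj _ j k.isLt (by
      by_contra! hlt
      exact hj ⟨⟨j, hlt⟩, rfl⟩)) hX h1 h2
  refine ⟨Y, hY, ?_⟩
  rw [← lyap_sum_smul]
  convert hYL using 3 with l
  ext l i j
  simp [Matrix.sum_apply]
end

section
/- Let A, N_1, …, N_q ∈ ℝ^{n×n}, B ∈ ℝ^{n×m}, C ∈ ℝ^{p×n}, and let K = (k_{ij}) ∈ ℝ^{q×q} be symmetric positive semidefinite. Let Σ = diag(σ₁, …, σ_n) be a positive definite diagonal matrix satisfying the balanced Riccati equation AᵀΣ + ΣA + Σ_{i,j=1}^q N_iᵀ Σ N_j k_{ij} + CᵀC − ΣBBᵀΣ = 0 and the balanced Riccati inequality AᵀΣ⁻¹ + Σ⁻¹A + Σ_{i,j=1}^q N_iᵀ Σ⁻¹ N_j k_{ij} − CᵀC + Σ⁻¹BBᵀΣ⁻¹ ⪯ 0, and suppose Σ is stabilizing: there exists Y ≻ 0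 with (A−BBᵀΣ)ᵀY + Y(A−BBᵀΣ) + Σ_{i,j=1}^q N_iᵀ Y N_j k_{ij} ≺ 0. Write Σ = diag(Σ_r, Σ_{2}), with r < n, where the sets of diagonal entries of Σ_r = diag(σ₁, …, σ_r) and Σ_{2} = diag(σ_{r+1}, …, σ_n) are disjoint; let A_r, N_{i,r} be the leading r×r blocks of A, N_i and B_r the first r rows of B. Then the reduced closed-loop pair (A_r − B_rB_rᵀΣ_r, N_{i,r}) is mean square asymptotically stable: there exists a symmetric X_r ≻ 0 with (A_r − B_rB_rᵀΣ_r)ᵀX_r + X_r(A_r − B_rB_rᵀΣ_r) + Σ_{i,j=1}^q N_{i,r}ᵀ X_r N_{j,r} k_{ij} ≺ 0. -/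
open Matrix BigOperators

namespace LyapunovReduction

section General

variable {ι μ : Type*} [Fintype ι] [Fintype μ]

/-- The generalized Lyapunov operator `X ↦ Aᵀ X + X A + ∑ Nₗᵀ X Nₗ`. -/
def lyapunov (A : Matrix ι ι ℝ) (N : μ → Matrix ι ι ℝ) (X : Matrix ι ι ℝ) : Matrix ι ι ℝ :=
  Aᵀ * X + X * A + ∑ l, (N l)ᵀ * X * N l

/-- The trace dual `W ↦ A W + W Aᵀ + ∑ Nₗ W Nₗᵀ` of the generalized Lyapunov operator. -/
def lyapunovDual (A : Matrix ι ι ℝ) (N : μ → Matrix ι ι ℝ) :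
    Matrix ι ι ℝ →ₗ[ℝ] Matrix ι ι ℝ where
  toFun W := A * W + W * Aᵀ + ∑ l, N l * W * (N l)ᵀ
  map_add' V W := by
    simp only [mul_add, add_mul, Finset.sum_add_distrib]
    abel
  map_smul' c W := by
    simp only [Matrix.mul_smul, Matrix.smul_mul, ← Finset.smul_sum, ← smul_add, RingHom.id_apply]

theorem lyapunovDual_apply (A : Matrix ι ι ℝ) (N : μ → Matrix ι ι ℝ) (W : Matrix ι ι ℝ) :
    lyapunovDual A N W = A * W + W * Aᵀ + ∑ l, N l * W * (N l)ᵀ := rfl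

theorem trace_lyapunov_mul (A : Matrix ι ι ℝ) (N : μ → Matrix ι ι ℝ) (X W : Matrix ι ι ℝ) :
    (lyapunov A N X * W).trace = (X * lyapunovDual A N W).trace := by
  have h1 : (Aᵀ * X * W).trace = (X * (W * Aᵀ)).trace := by
    rw [Matrix.mul_assoc, Matrix.trace_mul_comm, Matrix.mul_assoc]
  have h2 (l : μ) : ((N l)ᵀ * X * N l * W).trace = (X * (N l * W * (N l)ᵀ)).trace := by
    rw [Matrix.mul_assoc, Matrix.mul_assoc, Matrix.trace_mul_comm]
    simp only [Matrix.mul_assoc]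
  simp only [lyapunov, lyapunovDual_apply, add_mul, mul_add, Finset.sum_mul, Finset.mul_sum,
    Matrix.trace_add, Matrix.trace_sum, h1, h2, Matrix.mul_assoc X A W]
  ring

theorem transpose_lyapunov (A : Matrix ι ι ℝ) (N : μ → Matrix ι ι ℝ) {X : Matrix ι ι ℝ}
    (hX : Xᵀ = X) : (lyapunov A N X)ᵀ = lyapunov A N X := by
  simp only [lyapunov, transpose_add, transpose_mul, transpose_sum, transpose_transpose, hX,
    Matrix.mul_assoc]
  abel

theorem transpose_lyapunovDual (A : Matrix ι ι ℝ) (N : μ → Matrix ι ι ℝ) {W : Matrix ι ι ℝ}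
    (hW : Wᵀ = W) : (lyapunovDual A N W)ᵀ = lyapunovDual A N W := by
  simp only [lyapunovDual_apply, transpose_add, transpose_mul, transpose_sum, transpose_transpose,
    hW, Matrix.mul_assoc]
  abel

theorem transpose_eq_of_posSemidef {κ : Type*} {W : Matrix κ κ ℝ} (hW : W.PosSemidef) : Wᵀ = W := by
  simpa using hW.isHermitian.eq

open scoped MatrixOrder in
theorem exists_eq_transpose_mul_self {κ : Type*} [Fintype κ] {P : Matrix κ κ ℝ}
    (hP : P.PosSemidef) : ∃ H : Matrix κ κ ℝ, P = Hᵀ * H := by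
  classical
  obtain ⟨H, hH⟩ := CStarAlgebra.nonneg_iff_eq_star_mul_self.1 hP.nonneg
  exact ⟨H, by simpa [star_eq_conjTranspose] using hH⟩

theorem trace_congr_mul_eq {H G X : Matrix ι ι ℝ} :
    (Xᵀ * (Hᵀ * H) * X * (Gᵀ * G)).trace = ((H * X * Gᵀ)ᴴ * (H * X * Gᵀ)).trace := by
  rw [← Matrix.mul_assoc _ Gᵀ G, Matrix.trace_mul_comm]
  simp only [conjTranspose_eq_transpose_of_trivial, transpose_mul, transpose_transpose,
    Matrix.mul_assoc]

theorem trace_congr_mul_nonneg {P W : Matrix ι ι ℝ} (hP : P.PosSemidef) (hW : W.PosSemidef)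
    (X : Matrix ι ι ℝ) : 0 ≤ (Xᵀ * P * X * W).trace := by
  obtain ⟨H, rfl⟩ := exists_eq_transpose_mul_self hP
  obtain ⟨G, rfl⟩ := exists_eq_transpose_mul_self hW
  rw [trace_congr_mul_eq]
  exact (posSemidef_conjTranspose_mul_self _).trace_nonneg

theorem mul_mul_eq_zero_of_trace {P W X : Matrix ι ι ℝ} (hP : P.PosSemidef) (hW : W.PosSemidef)
    (h : (Xᵀ * P * X * W).trace = 0) : P * X * W = 0 := by
  obtain ⟨H, rfl⟩ := exists_eq_transpose_mul_self hP
  obtain ⟨G, rfl⟩ := exists_eq_transpose_mul_self hW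
  rw [trace_congr_mul_eq, trace_conjTranspose_mul_self_eq_zero_iff] at h
  calc Hᵀ * H * X * (Gᵀ * G) = Hᵀ * (H * X * Gᵀ) * G := by simp only [Matrix.mul_assoc]
    _ = 0 := by rw [h, Matrix.mul_zero, Matrix.zero_mul]

theorem trace_mul_nonneg {P W : Matrix ι ι ℝ} (hP : P.PosSemidef) (hW : W.PosSemidef) :
    0 ≤ (P * W).trace := by
  classical
  simpa using trace_congr_mul_nonneg hP hW 1

theorem mul_eq_zero_of_trace {P W : Matrix ι ι ℝ} (hP : P.PosSemidef) (hW : W.PosSemidef)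
    (h : (P * W).trace = 0) : P * W = 0 := by
  classical
  simpa using mul_mul_eq_zero_of_trace (X := 1) hP hW (by simpa using h)

theorem eq_zero_of_trace_eq_zero {W : Matrix ι ι ℝ} (hW : W.PosSemidef) (h : W.trace = 0) :
    W = 0 := by
  classical
  simpa using mul_eq_zero_of_trace PosSemidef.one hW (by simpa using h)

theorem trace_pos_of_ne_zero {W : Matrix ι ι ℝ} (hW : W.PosSemidef) (h : W ≠ 0) :
    0 < W.trace :=
  lt_of_le_of_ne hW.trace_nonneg fun h0 => h (eq_zero_of_trace_eq_zero hW h0.symm)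

theorem abs_apply_le_trace {V : Matrix ι ι ℝ} (hV : V.PosSemidef) (i j : ι) :
    |V i j| ≤ V.trace := by
  classical
  have hdiag (k : ι) : V k k ≤ V.trace :=
    Finset.single_le_sum (f := fun k => V k k) (fun k _ => hV.diag_nonneg) (Finset.mem_univ k)
  have hsymm : V j i = V i j := congrFun (congrFun (transpose_eq_of_posSemidef hV) i) j
  have hquad (c : ℝ) : 0 ≤ V i i + c * V i j + (c * V j i + c * c * V j j) := by
    have := hV.dotProduct_mulVec_nonneg (Pi.single i 1 + Pi.single j c)
    simp only [star_trivial, mulVec_add, mulVec_single, dotProduct_add, add_dotProduct,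
      single_dotProduct] at this
    simp at this
    linarith
  have h1 := hquad 1
  have h2 := hquad (-1)
  have := hdiag i
  have := hdiag j
  rw [abs_le]
  constructor <;> linarith

theorem isClosed_posSemidef : IsClosed {V : Matrix ι ι ℝ | V.PosSemidef} := by
  simp only [posSemidef_iff_dotProduct_mulVec, Set.ofPred_and, Set.ofPred_forall]
  refine IsClosed.inter (isClosed_eq (continuous_id.matrix_conjTranspose) continuous_id) (isClosed_iInter fun x => ?_)
  exact isClosed_le continuous_const
    (continuous_const.dotProduct (continuous_id.matrix_mulVec continuous_const))

theorem isCompact_posSemidef_trace_le_one :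
    IsCompact {V : Matrix ι ι ℝ | V.PosSemidef ∧ V.trace ≤ 1} := by
  have hbox : IsCompact (Set.univ.pi fun _ : ι => Set.univ.pi fun _ : ι => Set.Icc (-1 : ℝ) 1) :=
    isCompact_univ_pi fun _ => isCompact_univ_pi fun _ => isCompact_Icc
  refine IsCompact.of_isClosed_subset (X := Matrix ι ι ℝ) hbox
    (isClosed_posSemidef.inter (isClosed_le continuous_id.matrix_trace continuous_const)) ?_
  rintro V ⟨hV, htr⟩ i - j -
  exact abs_le.1 ((abs_apply_le_trace hV i j).trans htr)

theorem trace_mul_of_linear [DecidableEq ι] (f : Matrix ι ι ℝ →ₗ[ℝ] ℝ) (M : Matrix ι ι ℝ) :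
    f M = ((Matrix.of fun i j => f (Matrix.single j i 1)) * M).trace := by
  conv_lhs => rw [matrix_eq_sum_single M]
  simp only [map_sum, trace, diag_apply, mul_apply, of_apply]
  rw [Finset.sum_comm]
  refine Finset.sum_congr rfl fun j _ => Finset.sum_congr rfl fun i _ => ?_
  have : Matrix.single i j (M i j) = M i j • Matrix.single i j (1 : ℝ) := by
    simp [smul_single]
  rw [this, map_smul, smul_eq_mul, mul_comm]

/-- A theorem of the alternative for linear maps on symmetric matrices. -/
theorem exists_posDef_or_exists_posSemidef (L : Matrix ι ι ℝ →ₗ[ℝ] Matrix ι ι ℝ)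
    (hL : ∀ V, Vᵀ = V → (L V)ᵀ = L V) :
    (∃ X : Matrix ι ι ℝ, X.PosDef ∧
      ∀ V : Matrix ι ι ℝ, V.PosSemidef → V ≠ 0 → (X * L V).trace < 0) ∨
    ∃ V : Matrix ι ι ℝ, V.PosSemidef ∧ (L V).PosSemidef ∧ V.trace + (L V).trace = 1 := by
  classical
  let T : Set (Matrix ι ι ℝ × Matrix ι ι ℝ) :=
    {p | p.1.PosSemidef ∧ p.2.PosSemidef ∧ p.1.trace + p.2.trace = 1}
  have hTcompact : IsCompact T := by
    refine IsCompact.of_isClosed_subset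
      (isCompact_posSemidef_trace_le_one.prod isCompact_posSemidef_trace_le_one)
      ((isClosed_posSemidef.preimage continuous_fst).inter
        ((isClosed_posSemidef.preimage continuous_snd).inter
          (isClosed_eq (by fun_prop) continuous_const))) ?_
    rintro p ⟨h1, h2, h⟩
    exact ⟨⟨h1, by linarith [h2.trace_nonneg]⟩, ⟨h2, by linarith [h1.trace_nonneg]⟩⟩
  have hTconvex : Convex ℝ T := by
    rintro p ⟨hp1, hp2, hp⟩ p' ⟨hp1', hp2', hp'⟩ a b ha hb hab
    refine ⟨(hp1.smul ha).add (hp1'.smul hb), (hp2.smul ha).add (hp2'.smul hb), ?_⟩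
    simp only [Prod.fst_add, Prod.snd_add, Prod.smul_fst, Prod.smul_snd, trace_add, trace_smul,
      smul_eq_mul]
    linear_combination a * hp + b * hp' + hab
  let F : Matrix ι ι ℝ × Matrix ι ι ℝ →ₗ[ℝ] Matrix ι ι ℝ :=
    LinearMap.snd ℝ _ _ - L ∘ₗ LinearMap.fst ℝ _ _
  have hFcont : Continuous F :=
    continuous_snd.sub (L.continuous_of_finiteDimensional.comp continuous_fst)
  by_cases h0 : (0 : Matrix ι ι ℝ) ∈ F '' T
  · obtain ⟨⟨V, Z⟩, ⟨hV, hZ, htr⟩, hF⟩ := h0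
    have hZL : Z = L V := sub_eq_zero.1 hF
    subst hZL
    exact Or.inr ⟨V, hV, hZ, htr⟩
  left
  have : LocallyConvexSpace ℝ (Matrix ι ι ℝ) :=
    inferInstanceAs (LocallyConvexSpace ℝ (ι → ι → ℝ))
  obtain ⟨f, u, hu, hf⟩ := geometric_hahn_banach_point_closed (hTconvex.linear_image F)
    (hTcompact.image hFcont).isClosed h0
  rw [map_zero] at hu
  obtain ⟨X₀, hX₀⟩ : ∃ X₀ : Matrix ι ι ℝ, ∀ M, f M = (X₀ * M).trace :=
    ⟨_, trace_mul_of_linear f.toLinearMap⟩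
  obtain ⟨X, hXsymm, hX⟩ : ∃ X : Matrix ι ι ℝ, Xᵀ = X ∧ ∀ M, Mᵀ = M → f M = (X * M).trace := by
    refine ⟨(1 / 2 : ℝ) • (X₀ + X₀ᵀ), ?_, fun M hM => ?_⟩
    · simp [add_comm]
    · have : (X₀ᵀ * M).trace = (X₀ * M).trace := by
        rw [← trace_transpose, transpose_mul, transpose_transpose, hM, trace_mul_comm]
      rw [hX₀, smul_mul, trace_smul, add_mul, trace_add, this, smul_eq_mul]
      ring
  have hneg (V : Matrix ι ι ℝ) (hV : V.PosSemidef) (hV0 : V ≠ 0) : (X * L V).trace < 0 := by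
    have ht := trace_pos_of_ne_zero hV hV0
    have := hf _ ⟨(V.trace⁻¹ • V, 0), ⟨hV.smul (inv_nonneg.2 ht.le), PosSemidef.zero, by
      simp [ht.ne']⟩, rfl⟩
    have hFV : F (V.trace⁻¹ • V, 0) = -(V.trace⁻¹ • L V) := by simp [F]
    rw [hFV, map_neg, map_smul, hX _ (hL V (transpose_eq_of_posSemidef hV)), smul_eq_mul] at this
    by_contra hcon
    have := mul_nonneg (inv_nonneg.2 ht.le) (not_lt.1 hcon)
    linarith
  refine ⟨X, PosDef.of_dotProduct_mulVec_pos (by simpa [IsHermitian] using hXsymm) ?_, hneg⟩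
  intro x hx
  have hV : (vecMulVec x x).PosSemidef := by simpa using posSemidef_vecMulVec_self_star x
  have ht : 0 < (vecMulVec x x).trace := by
    rw [trace_vecMulVec]
    simpa using dotProduct_star_self_pos_iff.2 hx
  have := hf _ ⟨(0, (vecMulVec x x).trace⁻¹ • vecMulVec x x),
    ⟨PosSemidef.zero, hV.smul (inv_nonneg.2 ht.le), by
      simp [inv_mul_cancel₀ ht.ne', -trace_vecMulVec]⟩, rfl⟩
  have hFV : F (0, (vecMulVec x x).trace⁻¹ • vecMulVec x x) =
      (vecMulVec x x).trace⁻¹ • vecMulVec x x := by simp [F]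
  rw [hFV, map_smul, hX _ (transpose_eq_of_posSemidef hV), smul_eq_mul, mul_vecMulVec,
    trace_vecMulVec] at this
  rw [star_trivial, dotProduct_comm]
  exact (pos_iff_pos_of_mul_pos (hu.trans this)).1 (inv_pos.2 ht)

/-- If `Q ≻ 0` and the Lyapunov operator maps `Q` to a negative semidefinite matrix, then either
the strict Lyapunov inequality is solvable or the dual operator has a positive semidefinite
kernel element. -/
theorem exists_posDef_or_exists_dual_kernel (A : Matrix ι ι ℝ) (N : μ → Matrix ι ι ℝ)
    {Q : Matrix ι ι ℝ} (hQ : Q.PosDef) (hLQ : (-lyapunov A N Q).PosSemidef) :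
    (∃ X : Matrix ι ι ℝ, X.PosDef ∧ (-lyapunov A N X).PosDef) ∨
    ∃ V : Matrix ι ι ℝ, V.PosSemidef ∧ V ≠ 0 ∧ lyapunovDual A N V = 0 := by
  classical
  rcases exists_posDef_or_exists_posSemidef (lyapunovDual A N)
    (fun V => transpose_lyapunovDual A N) with ⟨X, hX, hXneg⟩ | ⟨V, hV, hLV, htr⟩
  · refine Or.inl ⟨X, hX, PosDef.of_dotProduct_mulVec_pos ?_ fun x hx => ?_⟩
    · have := transpose_lyapunov A N (transpose_eq_of_posSemidef hX.posSemidef)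
      simp [IsHermitian, this]
    · have hV : (vecMulVec x x).PosSemidef := by simpa using posSemidef_vecMulVec_self_star x
      have hV0 : vecMulVec x x ≠ 0 := by
        intro h
        obtain ⟨i, hi⟩ := Function.ne_iff.1 hx
        have := congrFun (congrFun h i) i
        simp [vecMulVec_apply] at this
        exact hi this
      have := hXneg _ hV hV0
      rw [← trace_lyapunov_mul, mul_vecMulVec, trace_vecMulVec, dotProduct_comm] at this
      rw [star_trivial, neg_mulVec, dotProduct_neg]
      linarith
  · right
    have h1 : (Q * lyapunovDual A N V).trace = 0 := by
      refine le_antisymm ?_ (trace_mul_nonneg hQ.posSemidef hLV)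
      have := trace_mul_nonneg hLQ hV
      rw [neg_mul, trace_neg, trace_lyapunov_mul] at this
      linarith
    have h2 := mul_eq_zero_of_trace hQ.posSemidef hLV h1
    have h3 : lyapunovDual A N V = 0 := by
      rwa [hQ.isUnit.mul_right_eq_zero] at h2
    refine ⟨V, hV, ?_, h3⟩
    rintro rfl
    simp at htr

end General

section Truncation

variable {ι μ : Type*} [Fintype ι] [DecidableEq ι] [Fintype μ]

theorem sum_commutator_congr_eq (A : Matrix ι ι ℝ) (N : μ → Matrix ι ι ℝ)
    {Q D : Matrix ι ι ℝ} (hD : Dᵀ = D) (hDQ : D * Q = Q * D) :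
    ∑ l, (N l * D - D * N l)ᵀ * Q * (N l * D - D * N l) =
      D * lyapunov A N Q * D - D * lyapunov A N (Q * D) - lyapunov A N (Q * D) * D +
        lyapunov A N (Q * D * D) := by
  have hDQ' (M : Matrix ι ι ℝ) : D * (Q * M) = Q * (D * M) := by
    rw [← Matrix.mul_assoc, hDQ, Matrix.mul_assoc]
  simp only [lyapunov, transpose_sub, transpose_mul, hD, mul_add, add_mul, mul_sub, sub_mul,
    Finset.mul_sum, Finset.sum_mul, Finset.sum_sub_distrib, Matrix.mul_assoc, hDQ, hDQ']
  abel

theorem trace_diagonal_mul_eq_zero {H : Matrix ι ι ℝ} (hH : ∀ i, H i i = 0) (x : ι → ℝ) :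
    (diagonal x * H).trace = 0 := by
  simp [trace, diagonal_mul, hH]

theorem commute_of_dual_diag_eq_zero (A : Matrix ι ι ℝ) (N : μ → Matrix ι ι ℝ)
    {q d : ι → ℝ} (hq : ∀ i, 0 < q i)
    (hR : (-lyapunov A N (diagonal q)).PosSemidef)
    (hS : (-lyapunov A N (diagonal (q * d))).PosSemidef)
    {W : Matrix ι ι ℝ} (hW : W.PosSemidef) (hH : ∀ i, lyapunovDual A N W i i = 0) :
    (∀ l, N l * diagonal d * W = diagonal d * N l * W) ∧
      A * diagonal d * W = diagonal d * A * W := by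
  set Q := diagonal q with hQdef
  set D := diagonal d with hDdef
  have hQT : Qᵀ = Q := diagonal_transpose q
  have hDT : Dᵀ = D := diagonal_transpose d
  have hQpos : Q.PosDef := PosDef.diagonal hq
  have hDQ : D * Q = Q * D := by simp [hQdef, hDdef, mul_comm]
  have hQD : diagonal (q * d) = Q * D := by simp [hQdef, hDdef, Pi.mul_def]
  have hQDT : (Q * D)ᵀ = Q * D := by rw [transpose_mul, hQT, hDT, hDQ]
  rw [hQD] at hS
  have hQDD : Q * D * D = diagonal (fun i => q i * d i * d i) := by simp [hQdef, hDdef]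
  have hWT := transpose_eq_of_posSemidef hW
  have hRW : lyapunov A N Q * W = 0 := by
    have := mul_eq_zero_of_trace hR hW (by
      rw [neg_mul, trace_neg, trace_lyapunov_mul, trace_diagonal_mul_eq_zero hH, neg_zero])
    simpa using this
  have hSW : lyapunov A N (Q * D) * W = 0 := by
    have := mul_eq_zero_of_trace hS hW (by
      rw [neg_mul, trace_neg, trace_lyapunov_mul, ← hQD, trace_diagonal_mul_eq_zero hH, neg_zero])
    simpa using this
  have hWS : W * lyapunov A N (Q * D) = 0 := by
    have := congrArg transpose hSW
    rwa [transpose_mul, transpose_lyapunov A N hQDT, hWT, transpose_zero] at this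
  have hsum : ∑ l, ((N l * D - D * N l)ᵀ * Q * (N l * D - D * N l) * W).trace =
      (D * lyapunov A N Q * D * W).trace := by
    have h1 : (D * lyapunov A N (Q * D) * W).trace = 0 := by
      rw [Matrix.mul_assoc, hSW, Matrix.mul_zero, trace_zero]
    have h2 : (lyapunov A N (Q * D) * D * W).trace = 0 := by
      rw [Matrix.mul_assoc, trace_mul_comm, Matrix.mul_assoc, hWS, Matrix.mul_zero, trace_zero]
    have h3 : (lyapunov A N (Q * D * D) * W).trace = 0 := by
      rw [trace_lyapunov_mul, hQDD, trace_diagonal_mul_eq_zero hH]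
    rw [← trace_sum, ← Finset.sum_mul, sum_commutator_congr_eq A N hDT hDQ, add_mul, sub_mul,
      sub_mul, trace_add, trace_sub, trace_sub, h1, h2, h3]
    ring
  have hterm (l : μ) := trace_congr_mul_nonneg hQpos.posSemidef hW (N l * D - D * N l)
  have hDRD : 0 ≤ (Dᵀ * (-lyapunov A N Q) * D * W).trace := trace_congr_mul_nonneg hR hW D
  have hDRD' : (Dᵀ * (-lyapunov A N Q) * D * W).trace = -(D * lyapunov A N Q * D * W).trace := by
    rw [hDT, mul_neg, neg_mul, neg_mul, trace_neg]
  have hsum_nonneg := Finset.sum_nonneg fun l (_ : l ∈ Finset.univ) => hterm l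
  have hsum0 : ∑ l, ((N l * D - D * N l)ᵀ * Q * (N l * D - D * N l) * W).trace = 0 := by
    linarith
  have hRDW : lyapunov A N Q * D * W = 0 := by
    have := mul_mul_eq_zero_of_trace hR hW (X := D) (by linarith)
    simpa using this
  have hN (l : μ) : N l * D * W = D * N l * W := by
    have h0 := (Finset.sum_eq_zero_iff_of_nonneg fun l _ => hterm l).1 hsum0 l (Finset.mem_univ l)
    have h1 := mul_mul_eq_zero_of_trace hQpos.posSemidef hW h0
    rw [Matrix.mul_assoc, hQpos.isUnit.mul_right_eq_zero, sub_mul, sub_eq_zero] at h1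
    exact h1
  refine ⟨hN, ?_⟩
  have hN' (l : μ) : N l * (D * W) = D * (N l * W) := by simpa only [Matrix.mul_assoc] using hN l
  have hdiff : Q * (A * D * W - D * A * W) =
      lyapunov A N Q * D * W - lyapunov A N (Q * D) * W := by
    simp only [lyapunov, add_mul, mul_sub, Finset.sum_mul, Matrix.mul_assoc, hN']
    abel
  rw [hRDW, hSW, sub_zero, hQpos.isUnit.mul_right_eq_zero, sub_eq_zero] at hdiff
  exact hdiff

/-- A nonzero positive semidefinite matrix supported on the index set `I` whose image under the
dual Lyapunov operator vanishes on `I × I`. -/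
structure IsCriticalOn (A : Matrix ι ι ℝ) (N : μ → Matrix ι ι ℝ) (I : Set ι)
    (W : Matrix ι ι ℝ) : Prop where
  posSemidef : W.PosSemidef
  ne_zero : W ≠ 0
  apply_eq_zero : ∀ i ∉ I, ∀ j, W i j = 0
  dual_apply_eq_zero : ∀ i ∈ I, ∀ j ∈ I, lyapunovDual A N W i j = 0

namespace IsCriticalOn

variable {A : Matrix ι ι ℝ} {N : μ → Matrix ι ι ℝ} {I : Set ι} {W : Matrix ι ι ℝ}

omit [DecidableEq ι] in
theorem apply_eq_zero' (h : IsCriticalOn A N I W) (i : ι) {j : ι} (hj : j ∉ I) : W i j = 0 := by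
  rw [← transpose_eq_of_posSemidef h.posSemidef]
  exact h.apply_eq_zero j hj i

theorem dual_diag_eq_zero (h : IsCriticalOn A N I W) {q : ι → ℝ} (hq : ∀ i, 0 < q i)
    (hR : (-lyapunov A N (diagonal q)).PosSemidef) (i : ι) : lyapunovDual A N W i i = 0 := by
  have hnonneg (i : ι) : 0 ≤ lyapunovDual A N W i i := by
    by_cases hi : i ∈ I
    · exact (h.dual_apply_eq_zero i hi i hi).ge
    · have h1 : (A * W) i i = 0 := by
        rw [mul_apply]
        exact Finset.sum_eq_zero fun j _ => by rw [h.apply_eq_zero' j hi, mul_zero]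
      have h2 : (W * Aᵀ) i i = 0 := by
        rw [mul_apply]
        exact Finset.sum_eq_zero fun j _ => by rw [h.apply_eq_zero i hi j, zero_mul]
      rw [lyapunovDual_apply, Matrix.add_apply, Matrix.add_apply, h1, h2, Matrix.sum_apply]
      simp only [zero_add]
      refine Finset.sum_nonneg fun l _ => ?_
      have := h.posSemidef.mul_mul_conjTranspose_same (N l)
      exact this.diag_nonneg
  have htrace := trace_mul_nonneg hR h.posSemidef
  rw [neg_mul, trace_neg, trace_lyapunov_mul] at htrace
  have hexpand : (diagonal q * lyapunovDual A N W).trace =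
      ∑ i, q i * lyapunovDual A N W i i := by simp [trace, diagonal_mul]
  have hterm (i : ι) : 0 ≤ q i * lyapunovDual A N W i i := mul_nonneg (hq i).le (hnonneg i)
  have hsum : ∑ i, q i * lyapunovDual A N W i i = 0 :=
    le_antisymm (by linarith) (Finset.sum_nonneg fun i _ => hterm i)
  have := (Finset.sum_eq_zero_iff_of_nonneg fun i _ => hterm i).1 hsum i (Finset.mem_univ i)
  exact (mul_eq_zero.1 this).resolve_left (hq i).ne'

theorem dual_congr {E : Matrix ι ι ℝ} (hE : Eᵀ = E) (hW : Wᵀ = W)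
    (hN : ∀ l, N l * E * W = E * N l * W) (hA : A * E * W = E * A * W) :
    lyapunovDual A N (E * W * E) = E * lyapunovDual A N W * E := by
  have hA' (M : Matrix ι ι ℝ) : A * (E * (W * M)) = E * (A * (W * M)) := by
    simpa only [Matrix.mul_assoc] using congrArg (· * M) hA
  have hN' (l : μ) (M : Matrix ι ι ℝ) : N l * (E * (W * M)) = E * (N l * (W * M)) := by
    simpa only [Matrix.mul_assoc] using congrArg (· * M) (hN l)
  have hAt : W * (E * Aᵀ) = W * (Aᵀ * E) := by
    simpa only [transpose_mul, hE, hW, Matrix.mul_assoc] using congrArg transpose hA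
  have hNt (l : μ) : W * (E * (N l)ᵀ) = W * ((N l)ᵀ * E) := by
    simpa only [transpose_mul, hE, hW, Matrix.mul_assoc] using congrArg transpose (hN l)
  simp only [lyapunovDual_apply, mul_add, add_mul, Finset.mul_sum, Finset.sum_mul,
    Matrix.mul_assoc, hA', hN', hAt, hNt]

theorem diagonal_congr (h : IsCriticalOn A N I W) {e : ι → ℝ}
    (hN : ∀ l, N l * diagonal e * W = diagonal e * N l * W)
    (hA : A * diagonal e * W = diagonal e * A * W) (hne : diagonal e * W ≠ 0) :
    IsCriticalOn A N I (diagonal e * W * diagonal e) := by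
  have hpsd : (diagonal e * W * diagonal e).PosSemidef := by
    simpa using h.posSemidef.mul_mul_conjTranspose_same (diagonal e)
  refine ⟨hpsd, fun h0 => hne ?_, fun i hi j => ?_, fun i hi j hj => ?_⟩
  · have := mul_mul_eq_zero_of_trace (PosSemidef.one (n := ι) (R := ℝ)) h.posSemidef
      (X := diagonal e) (by
        rw [diagonal_transpose, Matrix.mul_one, Matrix.mul_assoc, trace_mul_comm, h0, trace_zero])
    simpa using this
  · simp [mul_diagonal, diagonal_mul, h.apply_eq_zero i hi j]
  · rw [dual_congr (diagonal_transpose e) (transpose_eq_of_posSemidef h.posSemidef) hN hA,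
      mul_diagonal, diagonal_mul, h.dual_apply_eq_zero i hi j hj, mul_zero, zero_mul]

open Classical in
/-- Among the critical matrices there is one whose range lies in an eigenspace of
`diagonal d`. -/
theorem exists_eigen (h : IsCriticalOn A N I W) {q d : ι → ℝ} (hq : ∀ i, 0 < q i)
    (hR : (-lyapunov A N (diagonal q)).PosSemidef)
    (hS : (-lyapunov A N (diagonal (q * d))).PosSemidef) :
    ∃ W' : Matrix ι ι ℝ, IsCriticalOn A N I W' ∧
      ∃ k ∈ I, diagonal d * W' = d k • W' := by
  let rows (V : Matrix ι ι ℝ) : Finset ι := {i | V i ≠ 0}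
  obtain ⟨V, hV, hmin⟩ := WellFounded.has_min
    (measure fun V : Matrix ι ι ℝ => (rows V).card).wf {V | IsCriticalOn A N I V} ⟨W, h⟩
  refine ⟨V, hV, ?_⟩
  obtain ⟨k, hk⟩ : ∃ k, V k ≠ 0 := Function.ne_iff.1 hV.ne_zero
  refine ⟨k, ?_, ?_⟩
  · by_contra hkI
    exact hk (funext fun j => hV.apply_eq_zero k hkI j)
  obtain ⟨hN, hA⟩ := commute_of_dual_diag_eq_zero A N hq hR hS hV.posSemidef
    (hV.dual_diag_eq_zero hq hR)
  by_contra hne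
  have he : diagonal (fun i => d i - d k) = diagonal d - d k • (1 : Matrix ι ι ℝ) := by
    ext i j
    by_cases hij : i = j <;> simp [hij]
  have hcrit := hV.diagonal_congr (e := fun i => d i - d k)
    (fun l => by simp [he, mul_sub, sub_mul, hN l])
    (by simp [he, mul_sub, sub_mul, hA])
    (by simpa [he, sub_mul, sub_eq_zero] using hne)
  refine hmin _ hcrit (Finset.card_lt_card ?_)
  refine Finset.ssubset_iff_of_subset (fun i hi => ?_) |>.2 ⟨k, by simpa [rows] using hk, ?_⟩
  · simp only [rows, Finset.mem_filter, Finset.mem_univ, true_and] at hi ⊢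
    refine fun h0 => hi (funext fun j => ?_)
    simp [mul_diagonal, diagonal_mul, h0]
  · simp only [rows, Finset.mem_filter, Finset.mem_univ, true_and, not_not]
    funext j
    simp [mul_diagonal, diagonal_mul]

end IsCriticalOn

/-- If the Lyapunov operator is stable, there are no critical matrices on an index set separated
from its complement by `d`. -/
theorem not_isCriticalOn {A : Matrix ι ι ℝ} {N : μ → Matrix ι ι ℝ} {I : Set ι}
    {q d : ι → ℝ} (hq : ∀ i, 0 < q i)
    (hR : (-lyapunov A N (diagonal q)).PosSemidef)
    (hS : (-lyapunov A N (diagonal (q * d))).PosSemidef)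
    (hd : ∀ i ∈ I, ∀ j ∉ I, d i ≠ d j)
    {Y : Matrix ι ι ℝ} (hY : (-lyapunov A N Y).PosDef) (W : Matrix ι ι ℝ) :
    ¬ IsCriticalOn A N I W := by
  intro hW
  obtain ⟨V, hV, k, hk, hkV⟩ := hW.exists_eigen hq hR hS
  obtain ⟨hN, hA⟩ := commute_of_dual_diag_eq_zero A N hq hR hS hV.posSemidef
    (hV.dual_diag_eq_zero hq hR)
  have hrow {M : Matrix ι ι ℝ} (hM : M * diagonal d * V = diagonal d * M * V) {i : ι}
      (hi : i ∉ I) (j : ι) : (M * V) i j = 0 := by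
    rw [Matrix.mul_assoc, hkV, Matrix.mul_smul, Matrix.mul_assoc] at hM
    have := congrFun (congrFun hM i) j
    rw [diagonal_mul, Matrix.smul_apply, smul_eq_mul] at this
    have hne := sub_ne_zero.2 (hd k hk i hi)
    refine (mul_eq_zero.1 ?_).resolve_left hne
    rw [sub_mul, this, sub_self]
  have hHrow {i : ι} (hi : i ∉ I) (j : ι) : lyapunovDual A N V i j = 0 := by
    have h2 : (V * Aᵀ) i j = 0 := by
      rw [mul_apply]
      exact Finset.sum_eq_zero fun j _ => by rw [hV.apply_eq_zero i hi j, zero_mul]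
    rw [lyapunovDual_apply, Matrix.add_apply, Matrix.add_apply, hrow hA hi, h2, Matrix.sum_apply, zero_add,
      zero_add]
    refine Finset.sum_eq_zero fun l _ => ?_
    rw [mul_apply]
    exact Finset.sum_eq_zero fun j _ => by rw [hrow (hN l) hi j, zero_mul]
  have hH : lyapunovDual A N V = 0 := by
    ext i j
    by_cases hi : i ∈ I
    · by_cases hj : j ∈ I
      · exact hV.dual_apply_eq_zero i hi j hj
      · rw [← transpose_lyapunovDual A N (transpose_eq_of_posSemidef hV.posSemidef)]
        exact hHrow hj i
    · exact hHrow hi j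
  have := mul_eq_zero_of_trace hY.posSemidef hV.posSemidef (by
    rw [neg_mul, trace_neg, trace_lyapunov_mul, hH, Matrix.mul_zero, trace_zero, neg_zero])
  rw [hY.isUnit.mul_right_eq_zero] at this
  exact hV.ne_zero this

end Truncation

section Compression

variable {ι κ μ : Type*} [Fintype ι] [DecidableEq ι] [Fintype κ] [DecidableEq κ] [Fintype μ]

/-- The matrix whose columns are the standard basis vectors selected by `c`. -/
def selection (c : κ → ι) : Matrix ι κ ℝ := (1 : Matrix ι ι ℝ).submatrix id c

omit [Fintype κ] [DecidableEq κ] in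
theorem submatrix_eq_selection (c : κ → ι) (M : Matrix ι ι ℝ) :
    M.submatrix c c = (selection c)ᵀ * M * selection c := by
  ext a b
  simp [selection, mul_apply, one_apply]

omit [Fintype κ] in
theorem selection_transpose_mul_self {c : κ → ι} (hc : Function.Injective c) :
    (selection c)ᵀ * selection c = 1 := by
  have := submatrix_eq_selection c 1
  rwa [submatrix_one c hc, Matrix.mul_one, eq_comm] at this

theorem diagonal_mul_selection (c : κ → ι) (q : ι → ℝ) :
    diagonal q * selection c = selection c * diagonal (q ∘ c) := by
  ext i k
  by_cases h : i = c k <;> simp [selection, diagonal_mul, mul_diagonal, h, mul_comm]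

theorem neg_lyapunov_submatrix_posSemidef {A : Matrix ι ι ℝ} {N : μ → Matrix ι ι ℝ} {q : ι → ℝ}
    (hq : ∀ i, 0 < q i) (hR : (-lyapunov A N (diagonal q)).PosSemidef) {c : κ → ι}
    (hc : Function.Injective c) :
    (-lyapunov (A.submatrix c c) (fun l => (N l).submatrix c c)
      (diagonal (q ∘ c))).PosSemidef := by
  set J := selection c with hJ
  set Q := diagonal q with hQ
  have hJJ : Jᵀ * J = 1 := selection_transpose_mul_self hc
  have hQJ : J * diagonal (q ∘ c) = Q * J := (diagonal_mul_selection c q).symm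
  have hJQ : diagonal (q ∘ c) * Jᵀ = Jᵀ * Q := by
    simpa [hQ, transpose_mul] using congrArg transpose hQJ
  have hJJ' (M : Matrix κ κ ℝ) : Jᵀ * (J * M) = M := by
    rw [← Matrix.mul_assoc, hJJ, Matrix.one_mul]
  have hJQ' (M : Matrix ι κ ℝ) : diagonal (q ∘ c) * (Jᵀ * M) = Jᵀ * (Q * M) := by
    rw [← Matrix.mul_assoc, hJQ, Matrix.mul_assoc]
  have hcomm (M : Matrix ι κ ℝ) : Q * (J * (Jᵀ * M)) = J * (Jᵀ * (Q * M)) := by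
    rw [← hJQ', ← Matrix.mul_assoc J (diagonal (q ∘ c)), hQJ, Matrix.mul_assoc Q]
  have hP : (1 - J * Jᵀ)ᴴ = 1 - J * Jᵀ := by simp
  have hterm (l : μ) : ((N l * J)ᴴ * ((1 - J * Jᵀ)ᴴ * Q * (1 - J * Jᵀ)) * (N l * J)).PosSemidef :=
    ((PosSemidef.diagonal fun i => (hq i).le).conjTranspose_mul_mul_same _).conjTranspose_mul_mul_same
      _
  have heq : -lyapunov (A.submatrix c c) (fun l => (N l).submatrix c c) (diagonal (q ∘ c)) =
      Jᴴ * (-lyapunov A N Q) * J +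
        ∑ l, (N l * J)ᴴ * ((1 - J * Jᵀ)ᴴ * Q * (1 - J * Jᵀ)) * (N l * J) := by
    rw [hP]
    simp only [lyapunov, submatrix_eq_selection, ← hJ, conjTranspose_eq_transpose_of_trivial,
      transpose_mul, transpose_transpose, Matrix.mul_add, Matrix.add_mul, Matrix.mul_sub,
      Matrix.sub_mul, Matrix.mul_neg, Matrix.neg_mul, Matrix.mul_one, Matrix.one_mul,
      Matrix.mul_sum, Matrix.sum_mul, Finset.sum_sub_distrib,
      Matrix.mul_assoc, hQJ, hJQ', hcomm, hJJ']
    abel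
  rw [heq]
  exact (hR.conjTranspose_mul_mul_same J).add (posSemidef_sum _ fun l _ => hterm l)

theorem isCriticalOn_of_submatrix {A : Matrix ι ι ℝ} {N : μ → Matrix ι ι ℝ} {c : κ → ι}
    (hc : Function.Injective c) {V : Matrix κ κ ℝ} (hV : V.PosSemidef) (hV0 : V ≠ 0)
    (hdual : lyapunovDual (A.submatrix c c) (fun l => (N l).submatrix c c) V = 0) :
    IsCriticalOn A N (Set.range c) (selection c * V * (selection c)ᵀ) := by
  set J := selection c with hJ
  have hJJ : Jᵀ * J = 1 := selection_transpose_mul_self hc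
  have hJJ' (M : Matrix κ κ ℝ) : Jᵀ * (J * M) = M := by
    rw [← Matrix.mul_assoc, hJJ, Matrix.one_mul]
  refine ⟨?_, fun h => hV0 ?_, ?_, ?_⟩
  · simpa using hV.mul_mul_conjTranspose_same J
  · have := congrArg (fun M => Jᵀ * M * J) h
    simpa [Matrix.mul_assoc, hJJ, hJJ'] using this
  · intro i hi j
    have hrow (k : κ) : J i k = 0 := by
      rw [hJ, selection, submatrix_apply, id, one_apply_ne]
      rintro rfl
      exact hi ⟨k, rfl⟩
    rw [Matrix.mul_assoc, mul_apply]
    exact Finset.sum_eq_zero fun k _ => by rw [hrow, zero_mul]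
  · rintro _ ⟨a, rfl⟩ _ ⟨b, rfl⟩
    have heq : (lyapunovDual A N (J * V * Jᵀ)).submatrix c c =
        lyapunovDual (A.submatrix c c) (fun l => (N l).submatrix c c) V := by
      simp only [lyapunovDual_apply, submatrix_eq_selection, ← hJ, transpose_mul,
        transpose_transpose, Matrix.mul_add, Matrix.add_mul, Matrix.mul_sum, Matrix.sum_mul,
        Matrix.mul_assoc, hJJ, hJJ', Matrix.mul_one]
    rw [hdual] at heq
    exact congrFun (congrFun heq a) b

/-- Truncation to the index set selected by `c` preserves stability when the generalized
eigenvalues `d` of the two diagonal solutions separate kept and truncated indices. -/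
theorem exists_posDef_submatrix {A : Matrix ι ι ℝ} {N : μ → Matrix ι ι ℝ} {q d : ι → ℝ}
    (hq : ∀ i, 0 < q i) (hR : (-lyapunov A N (diagonal q)).PosSemidef)
    (hS : (-lyapunov A N (diagonal (q * d))).PosSemidef) {c : κ → ι}
    (hc : Function.Injective c) (hd : ∀ i ∈ Set.range c, ∀ j ∉ Set.range c, d i ≠ d j)
    {Y : Matrix ι ι ℝ} (hY : (-lyapunov A N Y).PosDef) :
    ∃ X : Matrix κ κ ℝ, X.PosDef ∧
      (-lyapunov (A.submatrix c c) (fun l => (N l).submatrix c c) X).PosDef := by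
  refine (exists_posDef_or_exists_dual_kernel _ _ (PosDef.diagonal fun k => hq (c k))
    (neg_lyapunov_submatrix_posSemidef hq hR hc)).resolve_right ?_
  rintro ⟨V, hV, hV0, hdual⟩
  exact not_isCriticalOn hq hR hS hd hY _ (isCriticalOn_of_submatrix hc hV hV0 hdual)

end Compression

theorem sum_transpose_mul_mul_eq {ι ν : Type*} [Fintype ι] [Fintype ν] (G : Matrix ν ν ℝ)
    (N : ν → Matrix ι ι ℝ) (X : Matrix ι ι ℝ) :
    ∑ l, (∑ i, G l i • N i)ᵀ * X * (∑ j, G l j • N j) =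
      ∑ i, ∑ j, (Gᵀ * G) i j • ((N i)ᵀ * X * N j) := by
  simp only [transpose_sum, transpose_smul, Finset.sum_mul, Finset.mul_sum, Matrix.smul_mul,
    Matrix.mul_smul, smul_smul, mul_apply, transpose_apply, Finset.sum_smul]
  rw [Finset.sum_comm]
  conv_rhs => rw [Finset.sum_comm]
  refine Finset.sum_congr rfl fun i _ => ?_
  rw [Finset.sum_comm]
  refine Finset.sum_congr rfl fun j _ => ?_
  exact Finset.sum_congr rfl fun l _ => by rw [mul_comm]

end LyapunovReduction

/-- LQG balanced truncation preserves closed-loop mean square asymptotic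
stability when the kept and truncated singular values are disjoint. -/
theorem stmt_9 {n m p q r : ℕ} (hr : r < n)
    (A : Matrix (Fin n) (Fin n) ℝ) (N : Fin q → Matrix (Fin n) (Fin n) ℝ)
    (B : Matrix (Fin n) (Fin m) ℝ) (C : Matrix (Fin p) (Fin n) ℝ)
    (K : Matrix (Fin q) (Fin q) ℝ) (hK : K.PosSemidef)
    (σ : Fin n → ℝ) (hσpos : ∀ i, 0 < σ i)
    (hdisj : ∀ i j : Fin n, (i : ℕ) < r → r ≤ (j : ℕ) → σ i ≠ σ j)
    (hric : Aᵀ * Matrix.diagonal σ + Matrix.diagonal σ * A +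
      (∑ i : Fin q, ∑ j : Fin q, K i j • ((N i)ᵀ * Matrix.diagonal σ * N j)) +
      Cᵀ * C - Matrix.diagonal σ * B * Bᵀ * Matrix.diagonal σ = 0)
    (hineq : (-(Aᵀ * (Matrix.diagonal σ)⁻¹ + (Matrix.diagonal σ)⁻¹ * A +
      (∑ i : Fin q, ∑ j : Fin q, K i j • ((N i)ᵀ * (Matrix.diagonal σ)⁻¹ * N j)) -
      Cᵀ * C + (Matrix.diagonal σ)⁻¹ * B * Bᵀ * (Matrix.diagonal σ)⁻¹)).PosSemidef)
    (hstab : ∃ Y : Matrix (Fin n) (Fin n) ℝ, Y.PosDef ∧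
      (-((A - B * Bᵀ * Matrix.diagonal σ)ᵀ * Y + Y * (A - B * Bᵀ * Matrix.diagonal σ) +
        ∑ i : Fin q, ∑ j : Fin q, K i j • ((N i)ᵀ * Y * N j))).PosDef) :
    ∃ Xr : Matrix (Fin r) (Fin r) ℝ, Xr.PosDef ∧
      (-((A.submatrix (Fin.castLE hr.le) (Fin.castLE hr.le) -
            B.submatrix (Fin.castLE hr.le) id *
            (B.submatrix (Fin.castLE hr.le) id)ᵀ *
            Matrix.diagonal (σ ∘ Fin.castLE hr.le))ᵀ * Xr +
        Xr * (A.submatrix (Fin.castLE hr.le) (Fin.castLE hr.le) -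
            B.submatrix (Fin.castLE hr.le) id *
            (B.submatrix (Fin.castLE hr.le) id)ᵀ *
            Matrix.diagonal (σ ∘ Fin.castLE hr.le)) +
        ∑ i : Fin q, ∑ j : Fin q,
          K i j • (((N i).submatrix (Fin.castLE hr.le) (Fin.castLE hr.le))ᵀ * Xr *
            (N j).submatrix (Fin.castLE hr.le) (Fin.castLE hr.le)))).PosDef := by
  obtain ⟨Y, -, hY⟩ := hstab
  obtain ⟨G, rfl⟩ := LyapunovReduction.exists_eq_transpose_mul_self hK
  have hinv : (diagonal σ)⁻¹ = diagonal (fun i => (σ i)⁻¹) := by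
    refine inv_eq_right_inv ?_
    rw [diagonal_mul_diagonal, ← diagonal_one]
    exact congrArg diagonal (funext fun i => mul_inv_cancel₀ (hσpos i).ne')
  have hmul : diagonal (σ * fun i => 1 + (σ i ^ 2)⁻¹) =
      diagonal σ + diagonal (fun i => (σ i)⁻¹) := by
    rw [diagonal_add]
    refine congrArg diagonal (funext fun i => ?_)
    have := (hσpos i).ne'
    simp only [Pi.mul_apply]
    field_simp
  rw [hinv] at hineq
  simp only [← LyapunovReduction.sum_transpose_mul_mul_eq] at hric hineq hY ⊢
  set M : Fin q → Matrix (Fin n) (Fin n) ℝ := fun l => ∑ i, G l i • N i with hM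
  set Q := diagonal σ with hQ
  set T := diagonal (fun i => (σ i)⁻¹) with hT
  set Ac := A - B * Bᵀ * Q with hAc
  have hQt : Qᵀ = Q := diagonal_transpose σ
  have hTt : Tᵀ = T := diagonal_transpose _
  have hsum : ∑ l, (M l)ᵀ * (Q * M l) = Q * (B * (Bᵀ * Q)) - Cᵀ * C - (Aᵀ * Q + Q * A) := by
    rw [← sub_eq_zero, ← hric]
    simp only [hM, Matrix.mul_assoc]
    abel
  have hR : (-LyapunovReduction.lyapunov Ac M Q).PosSemidef := by
    have heq : -LyapunovReduction.lyapunov Ac M Q = Cᴴ * C + (Bᵀ * Q)ᴴ * (Bᵀ * Q) := by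
      simp only [LyapunovReduction.lyapunov, hsum, hAc, conjTranspose_eq_transpose_of_trivial,
        transpose_sub, transpose_mul, transpose_transpose, hQt, Matrix.mul_sub, Matrix.sub_mul,
        Matrix.mul_assoc]
      abel
    rw [heq]
    exact (posSemidef_conjTranspose_mul_self _).add (posSemidef_conjTranspose_mul_self _)
  have hS : (-LyapunovReduction.lyapunov Ac M
      (diagonal (σ * fun i => 1 + (σ i ^ 2)⁻¹))).PosSemidef := by
    have heq : -LyapunovReduction.lyapunov Ac M (Q + T) =
        -(Aᵀ * T + T * A + ∑ l, (M l)ᵀ * T * M l - Cᵀ * C + T * B * Bᵀ * T) +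
          (Bᵀ * (Q + T))ᴴ * (Bᵀ * (Q + T)) := by
      simp only [LyapunovReduction.lyapunov, Matrix.mul_add, Matrix.add_mul,
        Finset.sum_add_distrib, hsum, hAc, conjTranspose_eq_transpose_of_trivial,
        transpose_sub, transpose_add, transpose_mul, transpose_transpose, hQt, hTt,
        Matrix.mul_sub, Matrix.sub_mul, Matrix.mul_assoc]
      abel
    rw [hmul, heq]
    exact hineq.add (posSemidef_conjTranspose_mul_self _)
  have hc : Function.Injective (Fin.castLE hr.le) := Fin.castLE_injective hr.le
  obtain ⟨X, hX, hLX⟩ := LyapunovReduction.exists_posDef_submatrix hσpos hR hS hc (by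
    rintro _ ⟨i, rfl⟩ j hj h
    have hrj : r ≤ (j : ℕ) := by
      by_contra hlt
      exact hj ⟨⟨j, not_le.1 hlt⟩, rfl⟩
    refine hdisj (Fin.castLE hr.le i) j i.2 hrj ?_
    have := inv_injective (add_left_cancel h)
    exact (pow_left_inj₀ (hσpos _).le (hσpos _).le two_ne_zero).1 this) hY
  refine ⟨X, hX, ?_⟩
  have hAr : A.submatrix (Fin.castLE hr.le) (Fin.castLE hr.le) -
      B.submatrix (Fin.castLE hr.le) id * (B.submatrix (Fin.castLE hr.le) id)ᵀ *
        diagonal (σ ∘ Fin.castLE hr.le) =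
      Ac.submatrix (Fin.castLE hr.le) (Fin.castLE hr.le) := by
    ext i j
    simp only [hAc, hQ, Matrix.sub_apply, submatrix_apply, mul_diagonal]
    simp [mul_apply]
  have hMr (l : Fin q) : ∑ i, G l i • (N i).submatrix (Fin.castLE hr.le) (Fin.castLE hr.le) =
      (M l).submatrix (Fin.castLE hr.le) (Fin.castLE hr.le) := by
    ext a b
    simp [hM, Matrix.sum_apply]
  rw [hAr]
  simp only [hMr]
  exact hLX
end
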